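/- arXiv:2005.01886 — 3 statements merged into one kernel-verified Lean document; each statement's English description precedes it below -/
import Mathlib

section
/- Let Ω be a metric space each of whose separable subspaces is sigma-finite dimensional in the sense of Nagata and Preiss. Then the k-nearest neighbour classifier is universally consistent in Ω if and only if the density of Ω is strictly less than every real-valued measurable cardinal. -/
open MeasureTheory Filter Set Metric Cardinal
open scoped ENNReal

noncomputable section

universe u

/-- A cardinal `τ` is *real-valued measurable* if a set of cardinality `τ` carries a
probability measure defined on *all* subsets, vanishing on singletons, whose ideal of
null sets is closed under unions of fewer than `τ` members. -/
def IsRealValuedMeasurableCardinal (τ : Cardinal.{u}) : Prop :=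
  ∃ μ : @Measure τ.out ⊤,
    μ Set.univ = 1 ∧
    (∀ x : τ.out, μ {x} = 0) ∧
    ∀ 𝒩 : Set (Set τ.out), #𝒩 < τ → (∀ A ∈ 𝒩, μ A = 0) → μ (⋃₀ 𝒩) = 0

/-- The density of a topological space: the least cardinality of a dense subset. -/
def densityCard (X : Type u) [TopologicalSpace X] : Cardinal.{u} :=
  sInf {c : Cardinal.{u} | ∃ s : Set X, Dense s ∧ #s = c}

/-- The label assigned to the point `x` by the `k`-nearest-neighbour rule on the labelled
sample `σ`, distance ties being broken according to the ordering `π` of the sample, and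
voting ties broken in favour of the label `1` (`true`).  An index `i` is among the `k`
nearest neighbours of `x` iff fewer than `k` indices precede it in the lexicographic
order (distance to `x`, position under `π`). -/
def kNNLabel {Ω : Type u} [MetricSpace Ω] (n k : ℕ) (σ : Fin n → Ω × Bool)
    (π : Equiv.Perm (Fin n)) (x : Ω) : Bool :=
  let nearer : Fin n → Fin n → Prop := fun j i =>
    dist x (σ j).1 < dist x (σ i).1 ∨ (dist x (σ j).1 = dist x (σ i).1 ∧ π j < π i)
  let S : Set (Fin n) := {i | Set.ncard {j | nearer j i} < k}
  decide (k ≤ 2 * Set.ncard {i ∈ S | (σ i).2 = true})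

/-- The expected misclassification error of the `k`-nearest neighbour rule at sample
size `n`, for i.i.d. data with law `μt`, the tie-breaking order of the sample being
chosen uniformly at random among all `n!` orderings. -/
def kNNError {Ω : Type u} [MetricSpace Ω] [MeasurableSpace Ω]
    (μt : Measure (Ω × Bool)) (n k : ℕ) : ℝ≥0∞ :=
  (∑ π : Equiv.Perm (Fin n),
      (Measure.pi fun _ : Fin n => μt).prod μt
        {q : (Fin n → Ω × Bool) × (Ω × Bool) | kNNLabel n k q.1 π q.2.1 ≠ q.2.2}) /
    (Nat.factorial n : ℝ≥0∞)

/-- The Bayes (optimal) error of the learning problem given by a probability measure on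
`Ω × {0,1}`: the infimum of the misclassification errors of all measurable classifiers. -/
def bayesError {Ω : Type u} [MeasurableSpace Ω] (μt : Measure (Ω × Bool)) : ℝ≥0∞ :=
  ⨅ (T : Ω → Bool) (_ : Measurable T), μt {p : Ω × Bool | T p.1 ≠ p.2}

/-- The `k`-nearest neighbour classifier is universally consistent in the metric space `Ω`
(with its Borel sigma-algebra): for every choice of `k = kₙ` with `kₙ → ∞` and `kₙ/n → 0`
and every probability measure `μ̃` on `Ω × {0,1}`, the expected misclassification error at
sample size `n` converges to the Bayes error of `μ̃`. -/
def kNNUniversallyConsistent (Ω : Type u) [MetricSpace Ω] : Prop :=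
  letI : MeasurableSpace Ω := borel Ω
  ∀ k : ℕ → ℕ, Tendsto k atTop atTop →
    Tendsto (fun n : ℕ => (k n : ℝ) / n) atTop (nhds 0) →
    ∀ μt : Measure (Ω × Bool), IsProbabilityMeasure μt →
      Tendsto (fun n : ℕ => kNNError μt n (k n)) atTop (nhds (bayesError μt))

/-- A subset `X` of a metric space `Ω` has *Nagata dimension* `≤ δ` on the scale `s > 0`
in `Ω` if every finite family of closed balls of `Ω` with centres in `X` and radii `< s`
admits a subfamily of multiplicity `≤ δ + 1` which still covers the centres of all the
original balls.  A family of balls is recorded as a finite set of (centre, radius) pairs. -/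
def NagataDimLE {Ω : Type u} [MetricSpace Ω] (X : Set Ω) (δ : ℕ) (s : ℝ) : Prop :=
  ∀ F : Finset (Ω × ℝ),
    (∀ p ∈ F, p.1 ∈ X ∧ 0 ≤ p.2 ∧ p.2 < s) →
    ∃ G ⊆ F,
      (∀ p ∈ F, ∃ q ∈ G, p.1 ∈ Metric.closedBall q.1 q.2) ∧
      ∀ z : Ω, (G.filter fun q => dist z q.1 ≤ q.2).card ≤ δ + 1

/-- A metric space `Ω` is *sigma-finite dimensional in the sense of Nagata* if it is the
union of countably many subsets `Xₙ`, each of which has finite Nagata dimension in `Ω`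
on some scale `sₙ > 0`. -/
def IsSigmaFiniteDimNagata (Ω : Type u) [MetricSpace Ω] : Prop :=
  ∃ (X : ℕ → Set Ω) (δ : ℕ → ℕ) (s : ℕ → ℝ),
    (∀ n, 0 < s n) ∧ (∀ n, NagataDimLE (X n) (δ n) (s n)) ∧ (⋃ n, X n) = Set.univ

namespace KNNAux

open Classical in
def phi {K : Type u} (A : ℕ → Set K) (x : K) : ℕ → Bool := fun n => decide (x ∈ A n)

theorem phi_true {K : Type u} (A : ℕ → Set K) (x : K) (n : ℕ) : phi A x n = true ↔ x ∈ A n := by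
  simp [phi]

theorem exists_seq {K : Type u} [MeasurableSpace K] (μ : Measure K) (A : ℕ → Set K)
    (hA : ∀ S : Set K, ∀ ε : ℝ≥0∞, 0 < ε → ∃ n, μ (symmDiff S (A n)) < ε) (T : Set K) :
    ∃ n : ℕ → ℕ, ∀ᵐ x ∂μ, ∀ᶠ k in atTop, (x ∈ A (n k) ↔ x ∈ T) := by
  obtain ⟨ε, hε, hs⟩ := ENNReal.exists_pos_sum_of_countable' (ε := 1) one_ne_zero ℕ
  choose n hn using fun k => hA T (ε k) (hε k)
  refine ⟨n, ?_⟩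
  have h1 : ∑' k, μ (symmDiff T (A (n k))) ≠ ⊤ := by
    refine ne_top_of_lt (lt_of_le_of_lt (ENNReal.tsum_le_tsum fun k => (hn k).le) hs)
  filter_upwards [ae_eventually_notMem h1] with x hx
  filter_upwards [hx] with k hk
  simp only [Set.mem_symmDiff] at hk
  tauto

theorem measurable_bit (n : ℕ) : MeasurableSet {v : ℕ → Bool | v n = true} :=
  measurableSet_eq_fun (measurable_pi_apply n) measurable_const

theorem factor1 {K : Type u} [MeasurableSpace K] (μ : Measure K) (A : ℕ → Set K)
    (hA : ∀ S : Set K, ∀ ε : ℝ≥0∞, 0 < ε → ∃ n, μ (symmDiff S (A n)) < ε) (T : Set K) :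
    ∃ B : Set (ℕ → Bool), MeasurableSet B ∧ ∀ᵐ x ∂μ, (phi A x ∈ B ↔ x ∈ T) := by
  obtain ⟨n, hn⟩ := exists_seq μ A hA T
  refine ⟨⋂ m, ⋃ k, ⋃ (_ : m ≤ k), {v | v (n k) = true}, ?_, ?_⟩
  · exact MeasurableSet.iInter fun m => MeasurableSet.iUnion fun k => MeasurableSet.iUnion fun _ =>
      measurable_bit _
  · filter_upwards [hn] with x hx
    simp only [mem_iInter, mem_iUnion, Set.mem_ofPred_eq, phi_true]
    obtain ⟨m, hm⟩ := eventually_atTop.1 hx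
    constructor
    · intro h
      obtain ⟨k, hk, h⟩ := h m
      exact (hm k hk).1 h
    · intro h m'
      exact ⟨max m m', le_max_right _ _, (hm _ (le_max_left _ _)).2 h⟩

theorem factor2 {K : Type u} [MeasurableSpace K] (μ : Measure K) (A : ℕ → Set K)
    (hA : ∀ S : Set K, ∀ ε : ℝ≥0∞, 0 < ε → ∃ n, μ (symmDiff S (A n)) < ε) (S : K → Set K) :
    ∃ B : Set ((ℕ → Bool) × (ℕ → Bool)), MeasurableSet B ∧
      ∀ᵐ y ∂μ, ∀ᵐ x ∂μ, ((phi A y, phi A x) ∈ B ↔ x ∈ S y) := by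
  choose n hn using fun y => exists_seq μ A hA (S y)
  choose B hBm hB using fun k j => factor1 μ A hA {y | n y k = j}
  refine ⟨⋂ m, ⋃ k, ⋃ (_ : m ≤ k), ⋃ j, (Prod.fst ⁻¹' B k j) ∩ Prod.snd ⁻¹' {v | v j = true}, ?_, ?_⟩
  · exact MeasurableSet.iInter fun m => MeasurableSet.iUnion fun k => MeasurableSet.iUnion fun _ =>
      MeasurableSet.iUnion fun j => (measurable_fst (hBm k j)).inter (measurable_snd (measurable_bit j))
  · have hB' : ∀ᵐ y ∂μ, ∀ k j, (phi A y ∈ B k j ↔ y ∈ {y | n y k = j}) := by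
      rw [ae_all_iff]; intro k; rw [ae_all_iff]; exact hB k
    filter_upwards [hB'] with y hy
    filter_upwards [hn y] with x hx
    simp only [mem_iInter, mem_iUnion, Set.mem_ofPred_eq, phi_true, mem_inter_iff, mem_preimage, hy]
    obtain ⟨m, hm⟩ := eventually_atTop.1 hx
    constructor
    · intro h
      obtain ⟨k, hk, j, rfl, h⟩ := h m
      exact (hm k hk).1 h
    · intro h m'
      exact ⟨max m m', le_max_right _ _, _, rfl, (hm _ (le_max_left _ _)).2 h⟩

open Classical in
theorem factor2fun {K : Type u} [MeasurableSpace K] (μ : Measure K) (A : ℕ → Set K)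
    (hA : ∀ S : Set K, ∀ ε : ℝ≥0∞, 0 < ε → ∃ n, μ (symmDiff S (A n)) < ε)
    (Γ : K → K → ℕ → Bool) :
    ∃ G : (ℕ → Bool) × (ℕ → Bool) → (ℕ → Bool), Measurable G ∧
      ∀ᵐ y ∂μ, ∀ᵐ x ∂μ, G (phi A y, phi A x) = Γ y x := by
  choose B hBm hB using fun n => factor2 μ A hA (fun y => {x | Γ y x n = true})
  refine ⟨fun p n => decide (p ∈ B n), ?_, ?_⟩
  · rw [measurable_pi_iff]
    intro n
    apply measurable_to_bool
    have : (fun p => decide (p ∈ B n)) ⁻¹' {true} = B n := by ext; simp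
    rw [this]; exact hBm n
  · filter_upwards [ae_all_iff.2 hB] with y hy
    filter_upwards [ae_all_iff.2 hy] with x hx
    ext n
    have := hx n
    rw [Bool.eq_iff_iff]; simpa using this

open Classical in
theorem factor1fun {K : Type u} [MeasurableSpace K] (μ : Measure K) (A : ℕ → Set K)
    (hA : ∀ S : Set K, ∀ ε : ℝ≥0∞, 0 < ε → ∃ n, μ (symmDiff S (A n)) < ε)
    (Γ : K → ℕ → Bool) :
    ∃ G : (ℕ → Bool) → (ℕ → Bool), Measurable G ∧ ∀ᵐ x ∂μ, G (phi A x) = Γ x := by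
  choose B hBm hB using fun n => factor1 μ A hA {x | Γ x n = true}
  refine ⟨fun p n => decide (p ∈ B n), ?_, ?_⟩
  · rw [measurable_pi_iff]
    intro n
    apply measurable_to_bool
    have : (fun p => decide (p ∈ B n)) ⁻¹' {true} = B n := by ext; simp
    rw [this]; exact hBm n
  · filter_upwards [ae_all_iff.2 hB] with x hx
    ext n
    have := hx n
    rw [Bool.eq_iff_iff]; simpa using this

/-- Small initial segments already have non-null image. -/
theorem gs_step1 {K : Type u} [LinearOrder K] [MeasurableSpace K]
    [DiscreteMeasurableSpace K] (μ : Measure K) [IsProbabilityMeasure μ]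
    (hIic : ∀ x : K, μ (Set.Iic x) = 0)
    (A : ℕ → Set K)
    (hA : ∀ S : Set K, ∀ ε : ℝ≥0∞, 0 < ε → ∃ n, μ (symmDiff S (A n)) < ε)
    (P : Set K) (hP : ∀ᵐ x ∂μ, x ∈ P) :
    ∃ z : K, μ.map (phi A) (phi A '' (P ∩ Set.Iio z)) ≠ 0 := by
  by_contra! hcon
  set lam := μ.map (phi A) with hlam
  have hphi : Measurable (phi A) := Measurable.of_discrete
  have : IsProbabilityMeasure lam := Measure.isProbabilityMeasure_map hphi.aemeasurable
  have hU : ∀ x : K, ∃ U, phi A '' (P ∩ Set.Iio x) ⊆ U ∧ IsOpen U ∧ lam U < 1/2 := by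
    intro x
    obtain ⟨U, h1, h2, h3⟩ := Set.exists_isOpen_lt_of_lt (μ := lam) (phi A '' (P ∩ Set.Iio x)) (1/2)
      (by rw [hcon x]; simp)
    exact ⟨U, h1, h2, h3⟩
  choose U hUs hUo hUl using hU
  obtain ⟨Cb, hCc, -, hCb⟩ := TopologicalSpace.exists_countable_basis (ℕ → Bool)
  have : Countable Cb := hCc.to_subtype
  choose B hBm hB using fun c : Cb => factor1 μ A hA {x | (c : Set (ℕ → Bool)) ⊆ U x}
  have hB' := ae_all_iff.2 hB
  set W : Set ((ℕ → Bool) × (ℕ → Bool)) := ⋃ c : Cb, (Prod.fst ⁻¹' B c) ∩ Prod.snd ⁻¹' (c : Set (ℕ → Bool))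
    with hW
  have hWm : MeasurableSet W := MeasurableSet.iUnion fun c => (measurable_fst (hBm c)).inter
    (measurable_snd (hCb.isOpen c.2).measurableSet)
  have hWx : ∀ᵐ x ∂μ, ∀ v, (phi A x, v) ∈ W ↔ v ∈ U x := by
    filter_upwards [hB'] with x hx v
    simp only [hW, mem_iUnion, mem_inter_iff, mem_preimage, hx]
    constructor
    · rintro ⟨c, h1, h2⟩; exact h1 h2
    · intro hv
      obtain ⟨c, hc, h1, h2⟩ := hCb.exists_subset_of_mem_open hv (hUo x)
      exact ⟨⟨c, hc⟩, h2, h1⟩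
  have e1 : lam.prod lam W ≤ 1/2 := by
    rw [Measure.prod_apply hWm]
    have : ∀ᵐ u ∂lam, lam (Prod.mk u ⁻¹' W) ≤ 1/2 := by
      rw [hlam, ae_map_iff hphi.aemeasurable
        (measurableSet_le (measurable_measure_prodMk_left hWm) measurable_const)]
      filter_upwards [hWx] with x hx
      have : Prod.mk (phi A x) ⁻¹' W = U x := by ext v; exact hx v
      rw [this]; exact (hUl x).le
    calc _ ≤ ∫⁻ u, 1/2 ∂lam := lintegral_mono_ae this
      _ = 1/2 := by simp
  have e2 : ∀ᵐ p ∂(lam.prod lam), p ∈ W := by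
    have h1 : ∀ᵐ v ∂lam, ∀ᵐ u ∂lam, (u, v) ∈ W := by
      have hm : MeasurableSet {v | ∀ᵐ u ∂lam, (u, v) ∈ W} := by
        have : {v | ∀ᵐ u ∂lam, (u, v) ∈ W} = {v | lam ((fun u => (u, v)) ⁻¹' Wᶜ) = 0} := by
          ext v; simp [ae_iff]; rfl
        rw [this]
        exact measurable_measure_prodMk_right hWm.compl (measurableSet_singleton 0)
      rw [hlam, ae_map_iff hphi.aemeasurable (by rw [← hlam]; exact hm)]
      filter_upwards [hP] with y hy
      rw [ae_map_iff hphi.aemeasurable (measurable_prodMk_right hWm)]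
      have : ∀ᵐ x ∂μ, x ∉ Set.Iic y := measure_eq_zero_iff_ae_notMem.1 (hIic y)
      filter_upwards [this, hWx] with x hx hx2
      rw [hx2]
      exact hUs x ⟨y, ⟨hy, not_le.1 hx⟩, rfl⟩
    rw [Measure.ae_prod_iff_ae_ae (p := fun p => p ∈ W) hWm,
      Measure.ae_ae_comm (p := fun u v => (u, v) ∈ W) hWm]
    exact h1
  have e3 : lam.prod lam W = 1 := by
    rw [prob_compl_eq_zero_iff hWm |>.symm]; exact e2
  rw [e3] at e1
  norm_num at e1

theorem exists_mem_of_ae {α : Type*} [MeasurableSpace α] {μ : Measure α} {s : Set α} {p : α → Prop}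
    (hs : μ s ≠ 0) (h : ∀ᵐ x ∂μ, p x) : ∃ x ∈ s, p x := by
  by_contra! hc
  exact hs (measure_mono_null (fun x hx => hc x hx) h)

theorem ms_ae {α β : Type*} [MeasurableSpace α] [MeasurableSpace β] (ν : Measure β) [SFinite ν]
    {s : Set (α × β)} (hs : MeasurableSet s) : MeasurableSet {x | ∀ᵐ y ∂ν, (x, y) ∈ s} := by
  have : {x | ∀ᵐ y ∂ν, (x, y) ∈ s} = (fun x => ν (Prod.mk x ⁻¹' sᶜ)) ⁻¹' {0} := by
    ext v; simp [ae_iff]; rfl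
  rw [this]
  exact measurable_measure_prodMk_left hs.compl (measurableSet_singleton 0)

theorem null_of_card {K : Type u} [MeasurableSpace K] (μ : Measure K)
    (hadd : ∀ (J : Type u) (N : J → Set K), #J < #K → (∀ j, μ (N j) = 0) → μ (⋃ j, N j) = 0)
    (hnull : ∀ x, μ {x} = 0) (S : Set K) (hS : #S < #K) : μ S = 0 := by
  have := hadd S (fun x => {(x : K)}) hS (fun x => hnull x)
  simpa using this

/-- A big family of functions which are pairwise almost everywhere different. -/
theorem exists_family {K : Type u} [LinearOrder K] [MeasurableSpace K]
    (μ : Measure K) [IsProbabilityMeasure μ]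
    (hIic : ∀ x : K, μ (Set.Iic x) = 0)
    (hIio : ∀ x : K, #(Set.Iio x) < #K) :
    ∃ F : Set (K → K), F.Pairwise (fun g g' => μ {x | g x = g' x} = 0) ∧ #K < #F := by
  obtain ⟨F, hF⟩ := zorn_subset {F : Set (K → K) | F.Pairwise (fun g g' => μ {x | g x = g' x} = 0)} (by
    intro c hc hch
    refine ⟨⋃₀ c, ?_, fun s hs => subset_sUnion_of_mem hs⟩
    exact (Set.pairwise_sUnion hch.directedOn).2 hc)
  have hF1 : F.Pairwise (fun g g' => μ {x | g x = g' x} = 0) := hF.1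
  refine ⟨F, hF1, ?_⟩
  by_contra! hle
  obtain ⟨e⟩ := hle
  have hex : ∀ x : K, ∃ y : K, ∀ i : F, e i < x → i.1 x ≠ y := by
    intro x
    by_contra! hcon
    choose i hi hi2 using hcon
    have : #K ≤ #(Set.Iio x) := by
      refine ⟨⟨fun y => ⟨e (i y), hi y⟩, ?_⟩⟩
      intro y y' h
      have h' := e.injective (congrArg Subtype.val h)
      calc y = (i y).1 x := (hi2 y).symm
        _ = (i y').1 x := by rw [h']
        _ = y' := hi2 y'
    exact absurd this (not_le.2 (hIio x))
  choose g hg using hex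
  have hgi : ∀ i ∈ F, μ {x | g x = i x} = 0 := by
    intro i hi
    refine measure_mono_null ?_ (hIic (e ⟨i, hi⟩))
    intro x hx
    by_contra hlt
    exact hg x ⟨i, hi⟩ (not_le.1 hlt) hx.symm
  have hgF : g ∈ F := by
    have : insert g F ⊆ F := hF.2 (by
      change (insert g F).Pairwise _
      rw [Set.pairwise_insert]
      refine ⟨hF1, fun i hi _ => ⟨hgi i hi, ?_⟩⟩
      have := hgi i hi
      simpa only [eq_comm] using this) (subset_insert _ _)
    exact this (mem_insert _ _)
  have := hgi g hgF
  simp at this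

theorem gitik_shelah {K : Type u} [LinearOrder K] [MeasurableSpace K]
    [DiscreteMeasurableSpace K] (μ : Measure K) [IsProbabilityMeasure μ]
    (hadd : ∀ (J : Type u) (N : J → Set K), #J < #K → (∀ j, μ (N j) = 0) → μ (⋃ j, N j) = 0)
    (hnull : ∀ x, μ {x} = 0)
    (hIio : ∀ x : K, #(Set.Iio x) < #K)
    (A : ℕ → Set K)
    (hA : ∀ S : Set K, ∀ ε : ℝ≥0∞, 0 < ε → ∃ n, μ (symmDiff S (A n)) < ε)
    (h : K → ℕ → Bool) (hh : Function.Injective h) : False := by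
  have hIic : ∀ x : K, μ (Set.Iic x) = 0 := by
    intro x
    rw [← Set.Iio_insert, Set.insert_eq]
    exact measure_union_null (hnull x) (null_of_card μ hadd hnull _ (hIio x))
  have hinf : ℵ₀ ≤ #K := by
    by_contra! hlt
    have : Countable K := Cardinal.mk_le_aleph0_iff.1 hlt.le
    have h0 : μ (⋃ x : K, {x}) = 0 := measure_iUnion_null hnull
    rw [Set.iUnion_of_singleton] at h0
    simp at h0
  obtain ⟨F, hF, hFc⟩ := exists_family μ hIic hIio
  set lam := μ.map (phi A) with hlam
  have hphi : Measurable (phi A) := Measurable.of_discrete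
  have : IsProbabilityMeasure lam := Measure.isProbabilityMeasure_map hphi.aemeasurable
  choose G1 hG1m hG1 using fun g : F => factor1fun μ A hA (fun x => h (g.1 x))
  choose z hz using fun g : F => gs_step1 μ hIic A hA {x | G1 g (phi A x) = h (g.1 x)} (hG1 g)
  have hbd : ∀ g : F, ∃ w : K, ∀ x < z g, g.1 x < w := by
    intro g
    by_contra! hcon
    have h0 := hadd (Set.Iio (z g)) (fun x => Set.Iic (g.1 x)) (hIio _) (fun x => hIic _)
    have : (⋃ x : Set.Iio (z g), Set.Iic (g.1 x)) = Set.univ := by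
      ext w
      obtain ⟨x, hx, hx2⟩ := hcon w
      simp only [mem_iUnion, mem_Iic, mem_univ, iff_true]
      exact ⟨⟨x, hx⟩, hx2⟩
    rw [this] at h0
    simp at h0
  choose w hw using hbd
  obtain ⟨⟨z0, w0⟩, hfib⟩ := Cardinal.infinite_pigeonhole_card (fun g : F => (z g, w g)) (Order.succ #K)
    (Order.succ_le_of_lt hFc) (hinf.trans (Order.le_succ _)) (by
      rw [(Cardinal.isRegular_succ hinf).cof_ord, Cardinal.mk_prod, Cardinal.lift_id, Cardinal.mul_eq_self hinf]
      exact Order.lt_succ _)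
  obtain ⟨e⟩ := (Order.le_succ _).trans hfib
  have hez : ∀ y, z (e y).1 = z0 := fun y => congrArg Prod.fst (e y).2
  have hew : ∀ y, w (e y).1 = w0 := fun y => congrArg Prod.snd (e y).2
  set g : K → K → K := fun y => (e y).1.1 with hgdef
  have hgne : ∀ y y', y ≠ y' → ∀ᵐ x ∂μ, g y x ≠ g y' x := by
    intro y y' hne
    have : g y ≠ g y' := by
      intro heq
      exact hne (e.injective (Subtype.ext (Subtype.ext heq)))
    have := hF (e y).1.2 (e y').1.2 this
    simpa [ae_iff] using this
  obtain ⟨G, hGm, hG⟩ := factor2fun μ A hA (fun y x => h (g y x))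
  -- the triple statement
  have t1 : ∀ᵐ y ∂μ, ∀ᵐ y' ∂μ, ∀ᵐ x ∂μ, G (phi A y, phi A x) ≠ G (phi A y', phi A x) := by
    filter_upwards [hG] with y hy
    have : ∀ᵐ y' ∂μ, y' ∉ ({y} : Set K) := measure_eq_zero_iff_ae_notMem.1 (hnull y)
    filter_upwards [hG, this] with y' hy' hne
    filter_upwards [hy, hy', hgne y y' (fun h => hne h.symm)] with x h1 h2 h3
    rw [h1, h2]
    exact fun h => h3 (hh h)
  have m3 : MeasurableSet {q : ((ℕ → Bool) × (ℕ → Bool)) × (ℕ → Bool) | G (q.1.1, q.2) ≠ G (q.1.2, q.2)} :=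
    (measurableSet_eq_fun (by fun_prop) (by fun_prop)).compl
  have m3' : MeasurableSet {q : ((ℕ → Bool) × (ℕ → Bool)) × (ℕ → Bool) | G (q.1.1, q.1.2) ≠ G (q.2, q.1.2)} :=
    (measurableSet_eq_fun (by fun_prop) (by fun_prop)).compl
  have m2 := ms_ae lam m3
  have m2' := ms_ae lam m3'
  have m1 := ms_ae lam m2
  simp only [Set.mem_ofPred_eq] at m2 m2' m1
  have t2 : ∀ᵐ u ∂lam, ∀ᵐ u' ∂lam, ∀ᵐ v ∂lam, G (u, v) ≠ G (u', v) := by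
    refine (ae_map_iff (μ := μ) hphi.aemeasurable m1).2 ?_
    filter_upwards [t1] with y hy
    refine (ae_map_iff (μ := μ) (p := fun u' => ∀ᵐ v ∂lam, G (phi A y, v) ≠ G (u', v))
      hphi.aemeasurable (measurable_prodMk_left m2)).2 ?_
    filter_upwards [hy] with y' hy'
    refine (ae_map_iff (μ := μ) (p := fun v => G (phi A y, v) ≠ G (phi A y', v)) hphi.aemeasurable
      (measurableSet_eq_fun (by fun_prop) (by fun_prop)).compl).2 ?_
    exact hy'
  have t3 : ∀ᵐ u ∂lam, ∀ᵐ v ∂lam, ∀ᵐ u' ∂lam, G (u, v) ≠ G (u', v) := by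
    filter_upwards [t2] with u hu
    rw [Measure.ae_ae_comm (measurableSet_eq_fun (by fun_prop) (by fun_prop)).compl]
    exact hu
  rw [Measure.ae_ae_comm m2'] at t3
  have t4 : ∀ᵐ v ∂lam, ∀ c, μ {y | G (phi A y, v) = c} = 0 := by
    filter_upwards [t3] with v hv c
    have hm : MeasurableSet {u | G (u, v) = c} := measurableSet_eq_fun (by fun_prop) (by fun_prop)
    have : lam {u | G (u, v) = c} = 0 := by
      by_contra hne
      obtain ⟨u, hu, hu2⟩ := exists_mem_of_ae hne hv
      apply hne
      have hu : G (u, v) = c := hu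
      have hu2 : ∀ᵐ u' ∂lam, G (u, v) ≠ G (u', v) := hu2
      rw [measure_eq_zero_iff_ae_notMem]
      filter_upwards [hu2] with u' h1 h2
      exact h1 (hu.trans (Eq.symm h2))
    rw [hlam, Measure.map_apply hphi hm] at this
    exact this
  have t5 : ∀ᵐ y ∂μ, ∀ x < z0, ∀ c < w0, (∀ c, μ {y | G (phi A y, phi A x) = c} = 0) →
      G (phi A y, phi A x) ≠ h c := by
    have := hadd (Set.Iio z0) (fun x => ⋃ c : Set.Iio w0,
      {y | (∀ c, μ {y | G (phi A y, phi A x) = c} = 0) ∧ G (phi A y, phi A x) = h c}) (hIio _) (by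
        intro x
        refine hadd _ _ (hIio _) ?_
        intro c
        by_cases hx : ∀ c, μ {y | G (phi A y, phi A x) = c} = 0
        · exact measure_mono_null (fun y hy => hy.2) (hx (h c))
        · simp [hx])
    filter_upwards [measure_eq_zero_iff_ae_notMem.1 this] with y hy x hx c hc h1 h2
    apply hy
    simp only [mem_iUnion]
    exact ⟨⟨x, hx⟩, ⟨c, hc⟩, h1, h2⟩
  obtain ⟨y, hy5, hyG⟩ := (t5.and hG).exists
  have s1 : ∀ᵐ v ∂lam, G (phi A y, v) = G1 (e y).1 v := by
    rw [hlam, ae_map_iff hphi.aemeasurable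
      (measurableSet_eq_fun (by fun_prop) (hG1m _))]
    filter_upwards [hyG, hG1 (e y).1] with x h1 h2
    rw [h1, h2]
  have hzy := hz (e y).1
  rw [← hlam] at hzy
  obtain ⟨v, hv, hv2⟩ := exists_mem_of_ae hzy (t4.and s1)
  obtain ⟨x, ⟨hx1, hx2⟩, rfl⟩ := hv
  have hx1 : G1 (e y).1 (phi A x) = h ((e y).1.1 x) := hx1
  have hx3 := hw _ x hx2
  rw [hew] at hx3
  rw [hez] at hx2
  exact hy5 x hx2 _ hx3 hv2.1 (hv2.2.trans hx1)

end KNNAux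

namespace KNNAux

theorem sqrt_ratio : Tendsto (fun n : ℕ => ((Nat.sqrt n : ℕ) : ℝ) / n) atTop (nhds 0) := by
  have h1 : Tendsto (fun n : ℕ => (Real.sqrt (n : ℝ))⁻¹) atTop (nhds 0) :=
    (Real.tendsto_sqrt_atTop.comp tendsto_natCast_atTop_atTop).inv_tendsto_atTop
  refine squeeze_zero (fun n => by positivity) (fun n => ?_) h1
  rcases Nat.eq_zero_or_pos n with rfl | hn
  · simp
  have hn' : (0 : ℝ) < n := by exact_mod_cast hn
  have h2 : ((Nat.sqrt n : ℕ) : ℝ) ≤ Real.sqrt n := Real.nat_sqrt_le_real_sqrt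
  rw [div_le_iff₀ hn', inv_mul_eq_div, Real.div_sqrt]
  exact h2

theorem sqrt_tendsto : Tendsto Nat.sqrt atTop atTop := by
  rw [Filter.tendsto_atTop]
  intro b
  filter_upwards [eventually_ge_atTop (b * b)] with n hn
  exact Nat.le_sqrt.2 hn

theorem sep_closed {Ω : Type u} [MetricSpace Ω] {ι : Type u} (b : ι → Ω) {e : ℝ} (he : 0 < e)
    (hsep : ∀ i j, i ≠ j → e ≤ dist (b i) (b j)) (S : Set ι) : IsClosed (b '' S) := by
  apply Metric.isClosed_of_pairwise_le_dist he
  rintro _ ⟨i, _, rfl⟩ _ ⟨j, _, rfl⟩ hne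
  exact hsep i j (fun h => hne (by rw [h]))

open Classical in
theorem lemB {Ω : Type u} [MetricSpace Ω] (hc : kNNUniversallyConsistent Ω) {ι : Type u}
    [MeasurableSpace ι] [DiscreteMeasurableSpace ι] (m : Measure ι) [IsProbabilityMeasure m]
    (b : ι → Ω) {e : ℝ} (he : 0 < e) (hsep : ∀ i j, i ≠ j → e ≤ dist (b i) (b j))
    (f : ι → Bool) (ε : ℝ≥0∞) (hε : 0 < ε) :
    ∃ (N : ℕ) (π : Equiv.Perm (Fin N)), (Measure.pi (fun _ : Fin N => m)).prod m
      {q : (Fin N → ι) × ι | kNNLabel N (Nat.sqrt N) (fun j => (b (q.1 j), f (q.1 j))) π (b q.2)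
        ≠ f q.2} < ε := by
  let _ : MeasurableSpace Ω := borel Ω
  have : BorelSpace Ω := ⟨rfl⟩
  have hinj : Function.Injective b := by
    intro i j hij
    by_contra hne
    have := hsep i j hne
    rw [hij, dist_self] at this
    linarith
  set ψ : ι → Ω × Bool := fun i => (b i, f i) with hψ
  have hψm : Measurable ψ := Measurable.of_discrete
  set M := m.map ψ with hM
  have : IsProbabilityMeasure M := Measure.isProbabilityMeasure_map hψm.aemeasurable
  have hbayes : bayesError M = 0 := by
    have hcl := (sep_closed b he hsep (f ⁻¹' {true})).measurableSet
    have hT : Measurable (fun x => decide (x ∈ b '' (f ⁻¹' {true}))) := by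
      apply measurable_to_bool
      convert hcl using 1
      ext; simp
    refine le_antisymm ?_ bot_le
    refine (iInf₂_le _ hT).trans ?_
    have hms : MeasurableSet {p : Ω × Bool | decide (p.1 ∈ b '' (f ⁻¹' {true})) ≠ p.2} :=
      (measurableSet_eq_fun (hT.comp measurable_fst) measurable_snd).compl
    rw [hM, Measure.map_apply hψm hms]
    refine (measure_mono_null (t := ∅) ?_ measure_empty).le
    intro i hi
    apply hi
    simp only [hψ]
    rw [Bool.eq_iff_iff]
    simp [hinj.eq_iff]
  have h1 := hc Nat.sqrt sqrt_tendsto sqrt_ratio M inferInstance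
  rw [hbayes] at h1
  obtain ⟨N, hN⟩ := (h1.eventually (gt_mem_nhds hε)).exists
  refine ⟨N, ?_⟩
  by_contra! hcon
  have h2 : ∀ π : Equiv.Perm (Fin N), ε ≤ (Measure.pi fun _ : Fin N => M).prod M
        {q : (Fin N → Ω × Bool) × (Ω × Bool) | kNNLabel N (Nat.sqrt N) q.1 π q.2.1 ≠ q.2.2} := by
    intro π
    refine (hcon π).trans ?_
    have e1 : (Measure.pi fun _ : Fin N => M) = (Measure.pi fun _ : Fin N => m).map
        (fun σ j => ψ (σ j)) := (Measure.pi_map_pi (fun _ => hψm.aemeasurable)).symm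
    rw [e1, hM, Measure.map_prod_map _ _ (by fun_prop) hψm]
    refine le_trans (le_of_eq ?_) (Measure.le_map_apply (by fun_prop) _)
    rfl
  have h3 : ε ≤ kNNError M N (Nat.sqrt N) := by
    rw [kNNError, ENNReal.le_div_iff_mul_le (by simp [Nat.factorial_ne_zero]) (by simp)]
    calc ε * (Nat.factorial N : ℝ≥0∞) = ∑ π : Equiv.Perm (Fin N), ε := by
          simp [Fintype.card_perm, mul_comm]
      _ ≤ _ := Finset.sum_le_sum fun π _ => h2 π
  exact absurd hN (not_lt.2 h3)

theorem exists_section {α β J : Type*} [MeasurableSpace α] [MeasurableSpace β] (μ : Measure α)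
    (ν : Measure β) [IsProbabilityMeasure μ] [SFinite ν] (s : Finset J) (H : J → Set (α × β))
    (ε : ℝ≥0∞) (h : ∀ j ∈ s, μ.prod ν (H j) ≤ ε) :
    ∃ a, ∑ j ∈ s, ν (Prod.mk a ⁻¹' H j) ≤ s.card * ε := by
  set H' := fun j => toMeasurable (μ.prod ν) (H j)
  have hm : ∀ j, MeasurableSet (H' j) := fun j => measurableSet_toMeasurable _ _
  have hf : Measurable (fun a => ∑ j ∈ s, ν (Prod.mk a ⁻¹' H' j)) :=
    Finset.measurable_sum _ fun j _ => measurable_measure_prodMk_left (hm j)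
  obtain ⟨a, ha⟩ := exists_le_lintegral hf.aemeasurable (μ := μ)
  refine ⟨a, ?_⟩
  calc _ ≤ ∑ j ∈ s, ν (Prod.mk a ⁻¹' H' j) :=
        Finset.sum_le_sum fun j _ => measure_mono (preimage_mono (subset_toMeasurable _ _))
    _ ≤ _ := ha
    _ = ∑ j ∈ s, μ.prod ν (H j) := by
        rw [lintegral_finsetSum _ fun j _ => measurable_measure_prodMk_left (hm j)]
        refine Finset.sum_congr rfl fun j _ => ?_
        rw [← Measure.prod_apply (hm j), measure_toMeasurable]
    _ ≤ s.card • ε := Finset.sum_le_card_nsmul _ _ _ h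
    _ = _ := by simp

open Classical in
theorem finite_fam {K : Type u} [MeasurableSpace K] (μ : Measure K) [IsProbabilityMeasure μ]
    (N : ℕ) (L : (Fin N → K) → (Fin N → Bool) → K → Bool) (d : ℝ≥0∞) (hd : d ≠ 0) (hd' : d ≠ ⊤)
    (F : Set (Set K)) (hF : F.Pairwise fun S S' => 8 * d ≤ μ (symmDiff S S'))
    (hFd : ∀ S ∈ F, (Measure.pi (fun _ : Fin N => μ)).prod μ
      {q : (Fin N → K) × K | L q.1 (fun j => decide (q.1 j ∈ S)) q.2 ≠ decide (q.2 ∈ S)} < d) :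
    F.Finite := by
  by_contra hinf
  obtain ⟨t, htF, htc⟩ := Set.Infinite.exists_subset_card_eq hinf (2 * 2 ^ N)
  obtain ⟨σ, hσ⟩ := exists_section (Measure.pi (fun _ : Fin N => μ)) μ t
    (fun S => {q : (Fin N → K) × K | L q.1 (fun j => decide (q.1 j ∈ S)) q.2 ≠ decide (q.2 ∈ S)}) d
    (fun S hS => (hFd S (htF hS)).le)
  set E : Set K → Set K := fun S => {x | L σ (fun j => decide (σ j ∈ S)) x ≠ decide (x ∈ S)} with hE
  have hσ : ∑ S ∈ t, μ (E S) ≤ t.card * d := hσ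
  have hgood : (t.filter fun S => μ (E S) < 4 * d).card ≤ 2 ^ N := by
    have : (Finset.univ : Finset (Fin N → Bool)).card = 2 ^ N := by simp
    rw [← this]
    refine Finset.card_le_card_of_injOn (fun S j => decide (σ j ∈ S)) (fun _ _ => Finset.mem_univ _) ?_
    intro S hS S' hS' heq
    simp only [Finset.coe_filter, Set.mem_ofPred_eq] at hS hS'
    by_contra hne
    have h1 := hF (htF hS.1) (htF hS'.1) hne
    have h2 : symmDiff S S' ⊆ E S ∪ E S' := by
      intro x hx
      by_contra hx2
      simp only [hE, mem_union, Set.mem_ofPred_eq, not_or, not_not] at hx2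
      have heq : (fun j => decide (σ j ∈ S)) = (fun j => decide (σ j ∈ S')) := heq
      rw [heq] at hx2
      have := hx2.1.symm.trans hx2.2
      simp only [decide_eq_decide] at this
      rw [Set.mem_symmDiff] at hx
      tauto
    have h3 : μ (symmDiff S S') < 4 * d + 4 * d :=
      lt_of_le_of_lt ((measure_mono h2).trans (measure_union_le _ _)) (ENNReal.add_lt_add hS.2 hS'.2)
    rw [← add_mul] at h3
    norm_num at h3
    exact absurd h3 (not_lt.2 h1)
  have hbad : 2 ^ N ≤ (t.filter fun S => ¬ μ (E S) < 4 * d).card := by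
    have := Finset.card_filter_add_card_filter_not (s := t) (fun S => μ (E S) < 4 * d)
    omega
  have h4 : ((2 ^ N : ℕ) : ℝ≥0∞) * (4 * d) ≤ ∑ S ∈ t, μ (E S) := by
    calc ((2 ^ N : ℕ) : ℝ≥0∞) * (4 * d) ≤ ((t.filter fun S => ¬ μ (E S) < 4 * d).card : ℝ≥0∞) * (4 * d) := by
          gcongr
      _ = (t.filter fun S => ¬ μ (E S) < 4 * d).card • (4 * d) := by simp
      _ ≤ ∑ S ∈ t.filter fun S => ¬ μ (E S) < 4 * d, μ (E S) :=
          Finset.card_nsmul_le_sum _ _ _ (fun S hS => not_lt.1 (Finset.mem_filter.1 hS).2)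
      _ ≤ _ := Finset.sum_le_sum_of_subset (Finset.filter_subset _ _)
  have h5 := h4.trans hσ
  rw [htc] at h5
  lift d to NNReal using hd'
  norm_cast at h5
  have : (0 : ℝ) < d := by
    have : d ≠ 0 := by simpa using hd
    positivity
  have h6 : (2 ^ N * (4 * d) : ℝ) ≤ 2 * 2 ^ N * d := by exact_mod_cast h5
  have : (0:ℝ) < 2 ^ N * d := by positivity
  nlinarith

open Classical in
theorem exists_dense_seq {K : Type u} [MeasurableSpace K] (μ : Measure K) [IsProbabilityMeasure μ]
    (L : (p : Σ N : ℕ, Equiv.Perm (Fin N)) → (Fin p.1 → K) → (Fin p.1 → Bool) → K → Bool)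
    (hL : ∀ (S : Set K) (ε : ℝ≥0∞), 0 < ε → ∃ p, (Measure.pi (fun _ : Fin p.1 => μ)).prod μ
      {q : (Fin p.1 → K) × K | L p q.1 (fun j => decide (q.1 j ∈ S)) q.2 ≠ decide (q.2 ∈ S)} < ε) :
    ∃ A : ℕ → Set K, ∀ S : Set K, ∀ ε : ℝ≥0∞, 0 < ε → ∃ n, μ (symmDiff S (A n)) < ε := by
  have key : ∀ d : ℝ≥0∞, d ≠ 0 → d ≠ ⊤ → ∃ F : Set (Set K), F.Countable ∧
      ∀ S, ∃ S' ∈ F, μ (symmDiff S S') < 8 * d := by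
    intro d hd hd'
    obtain ⟨F, hF⟩ := zorn_subset {F : Set (Set K) | F.Pairwise (fun S S' => 8 * d ≤ μ (symmDiff S S'))} (by
      intro c hc hch
      refine ⟨⋃₀ c, ?_, fun s hs => subset_sUnion_of_mem hs⟩
      exact (Set.pairwise_sUnion hch.directedOn).2 hc)
    have hF1 : F.Pairwise (fun S S' => 8 * d ≤ μ (symmDiff S S')) := hF.1
    refine ⟨F, ?_, ?_⟩
    · choose p hp using fun S => hL S d (pos_iff_ne_zero.2 hd)
      have : F = ⋃ r, {S ∈ F | p S = r} := by ext S; simp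
      rw [this]
      refine countable_iUnion fun r => Set.Finite.countable ?_
      refine finite_fam μ r.1 (L r) d hd hd' _ (hF1.mono (fun S hS => hS.1)) ?_
      rintro S ⟨_, rfl⟩
      exact hp S
    · intro S
      by_contra! hcon
      have hSF : S ∈ F := by
        have : insert S F ⊆ F := hF.2 (by
          change (insert S F).Pairwise _
          rw [Set.pairwise_insert]
          refine ⟨hF1, fun i hi _ => ⟨hcon i hi, ?_⟩⟩
          rw [symmDiff_comm]; exact hcon i hi) (subset_insert _ _)
        exact this (mem_insert _ _)
      have := hcon S hSF
      simp [hd] at this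
  have hd0 : ∀ n : ℕ, ((n : ℝ≥0∞) + 1)⁻¹ ≠ 0 := fun n => by simp
  choose F hFc hF using fun n : ℕ => key ((n : ℝ≥0∞) + 1)⁻¹ (hd0 n) (by simp)
  have hUc : (⋃ n, F n).Countable := countable_iUnion hFc
  have hUn : (⋃ n, F n).Nonempty := by
    obtain ⟨S', h, _⟩ := hF 0 ∅
    exact ⟨S', mem_iUnion.2 ⟨0, h⟩⟩
  obtain ⟨A, hA⟩ := hUc.exists_eq_range hUn
  refine ⟨A, fun S ε hε => ?_⟩
  have : ∃ n : ℕ, 8 * ((n : ℝ≥0∞) + 1)⁻¹ ≤ ε := by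
    have hne : ε / 8 ≠ 0 := by simp [hε.ne']
    obtain ⟨n, hn⟩ := ENNReal.exists_inv_nat_lt hne
    refine ⟨n, ?_⟩
    calc 8 * ((n : ℝ≥0∞) + 1)⁻¹ ≤ 8 * (n : ℝ≥0∞)⁻¹ := by gcongr; simp
      _ ≤ 8 * (ε / 8) := by gcongr
      _ = ε := ENNReal.mul_div_cancel (by norm_num) (by norm_num)
  obtain ⟨n, hn⟩ := this
  obtain ⟨S', h1, h2⟩ := hF n S
  have : S' ∈ Set.range A := by rw [← hA]; exact mem_iUnion.2 ⟨n, h1⟩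
  obtain ⟨k, rfl⟩ := this
  exact ⟨k, h2.trans_le hn⟩

end KNNAux

namespace KNNAux

theorem same_labels {Ω : Type u} [MetricSpace Ω] {K : Type u} [MeasurableSpace K]
    (μ : Measure K) [IsProbabilityMeasure μ]
    (hadd : ∀ (J : Type u) (N : J → Set K), #J < #K → (∀ j, μ (N j) = 0) → μ (⋃ j, N j) = 0)
    (hnull : ∀ x, μ {x} = 0) (A : ℕ → Set K)
    (hA : ∀ S : Set K, ∀ ε : ℝ≥0∞, 0 < ε → ∃ n, μ (symmDiff S (A n)) < ε)
    (b : K → Ω) (hK : 𝔠 < #K) (S : Set K) (hS : #S < #K) :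
    ∃ p : K × K, p.1 ≠ p.2 ∧ p.1 ∉ S ∧ p.2 ∉ S ∧ ∀ (N : ℕ) (π : Equiv.Perm (Fin N))
      (σ : Fin N → S × Bool), kNNLabel N (Nat.sqrt N) (fun j => (b (σ j).1, (σ j).2)) π (b p.1) =
        kNNLabel N (Nat.sqrt N) (fun j => (b (σ j).1, (σ j).2)) π (b p.2) := by
  have hK0 : ℵ₀ < #K := Cardinal.aleph0_lt_continuum.trans hK
  choose B hBm hB using fun (r : Σ N : ℕ, Equiv.Perm (Fin N)) (σ : Fin r.1 → S × Bool) =>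
    factor1 μ A hA {x | kNNLabel r.1 (Nat.sqrt r.1) (fun j => (b (σ j).1, (σ j).2)) r.2 (b x) = true}
  have hSB : #(S × Bool) < #K := by
    rw [Cardinal.mk_prod, Cardinal.lift_uzero]
    refine Cardinal.mul_lt_of_lt hK0.le hS ?_
    simp only [Cardinal.mk_bool, Cardinal.lift_ofNat]
    exact lt_trans (Cardinal.natCast_lt_aleph0 (n := 2)) hK0
  have hZ : μ (⋃ r : Σ N : ℕ, Equiv.Perm (Fin N), ⋃ σ : Fin r.1 → S × Bool,
      {x | ¬ (phi A x ∈ B r σ ↔ kNNLabel r.1 (Nat.sqrt r.1) (fun j => (b (σ j).1, (σ j).2)) r.2 (b x) = true)}) = 0 := by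
    refine measure_iUnion_null fun r => hadd _ _ ?_ fun σ => hB r σ
    have : #(Fin r.1 → S × Bool) = #(S × Bool) ^ r.1 := by simp
    rw [this]
    exact lt_of_le_of_lt Cardinal.power_nat_le_max (max_lt hSB hK0)
  set Z := (⋃ r : Σ N : ℕ, Equiv.Perm (Fin N), ⋃ σ : Fin r.1 → S × Bool,
      {x | ¬ (phi A x ∈ B r σ ↔ kNNLabel r.1 (Nat.sqrt r.1) (fun j => (b (σ j).1, (σ j).2)) r.2 (b x) = true)})
    with hZdef
  have hZS : μ (Z ∪ S) = 0 := measure_union_null hZ (null_of_card μ hadd hnull S hS)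
  have hni : ¬ Set.InjOn (phi A) (Z ∪ S)ᶜ := by
    intro hinj
    have h1 := Cardinal.lift_mk_le_lift_mk_of_injective (Set.injOn_iff_injective.1 hinj)
    have h2 : #((Z ∪ S)ᶜ : Set K) ≤ 𝔠 := by simpa using h1
    have h3 := null_of_card μ hadd hnull _ (h2.trans_lt hK)
    have h4 := measure_union_null hZS h3
    rw [union_compl_self] at h4
    simp at h4
  simp only [Set.InjOn, not_forall] at hni
  obtain ⟨p, hp, p', hp', heq, hne⟩ := hni
  rw [mem_compl_iff, mem_union, not_or] at hp hp'
  refine ⟨(p, p'), hne, hp.2, hp'.2, fun N π σ => ?_⟩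
  have h1 := hp.1
  have h2 := hp'.1
  simp only [hZdef, mem_iUnion, not_exists, Set.mem_ofPred_eq, not_not] at h1 h2
  have h1 := h1 ⟨N, π⟩ σ
  have h2 := h2 ⟨N, π⟩ σ
  rw [heq] at h1
  rw [Bool.eq_iff_iff]
  exact h1.symm.trans h2

theorem discrete_prod_bool {K : Type u} [MeasurableSpace K] [DiscreteMeasurableSpace K] :
    DiscreteMeasurableSpace (K × Bool) := by
  refine ⟨fun s => ?_⟩
  have : s = ⋃ i : Bool, {x | (x, i) ∈ s} ×ˢ {i} := by
    ext ⟨x, i⟩; cases i <;> simp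
  rw [this]
  exact MeasurableSet.iUnion fun i => MeasurableSet.prod (MeasurableSet.of_discrete) (measurableSet_singleton i)

open Classical in
theorem exists_pairs {K : Type u} [LinearOrder K] [WellFoundedLT K] (hK : ℵ₀ < #K)
    (hIio : ∀ x : K, #(Set.Iio x) < #K) (P : Set K → K × K → Prop)
    (hP : ∀ S : Set K, #S < #K → ∃ p : K × K, P S p) :
    ∃ X : K → K × K, ∀ α, P ({x | ∃ β < α, x = (X β).1 ∨ x = (X β).2}) (X α) := by
  have hne : Nonempty K := by
    rw [← Cardinal.mk_ne_zero_iff]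
    exact (lt_of_le_of_lt (zero_le) hK).ne'
  have : ∀ S : Set K, ∃ p : K × K, #S < #K → P S p := by
    intro S
    by_cases h : #S < #K
    · obtain ⟨p, hp⟩ := hP S h
      exact ⟨p, fun _ => hp⟩
    · exact ⟨(hne.some, hne.some), fun h' => absurd h' h⟩
  choose c hc using this
  set X : K → K × K := (wellFounded_lt (α := K)).fix
    (fun α ih => c {x | ∃ β, ∃ h : β < α, x = (ih β h).1 ∨ x = (ih β h).2}) with hX
  refine ⟨X, fun α => ?_⟩
  have h1 : X α = c {x | ∃ β < α, x = (X β).1 ∨ x = (X β).2} := by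
    conv_lhs => rw [hX, WellFounded.fix_eq]
    simp only [← hX, exists_prop]
  have h2 : #({x | ∃ β < α, x = (X β).1 ∨ x = (X β).2} : Set K) < #K := by
    have hsub : {x | ∃ β < α, x = (X β).1 ∨ x = (X β).2} ⊆
        ((fun β : Set.Iio α => (X β).1) '' Set.univ) ∪ ((fun β : Set.Iio α => (X β).2) '' Set.univ) := by
      rintro x ⟨β, hβ, h | h⟩
      · exact Or.inl ⟨⟨β, hβ⟩, trivial, h.symm⟩
      · exact Or.inr ⟨⟨β, hβ⟩, trivial, h.symm⟩
    refine (Cardinal.mk_le_mk_of_subset hsub).trans_lt ((Cardinal.mk_union_le _ _).trans_lt ?_)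
    refine Cardinal.add_lt_of_lt hK.le (Cardinal.mk_image_le.trans_lt ?_) (Cardinal.mk_image_le.trans_lt ?_)
    all_goals simpa using hIio α
  have := hc _ h2
  rwa [← h1] at this

theorem card_le_continuum {Ω : Type u} [MetricSpace Ω] (hc : kNNUniversallyConsistent Ω)
    {K : Type u} [LinearOrder K] [WellFoundedLT K] [MeasurableSpace K] [DiscreteMeasurableSpace K]
    (μ : Measure K) [IsProbabilityMeasure μ]
    (hadd : ∀ (J : Type u) (N : J → Set K), #J < #K → (∀ j, μ (N j) = 0) → μ (⋃ j, N j) = 0)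
    (hnull : ∀ x, μ {x} = 0) (hIio : ∀ x : K, #(Set.Iio x) < #K) (A : ℕ → Set K)
    (hA : ∀ S : Set K, ∀ ε : ℝ≥0∞, 0 < ε → ∃ n, μ (symmDiff S (A n)) < ε)
    (b : K → Ω) {e : ℝ} (he : 0 < e) (hsep : ∀ i j, i ≠ j → e ≤ dist (b i) (b j)) : #K ≤ 𝔠 := by
  by_contra! hK
  have hK0 : ℵ₀ < #K := Cardinal.aleph0_lt_continuum.trans hK
  obtain ⟨X, hX⟩ := exists_pairs hK0 hIio _ (fun S hS => same_labels μ hadd hnull A hA b hK S hS)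
  set Sp : K → Set K := fun α => {x | ∃ β < α, x = (X β).1 ∨ x = (X β).2} with hSp
  set g : K × Bool → K := fun p => if p.2 then (X p.1).2 else (X p.1).1 with hg
  have hg1 : ∀ β i α, β < α → g (β, i) ∈ Sp α := by
    intro β i α h
    refine ⟨β, h, ?_⟩
    cases i <;> simp [hg]
  have hg2 : ∀ α i, g (α, i) ∉ Sp α := by
    intro α i
    obtain ⟨h1, h2, h3, h4⟩ := hX α
    cases i
    · exact h2
    · exact h3
  have hginj : Function.Injective g := by
    rintro ⟨α, i⟩ ⟨β, j⟩ h
    rcases lt_trichotomy α β with hlt | rfl | hlt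
    · exact absurd (h ▸ hg1 α i β hlt) (hg2 β j)
    · have h1 := (hX α).1
      cases i <;> cases j <;> simp [hg] at h ⊢
      · exact h1 h
      · exact h1 h.symm
    · exact absurd (h.symm ▸ hg1 β j α hlt) (hg2 α i)
  have hd : DiscreteMeasurableSpace (K × Bool) := discrete_prod_bool
  have hIic : ∀ x : K, μ (Set.Iic x) = 0 := by
    intro x
    rw [← Set.Iio_insert, Set.insert_eq]
    exact measure_union_null (hnull x) (null_of_card μ hadd hnull _ (hIio x))
  set m : Measure (K × Bool) := (2⁻¹ : ℝ≥0∞) • (μ.map (fun x => (x, true)) + μ.map (fun x => (x, false)))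
    with hm
  have hmap : ∀ (s : Set (K × Bool)), m s = 2⁻¹ * (μ {x | (x, true) ∈ s} + μ {x | (x, false) ∈ s}) := by
    intro s
    rw [hm, Measure.smul_apply, Measure.add_apply,
      Measure.map_apply (Measurable.of_discrete) (MeasurableSet.of_discrete),
      Measure.map_apply (Measurable.of_discrete) (MeasurableSet.of_discrete)]
    rfl
  have hmp : IsProbabilityMeasure m := by
    refine ⟨?_⟩
    rw [hmap]
    have : ∀ i, {x : K | (x, i) ∈ (Set.univ : Set (K × Bool))} = Set.univ := fun i => by ext; simp
    rw [this, this, measure_univ, one_add_one_eq_two]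
    exact ENNReal.inv_mul_cancel (by norm_num) (by norm_num)
  obtain ⟨N, π, hN⟩ := lemB hc m (fun p => b (g p)) he (fun i j hij => hsep _ _ (hginj.ne hij))
    (fun p => p.2) 4⁻¹ (by simp)
  obtain ⟨σ, hσ⟩ := exists_section (Measure.pi (fun _ : Fin N => m)) m ({()} : Finset Unit)
    (fun _ => {q : (Fin N → K × Bool) × (K × Bool) | kNNLabel N (Nat.sqrt N)
      (fun j => (b (g (q.1 j)), (q.1 j).2)) π (b (g q.2)) ≠ q.2.2}) 4⁻¹ (fun _ _ => hN.le)
  simp only [Finset.sum_singleton, Finset.card_singleton, Nat.cast_one, one_mul] at hσ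
  have hne : Nonempty K := by
    rw [← Cardinal.mk_ne_zero_iff]
    exact (lt_of_le_of_lt (zero_le) hK0).ne'
  obtain ⟨α0, hα0⟩ := Finite.exists_le (fun j => (σ j).1)
  set Er : Bool → Set K := fun i => {x | kNNLabel N (Nat.sqrt N)
      (fun j => (b (g (σ j)), (σ j).2)) π (b (g (x, i))) ≠ i} with hEr
  have hσ' : 2⁻¹ * (μ (Er true) + μ (Er false)) ≤ 4⁻¹ := by
    rw [hmap] at hσ
    exact hσ
  have hcov : Set.univ ⊆ (Er true ∪ Er false) ∪ Set.Iic α0 := by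
    intro α _
    by_cases hα : α ≤ α0
    · exact Or.inr hα
    left
    rw [not_le] at hα
    have h4 := (hX α).2.2.2 N π (fun j => (⟨g (σ j), hg1 _ _ _ ((hα0 j).trans_lt hα)⟩, (σ j).2))
    have h5 : kNNLabel N (Nat.sqrt N) (fun j => (b (g (σ j)), (σ j).2)) π (b (g (α, false))) =
      kNNLabel N (Nat.sqrt N) (fun j => (b (g (σ j)), (σ j).2)) π (b (g (α, true))) := h4
    by_cases hE : kNNLabel N (Nat.sqrt N) (fun j => (b (g (σ j)), (σ j).2)) π (b (g (α, true))) = true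
    · right
      change _ ≠ false
      rw [h5, hE]; simp
    · left; exact hE
  have h1 : (1 : ℝ≥0∞) ≤ μ (Er true) + μ (Er false) := by
    rw [← measure_univ (μ := μ)]
    refine (measure_mono hcov).trans ((measure_union_le _ _).trans ?_)
    rw [hIic, add_zero]
    exact measure_union_le _ _
  have h2 : (2⁻¹ : ℝ≥0∞) ≤ 4⁻¹ := by
    calc (2⁻¹ : ℝ≥0∞) = 2⁻¹ * 1 := by simp
      _ ≤ _ := by gcongr
      _ ≤ _ := hσ'
  rw [ENNReal.inv_le_inv] at h2
  norm_num at h2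

theorem exists_max_sep {Ω : Type u} [MetricSpace Ω] (e : ℝ) (he : 0 < e) : ∃ D : Set Ω,
    D.Pairwise (fun x y => e ≤ dist x y) ∧ ∀ x, ∃ y ∈ D, dist x y < e := by
  obtain ⟨F, hF⟩ := zorn_subset {F : Set Ω | F.Pairwise (fun x y => e ≤ dist x y)} (by
      intro c hc hch
      refine ⟨⋃₀ c, ?_, fun s hs => subset_sUnion_of_mem hs⟩
      exact (Set.pairwise_sUnion hch.directedOn).2 hc)
  have hF1 : F.Pairwise (fun x y => e ≤ dist x y) := hF.1
  refine ⟨F, hF1, fun S => ?_⟩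
  by_contra! hcon
  have hSF : S ∈ F := by
    have : insert S F ⊆ F := hF.2 (by
      change (insert S F).Pairwise _
      rw [Set.pairwise_insert]
      refine ⟨hF1, fun i hi _ => ⟨hcon i hi, ?_⟩⟩
      rw [dist_comm]; exact hcon i hi) (subset_insert _ _)
    exact this (mem_insert _ _)
  have := hcon S hSF
  rw [dist_self] at this
  linarith

theorem rvm_data {τ : Cardinal.{u}} (hτ : IsRealValuedMeasurableCardinal τ) :
    ∃ (K : Type u) (_ : LinearOrder K) (_ : WellFoundedLT K) (_ : MeasurableSpace K)
      (_ : DiscreteMeasurableSpace K) (μ : Measure K), IsProbabilityMeasure μ ∧ #K = τ ∧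
      (∀ (J : Type u) (N : J → Set K), #J < #K → (∀ j, μ (N j) = 0) → μ (⋃ j, N j) = 0) ∧
      (∀ x, μ {x} = 0) ∧ (∀ x : K, #(Set.Iio x) < #K) := by
  obtain ⟨μ, h1, h2, h3⟩ := hτ
  let _ : MeasurableSpace τ.out := ⊤
  have hKτ : #(τ.ord.ToType) = τ := by simp
  obtain ⟨e⟩ : Nonempty (τ.out ≃ τ.ord.ToType) := by
    rw [← Cardinal.eq, hKτ, Cardinal.mk_out]
  let _ : MeasurableSpace τ.ord.ToType := ⊤
  have hdm : DiscreteMeasurableSpace τ.ord.ToType := ⟨fun s => trivial⟩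
  have hem : Measurable e := fun s _ => trivial
  have hmap : ∀ s, μ.map e s = μ (e ⁻¹' s) := fun s => Measure.map_apply hem trivial
  refine ⟨τ.ord.ToType, inferInstance, inferInstance, ⊤, hdm, μ.map e, ⟨?_⟩, hKτ, ?_, ?_, ?_⟩
  · rw [hmap]; exact h1
  · intro J N hJ hN
    rw [hmap, preimage_iUnion, ← sUnion_range]
    apply h3
    · refine Cardinal.mk_range_le.trans_lt ?_
      rwa [hKτ] at hJ
    · rintro _ ⟨j, rfl⟩
      rw [← hmap]; exact hN j
  · intro x
    rw [hmap]
    have : e ⁻¹' {x} = {e.symm x} := by ext y; simp [Equiv.eq_symm_apply]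
    rw [this]; exact h2 _
  · intro x
    rw [hKτ]
    exact Cardinal.mk_Iio_toType_ord_lt x

open Classical in
theorem backward {Ω : Type u} [MetricSpace Ω] (hc : kNNUniversallyConsistent Ω)
    (τ : Cardinal.{u}) (hτ : IsRealValuedMeasurableCardinal τ) : densityCard Ω < τ := by
  by_contra! hle
  obtain ⟨K, _, _, _, _, μ, _, hK, hadd, hnull, hIio⟩ := rvm_data hτ
  choose D hD1 hD2 using fun n : ℕ => exists_max_sep (Ω := Ω) (1 / ((n : ℝ) + 1)) (by positivity)
  have hdense : Dense (⋃ n, D n) := by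
    intro x
    rw [Metric.mem_closure_iff]
    intro ε hε
    obtain ⟨n, hn⟩ := exists_nat_one_div_lt hε
    obtain ⟨y, hy, hd⟩ := hD2 n x
    exact ⟨y, mem_iUnion.2 ⟨n, hy⟩, hd.trans hn⟩
  have h1 : #K ≤ #(⋃ n, D n : Set Ω) := by
    rw [hK]
    exact hle.trans (csInf_le' ⟨_, hdense, rfl⟩)
  obtain ⟨i⟩ := h1
  have h2 : ∃ n, #K ≤ #({x : K | (i x : Ω) ∈ D n} : Set K) := by
    by_contra! hcon
    have h3 : μ (⋃ n, {x : K | (i x : Ω) ∈ D n}) = 0 :=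
      measure_iUnion_null fun n => null_of_card μ hadd hnull _ (hcon n)
    have : (⋃ n, {x : K | (i x : Ω) ∈ D n}) = Set.univ := by
      ext x
      simpa using mem_iUnion.1 (i x).2
    rw [this] at h3
    simp at h3
  obtain ⟨n, ⟨j⟩⟩ := h2
  set b : K → Ω := fun x => (i (j x).1).1 with hb
  have he : 0 < 1 / ((n : ℝ) + 1) := by positivity
  have hsep : ∀ x y, x ≠ y → 1 / ((n : ℝ) + 1) ≤ dist (b x) (b y) := by
    intro x y hxy
    refine hD1 n (j x).2 (j y).2 ?_
    intro h
    exact hxy (j.injective (Subtype.ext (i.injective (Subtype.ext h))))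
  obtain ⟨A, hA⟩ := exists_dense_seq μ
    (fun p σ l x => kNNLabel p.1 (Nat.sqrt p.1) (fun j => (b (σ j), l j)) p.2 (b x)) (by
      intro S ε hε
      obtain ⟨N, π, h⟩ := lemB hc μ b he hsep (fun x => decide (x ∈ S)) ε hε
      exact ⟨⟨N, π⟩, h⟩)
  have hcc := card_le_continuum hc μ hadd hnull hIio A hA b he hsep
  have : Cardinal.lift.{0} #K ≤ Cardinal.lift.{u} #(ℕ → Bool) := by simpa using hcc
  obtain ⟨h⟩ := Cardinal.lift_mk_le'.1 this
  exact gitik_shelah μ hadd hnull hIio A hA h h.injective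

end KNNAux

namespace KNNAux

open Classical in
theorem exists_rvm {I : Type u} [MeasurableSpace I] [DiscreteMeasurableSpace I] (ν : Measure I)
    [IsFiniteMeasure ν] (hν : ν ≠ 0) (hx : ∀ x, ν {x} = 0) :
    ∃ τ : Cardinal.{u}, τ ≤ #I ∧ IsRealValuedMeasurableCardinal τ := by
  set C : Set Cardinal.{u} := {c | ∃ (J : Type u) (N : J → Set I), #J = c ∧ (∀ j, ν (N j) = 0) ∧
    ν (⋃ j, N j) ≠ 0} with hC
  have hI : #I ∈ C := by
    refine ⟨I, fun x => {x}, rfl, hx, ?_⟩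
    rw [iUnion_of_singleton]
    simpa using hν
  have hτ := csInf_mem ⟨_, hI⟩
  refine ⟨sInf C, csInf_le' hI, ?_⟩
  have hmin : ∀ (J : Type u) (N : J → Set I), #J < sInf C → (∀ j, ν (N j) = 0) → ν (⋃ j, N j) = 0 := by
    intro J N hJ hN
    by_contra hne
    exact notMem_of_lt_csInf' hJ ⟨J, N, rfl, hN, hne⟩
  set τ := sInf C
  obtain ⟨J, N, hJ, hN, hU⟩ := hτ
  obtain ⟨e⟩ : Nonempty (J ≃ τ.out) := by
    rw [← Cardinal.eq, hJ, Cardinal.mk_out]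
  set U := ⋃ j, N j with hUdef
  have hJn : Nonempty J := by
    by_contra h
    rw [not_nonempty_iff] at h
    apply hU
    simp [hUdef]
  set f : I → τ.out := fun x => if h : ∃ j, x ∈ N j then e h.choose else e hJn.some with hf
  have hfN : ∀ x ∈ U, ∀ y, f x = y → x ∈ N (e.symm y) := by
    intro x hx y hy
    have h : ∃ j, x ∈ N j := by simpa [hUdef] using hx
    have : f x = e h.choose := by simp only [hf, dif_pos h]
    rw [← hy, this, Equiv.symm_apply_apply]
    exact h.choose_spec
  let _ : MeasurableSpace τ.out := ⊤
  have hfm : Measurable f := Measurable.of_discrete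
  have happ : ∀ S, ((ν U)⁻¹ • (ν.restrict U).map f) S = (ν U)⁻¹ * ν (f ⁻¹' S ∩ U) := by
    intro S
    rw [Measure.smul_apply, Measure.map_apply hfm trivial, Measure.restrict_apply MeasurableSet.of_discrete]
    rfl
  have hnn : ∀ S, ((ν U)⁻¹ • (ν.restrict U).map f) S = 0 ↔ ν (f ⁻¹' S ∩ U) = 0 := by
    intro S
    rw [happ, mul_eq_zero, ENNReal.inv_eq_zero]
    simp [measure_ne_top]
  refine ⟨(ν U)⁻¹ • (ν.restrict U).map f, ?_, ?_, ?_⟩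
  · rw [happ]
    simp only [preimage_univ, univ_inter]
    exact ENNReal.inv_mul_cancel hU (measure_ne_top _ _)
  · intro y
    rw [hnn]
    exact measure_mono_null (fun x hx => hfN x hx.2 y hx.1) (hN (e.symm y))
  · intro 𝒩 h𝒩 hA
    rw [hnn, sUnion_eq_iUnion, preimage_iUnion, iUnion_inter]
    exact hmin _ _ h𝒩 fun A => (hnn _).1 (hA A.1 A.2)

theorem conc {I : Type u} [MeasurableSpace I] [DiscreteMeasurableSpace I] (ν : Measure I)
    [IsFiniteMeasure ν] (hI : ∀ τ : Cardinal.{u}, IsRealValuedMeasurableCardinal τ → #I < τ) :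
    ∃ C : Set I, C.Countable ∧ ν Cᶜ = 0 := by
  refine ⟨{i | 0 < ν {i}}, ?_, ?_⟩
  · refine Measure.countable_meas_pos_of_disjoint_iUnion (As := fun i => {i})
      (fun i => MeasurableSet.of_discrete) ?_
    intro i j hij
    simpa [Function.onFun] using hij
  · by_contra hne
    obtain ⟨τ, h1, h2⟩ := exists_rvm (ν.restrict {i | 0 < ν {i}}ᶜ) (by simpa using hne) (by
      intro x
      rw [Measure.restrict_apply MeasurableSet.of_discrete]
      by_cases hx : 0 < ν {x}
      · have : {x} ∩ {i | 0 < ν {i}}ᶜ = ∅ := by ext y; simp; rintro rfl; exact hx.ne'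
        rw [this]; simp
      · refine measure_mono_null inter_subset_left ?_
        simpa using hx)
    exact absurd (hI τ h2) (not_lt.2 h1)

theorem conc_sep {Ω : Type u} [MetricSpace Ω] [MeasurableSpace Ω] [BorelSpace Ω] (μ : Measure Ω)
    [IsFiniteMeasure μ] {I : Type u}
    (hI : ∀ τ : Cardinal.{u}, IsRealValuedMeasurableCardinal τ → #I < τ) (E : I → Set Ω)
    (hE : ∀ i, IsClosed (E i)) {d : ℝ} (hd : 0 < d)
    (hsep : ∀ i j, i ≠ j → ∀ x ∈ E i, ∀ y ∈ E j, d ≤ dist x y) :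
    ∃ C : Set I, C.Countable ∧ μ (⋃ i ∈ Cᶜ, E i) = 0 := by
  have hcl : ∀ J : Set I, IsClosed (⋃ i ∈ J, E i) := by
    intro J
    rw [biUnion_eq_iUnion]
    refine LocallyFinite.isClosed_iUnion ?_ fun i => hE i
    intro x
    refine ⟨ball x (d / 2), ball_mem_nhds _ (by positivity), Set.Subsingleton.finite ?_⟩
    rintro i ⟨y, hy1, hy2⟩ j ⟨z, hz1, hz2⟩
    by_contra hne
    have := hsep i j (fun h => hne (Subtype.ext h)) y hy1 z hz1
    rw [mem_ball] at hy2 hz2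
    have h3 := dist_triangle_right y z x
    linarith
  have huniq : ∀ x i j, x ∈ E i → x ∈ E j → i = j := by
    intro x i j h1 h2
    by_contra hne
    have := hsep i j hne x h1 x h2
    rw [dist_self] at this
    linarith
  set U : Set Ω := ⋃ i ∈ (Set.univ : Set I), E i with hU
  have hUm : MeasurableSet U := (hcl Set.univ).measurableSet
  have hex : ∀ x : U, ∃ i, (x : Ω) ∈ E i := by
    rintro ⟨x, hx⟩
    simpa [hU] using hx
  choose g hg using hex
  let _ : MeasurableSpace I := ⊤
  have hpre : ∀ J : Set I, g ⁻¹' J = Subtype.val ⁻¹' (⋃ i ∈ J, E i) := by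
    intro J
    ext x
    simp only [mem_preimage, mem_iUnion, exists_prop]
    constructor
    · intro h; exact ⟨_, h, hg x⟩
    · rintro ⟨i, hi, hx⟩
      rwa [huniq _ _ _ (hg x) hx]
  have hgm : Measurable g := by
    intro J _
    rw [hpre]
    exact measurable_subtype_coe (hcl J).measurableSet
  have : DiscreteMeasurableSpace I := ⟨fun _ => trivial⟩
  have hfin : IsFiniteMeasure (μ.comap (Subtype.val : U → Ω)) := by
    refine ⟨?_⟩
    rw [comap_subtype_coe_apply hUm]
    exact measure_lt_top _ _
  obtain ⟨C, hC, h0⟩ := conc ((μ.comap (Subtype.val : U → Ω)).map g) hI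
  refine ⟨C, hC, ?_⟩
  rw [Measure.map_apply hgm trivial, hpre, comap_subtype_coe_apply hUm, Subtype.image_preimage_coe] at h0
  refine measure_mono_null ?_ h0
  intro x hx
  refine ⟨?_, hx⟩
  simp only [mem_iUnion, exists_prop] at hx
  obtain ⟨i, _, hi⟩ := hx
  simp only [hU, mem_iUnion]
  exact ⟨i, trivial, hi⟩

theorem exists_separable_carrier {Ω : Type u} [MetricSpace Ω] [MeasurableSpace Ω] [BorelSpace Ω]
    (μ : Measure Ω) [IsFiniteMeasure μ]
    (hden : ∀ τ : Cardinal.{u}, IsRealValuedMeasurableCardinal τ → densityCard Ω < τ) :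
    ∃ Y : Set Ω, IsClosed Y ∧ TopologicalSpace.IsSeparable Y ∧ μ Yᶜ = 0 := by
  obtain ⟨s, hs, hsc⟩ : densityCard Ω ∈ {c : Cardinal.{u} | ∃ s : Set Ω, Dense s ∧ #s = c} :=
    csInf_mem ⟨_, Set.univ, dense_univ, rfl⟩
  rw [← hsc] at hden
  obtain ⟨lo, wf⟩ := exists_wellFoundedLT s
  set E : ℕ → ℕ → s → Set Ω := fun n m d =>
    closedBall (d : Ω) (1 / ((n : ℝ) + 1) - 1 / ((m : ℝ) + 1)) \ ⋃ β : s, ⋃ (_ : lo.lt β d), ball (β : Ω) (1 / ((n : ℝ) + 1)) with hE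
  have hEc : ∀ n m d, IsClosed (E n m d) := by
    intro n m d
    exact isClosed_closedBall.sdiff (isOpen_iUnion fun _ => isOpen_iUnion fun _ => isOpen_ball)
  have hEs0 : ∀ n m d d', lo.lt d d' → ∀ x ∈ E n m d, ∀ y ∈ E n m d', 1 / ((m : ℝ) + 1) ≤ dist x y := by
    intro n m d d' hlt x hx y hy
    have h1 : dist x d ≤ 1 / ((n : ℝ) + 1) - 1 / ((m : ℝ) + 1) := hx.1
    have h2 : y ∉ ball (d : Ω) (1 / ((n : ℝ) + 1)) := by
      intro h
      apply hy.2
      simp only [mem_iUnion]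
      exact ⟨d, hlt, h⟩
    rw [mem_ball, not_lt] at h2
    have h3 := dist_triangle_left y d x
    linarith
  have hEs : ∀ n m d d', d ≠ d' → ∀ x ∈ E n m d, ∀ y ∈ E n m d', 1 / ((m : ℝ) + 1) ≤ dist x y := by
    intro n m d d' hne x hx y hy
    rcases lt_or_gt_of_ne hne with h | h
    · exact hEs0 n m d d' h x hx y hy
    · rw [dist_comm]; exact hEs0 n m d' d h y hy x hx
  choose C hC hC0 using fun n m => conc_sep μ hden (E n m) (hEc n m)
    (show (0 : ℝ) < 1 / ((m : ℝ) + 1) by positivity) (hEs n m)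
  set Q : Set Ω := ⋃ n, ⋃ m, Subtype.val '' C n m with hQ
  have hQc : Q.Countable := countable_iUnion fun n => countable_iUnion fun m => (hC n m).image _
  refine ⟨closure Q, isClosed_closure, hQc.isSeparable.closure, ?_⟩
  have hnull : μ (⋃ n, ⋃ m, ⋃ i ∈ (C n m)ᶜ, E n m i) = 0 :=
    measure_iUnion_null fun n => measure_iUnion_null fun m => hC0 n m
  refine measure_mono_null ?_ hnull
  intro x hx
  by_contra hx2
  apply hx
  rw [Metric.mem_closure_iff]
  intro ε hε
  obtain ⟨n, hn⟩ := exists_nat_one_div_lt hε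
  have hne : {d : s | dist x d < 1 / ((n : ℝ) + 1)}.Nonempty := by
    obtain ⟨d, hd, h⟩ := hs.exists_dist_lt x (show (0 : ℝ) < 1 / ((n : ℝ) + 1) by positivity)
    exact ⟨⟨d, hd⟩, h⟩
  set d := WellFounded.min (wellFounded_lt (α := s)) _ hne with hd
  have hd1 : dist x d < 1 / ((n : ℝ) + 1) := WellFounded.min_mem _ _ hne
  have hd2 : ∀ β, lo.lt β d → ¬ dist x β < 1 / ((n : ℝ) + 1) := by
    intro β hβ h
    exact WellFounded.not_lt_min (wellFounded_lt (α := s)) (s := {d : s | dist x d < 1 / ((n : ℝ) + 1)}) h hβ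
  obtain ⟨m, hm⟩ := exists_nat_one_div_lt (sub_pos.2 hd1)
  have hxE : x ∈ E n m d := by
    refine ⟨?_, ?_⟩
    · rw [mem_closedBall]; linarith
    · simp only [mem_iUnion, not_exists]
      exact hd2
  have hdC : d ∈ C n m := by
    by_contra h
    apply hx2
    simp only [mem_iUnion]
    exact ⟨n, m, d, h, hxE⟩
  refine ⟨d, ?_, hd1.trans hn⟩
  simp only [hQ, mem_iUnion]
  exact ⟨n, m, d, hdC, rfl⟩

theorem transfer {Ω : Type u} [MetricSpace Ω] [MeasurableSpace Ω] [BorelSpace Ω]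
    (Y : Set Ω) (hY : MeasurableSet Y) (μt : Measure (Ω × Bool)) [IsProbabilityMeasure μt]
    (h0 : μt (Prod.fst ⁻¹' Yᶜ) = 0) :
    ∃ ν : Measure (Y × Bool), IsProbabilityMeasure ν ∧ bayesError ν = bayesError μt ∧
      ∀ n k, kNNError ν n k = kNNError μt n k := by
  set i : Y × Bool → Ω × Bool := Prod.map Subtype.val id with hi
  have hie : MeasurableEmbedding i := (MeasurableEmbedding.subtype_coe hY).prodMap MeasurableEmbedding.id
  have hr : Set.range i = Prod.fst ⁻¹' Y := by
    ext ⟨x, c⟩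
    simp [hi]
  have hmap : (μt.comap i).map i = μt := by
    rw [hie.map_comap, hr]
    rw [Measure.restrict_eq_self_of_ae_mem]
    rw [ae_iff]
    exact h0
  set ν := μt.comap i with hν
  have hνp : IsProbabilityMeasure ν := by
    refine ⟨?_⟩
    have : μt Set.univ = 1 := measure_univ
    rw [← hmap, hie.map_apply] at this
    simpa using this
  have hne : Nonempty (Y × Bool) := by
    by_contra h
    rw [not_nonempty_iff] at h
    have := measure_univ (μ := ν)
    rw [univ_eq_empty_iff.2 h] at this
    simp at this
  refine ⟨ν, hνp, ?_, ?_⟩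
  · apply le_antisymm
    · refine le_iInf₂ fun T hT => ?_
      refine (iInf₂_le (fun y : Y => T y) (hT.comp measurable_subtype_coe)).trans ?_
      conv_rhs => rw [← hmap, hie.map_apply]
      rfl
    · refine le_iInf₂ fun T hT => ?_
      obtain ⟨T', hT', hTT⟩ := (MeasurableEmbedding.subtype_coe hY).exists_measurable_extend hT
        (fun _ => ⟨true⟩)
      refine (iInf₂_le T' hT').trans ?_
      conv_lhs => rw [← hmap, hie.map_apply]
      subst hTT
      rfl
  · intro n k
    obtain ⟨ρ, hρ, hρi⟩ := hie.exists_measurable_extend (g := id) measurable_id (fun _ => hne)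
    have hpe : MeasurableEmbedding (fun (σ : Fin n → Y × Bool) j => i (σ j)) := by
      refine MeasurableEmbedding.of_measurable_inverse (g := fun σ j => ρ (σ j)) ?_ ?_ ?_ ?_
      · exact measurable_pi_lambda _ fun j => hie.measurable.comp (measurable_pi_apply j)
      · have : Set.range (fun (σ : Fin n → Y × Bool) j => i (σ j)) = Set.univ.pi fun _ => Set.range i := by
          ext σ
          simp only [mem_range, Set.mem_pi, mem_univ, forall_const]
          constructor
          · rintro ⟨σ', rfl⟩ j; exact ⟨_, rfl⟩
          · intro h
            choose σ' h' using h
            exact ⟨σ', funext h'⟩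
        rw [this]
        exact MeasurableSet.univ_pi fun _ => hie.measurableSet_range
      · exact measurable_pi_lambda _ fun j => hρ.comp (measurable_pi_apply j)
      · intro σ
        funext j
        exact congrFun hρi (σ j)
    unfold kNNError
    congr 1
    refine Finset.sum_congr rfl fun π _ => ?_
    conv_rhs => rw [← hmap]
    have e1 : (Measure.pi fun _ : Fin n => ν.map i) = (Measure.pi fun _ : Fin n => ν).map
        (fun σ j => i (σ j)) := by
      have : SigmaFinite (ν.map i) := by rw [hmap]; infer_instance
      exact (Measure.pi_map_pi (fun _ => hie.measurable.aemeasurable)).symm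
    rw [e1, Measure.map_prod_map _ _ hpe.measurable hie.measurable, (hpe.prodMap hie).map_apply]
    rfl

end KNNAux

namespace KNNAux

section
variable {Y : Type u} [MetricSpace Y] [MeasurableSpace Y] [BorelSpace Y] [SecondCountableTopology Y]

open Classical in
theorem mult_sum (μ : Measure Y) (f : Y → ℝ≥0∞) (hf : Measurable f) (G : Finset (Y × ℝ)) (c : ℕ)
    (hG : ∀ z : Y, (G.filter fun q => dist z q.1 ≤ q.2).card ≤ c) :
    ∑ q ∈ G, ∫⁻ z in closedBall q.1 q.2, f z ∂μ ≤ c * ∫⁻ z, f z ∂μ := by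
  have h1 : ∀ q ∈ G, ∫⁻ z in closedBall q.1 q.2, f z ∂μ =
      ∫⁻ z, (closedBall q.1 q.2).indicator f z ∂μ := fun q _ =>
    (lintegral_indicator isClosed_closedBall.measurableSet f).symm
  rw [Finset.sum_congr rfl h1, ← lintegral_finsetSum _ fun q _ =>
    hf.indicator isClosed_closedBall.measurableSet, ← lintegral_const_mul _ hf]
  refine lintegral_mono fun z => ?_
  calc ∑ q ∈ G, (closedBall q.1 q.2).indicator f z = ∑ q ∈ G, if dist z q.1 ≤ q.2 then f z else 0 := by
        refine Finset.sum_congr rfl fun q _ => ?_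
        simp [indicator, mem_closedBall]
    _ = ((G.filter fun q => dist z q.1 ≤ q.2).card : ℝ≥0∞) * f z := by
        rw [← Finset.sum_filter]; simp
    _ ≤ c * f z := by gcongr; exact hG z

theorem weak_eta (μ : Measure Y) (f : Y → ℝ≥0∞) (hf : Measurable f) (X : Set Y) (δ : ℕ) (s : ℝ)
    (hX : NagataDimLE X δ s) (t : ℝ≥0∞) (e : ℝ) (he : 0 < e) :
    t * μ {x | x ∈ X ∧ ∃ r, 0 ≤ r ∧ r < s ∧
      t * μ (closedBall x (r + e)) < ∫⁻ z in closedBall x r, f z ∂μ} ≤ (δ + 1 : ℕ) * ∫⁻ z, f z ∂μ := by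
  classical
  set E := {x | x ∈ X ∧ ∃ r, 0 ≤ r ∧ r < s ∧
      t * μ (closedBall x (r + e)) < ∫⁻ z in closedBall x r, f z ∂μ} with hE
  rcases isEmpty_or_nonempty Y with hY | hY
  · have : E = ∅ := Subsingleton.elim _ _
    rw [this]; simp
  set z := TopologicalSpace.denseSeq Y
  set P : ℕ → Set Y := fun i => closedBall (z i) (e / 2)
  have hcov : E = ⋃ n : ℕ, (E ∩ ⋃ i ∈ Finset.range n, P i) := by
    rw [← inter_iUnion]
    symm
    apply inter_eq_left.2
    intro x _
    obtain ⟨i, hi⟩ := (TopologicalSpace.denseRange_denseSeq Y).exists_dist_lt x (half_pos he)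
    simp only [mem_iUnion]
    exact ⟨i + 1, i, by simp, hi.le⟩
  have hmono : Monotone fun n : ℕ => (E ∩ ⋃ i ∈ Finset.range n, P i) := by
    intro n m hnm
    refine inter_subset_inter_right _ (biUnion_subset_biUnion_left ?_)
    intro i hi
    simp at hi ⊢
    omega
  rw [hcov, hmono.measure_iUnion, ENNReal.mul_iSup]
  refine iSup_le fun n => ?_
  have hch : ∀ i : ℕ, ∃ q : Y × ℝ, (E ∩ P i).Nonempty → q.1 ∈ E ∩ P i ∧ 0 ≤ q.2 ∧ q.2 < s ∧
      t * μ (closedBall q.1 (q.2 + e)) < ∫⁻ z in closedBall q.1 q.2, f z ∂μ := by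
    intro i
    by_cases h : (E ∩ P i).Nonempty
    · obtain ⟨x, hx, hx2⟩ := h
      obtain ⟨r, hr⟩ := hx.2
      exact ⟨(x, r), fun _ => ⟨⟨hx, hx2⟩, hr⟩⟩
    · exact ⟨(hY.some, 0), fun h' => absurd h' h⟩
  choose q hq using hch
  set F : Finset (Y × ℝ) := ((Finset.range n).filter fun i => (E ∩ P i).Nonempty).image q
  have hFp : ∀ p ∈ F, p.1 ∈ X ∧ 0 ≤ p.2 ∧ p.2 < s ∧
      t * μ (closedBall p.1 (p.2 + e)) < ∫⁻ z in closedBall p.1 p.2, f z ∂μ := by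
    intro p hp
    simp only [F, Finset.mem_image, Finset.mem_filter] at hp
    obtain ⟨i, ⟨_, hi⟩, rfl⟩ := hp
    obtain ⟨h1, h2⟩ := hq i hi
    exact ⟨h1.1.1, h2⟩
  obtain ⟨G, hGF, hGc, hGm⟩ := hX F (fun p hp => ⟨(hFp p hp).1, (hFp p hp).2.1, (hFp p hp).2.2.1⟩)
  have hsub : (E ∩ ⋃ i ∈ Finset.range n, P i) ⊆ ⋃ p ∈ G, closedBall p.1 (p.2 + e) := by
    rintro y ⟨hyE, hy⟩
    simp only [mem_iUnion, exists_prop] at hy ⊢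
    obtain ⟨i, hi, hyi⟩ := hy
    have hne : (E ∩ P i).Nonempty := ⟨y, hyE, hyi⟩
    obtain ⟨g, hg, hg2⟩ := hGc (q i) (by
      simp only [F, Finset.mem_image, Finset.mem_filter]
      exact ⟨i, ⟨hi, hne⟩, rfl⟩)
    refine ⟨g, hg, ?_⟩
    have h1 : dist y (z i) ≤ e / 2 := hyi
    have h2 : dist (q i).1 (z i) ≤ e / 2 := (hq i hne).1.2
    have h3 := dist_triangle_right y (q i).1 (z i)
    have h4 := dist_triangle y (q i).1 g.1
    rw [mem_closedBall] at hg2 ⊢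
    linarith
  calc t * μ (E ∩ ⋃ i ∈ Finset.range n, P i) ≤ t * ∑ p ∈ G, μ (closedBall p.1 (p.2 + e)) := by
        gcongr
        exact (measure_mono hsub).trans (measure_biUnion_finset_le _ _)
    _ = ∑ p ∈ G, t * μ (closedBall p.1 (p.2 + e)) := Finset.mul_sum _ _ _
    _ ≤ ∑ p ∈ G, ∫⁻ z in closedBall p.1 p.2, f z ∂μ :=
        Finset.sum_le_sum fun p hp => (hFp p (hGF hp)).2.2.2.le
    _ ≤ _ := mult_sum μ f hf G _ (by convert hGm)

theorem weak_type (μ : Measure Y) [IsFiniteMeasure μ] (f : Y → ℝ≥0∞) (hf : Measurable f) (X : Set Y)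
    (δ : ℕ) (s : ℝ) (hX : NagataDimLE X δ s) (t : ℝ≥0∞) (ht : t ≠ ⊤) :
    t * μ {x | x ∈ X ∧ ∃ r, 0 ≤ r ∧ r < s ∧
      t * μ (closedBall x r) < ∫⁻ z in closedBall x r, f z ∂μ} ≤ (δ + 1 : ℕ) * ∫⁻ z, f z ∂μ := by
  set En : ℕ → Set Y := fun m => {x | x ∈ X ∧ ∃ r, 0 ≤ r ∧ r < s ∧
      t * μ (closedBall x (r + 1 / ((m : ℝ) + 1))) < ∫⁻ z in closedBall x r, f z ∂μ} with hEn
  have hmono : Monotone En := by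
    intro m m' hm x hx
    obtain ⟨h1, r, h2, h3, h4⟩ := hx
    refine ⟨h1, r, h2, h3, lt_of_le_of_lt ?_ h4⟩
    have : 1 / ((m' : ℝ) + 1) ≤ 1 / ((m : ℝ) + 1) := by gcongr
    gcongr
  have hsub : {x | x ∈ X ∧ ∃ r, 0 ≤ r ∧ r < s ∧
      t * μ (closedBall x r) < ∫⁻ z in closedBall x r, f z ∂μ} ⊆ ⋃ m, En m := by
    rintro x ⟨h1, r, h2, h3, h4⟩
    have hlim : Tendsto (fun m : ℕ => μ (closedBall x (r + 1 / ((m : ℝ) + 1)))) atTop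
        (nhds (μ (⋂ m : ℕ, closedBall x (r + 1 / ((m : ℝ) + 1))))) := by
      refine tendsto_measure_iInter_atTop (fun m => isClosed_closedBall.measurableSet.nullMeasurableSet) ?_ ⟨0, measure_ne_top _ _⟩
      intro m m' hm
      refine closedBall_subset_closedBall ?_
      have : 1 / ((m' : ℝ) + 1) ≤ 1 / ((m : ℝ) + 1) := by gcongr
      linarith
    have hint : (⋂ m : ℕ, closedBall x (r + 1 / ((m : ℝ) + 1))) = closedBall x r := by
      ext y
      simp only [mem_iInter, mem_closedBall]
      constructor
      · intro h
        refine le_of_forall_pos_le_add fun ε hε => ?_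
        obtain ⟨m, hm⟩ := exists_nat_one_div_lt hε
        linarith [h m]
      · intro h m
        have : 0 < 1 / ((m : ℝ) + 1) := by positivity
        linarith
    rw [hint] at hlim
    have hlim2 := ENNReal.Tendsto.const_mul hlim (Or.inr ht)
    obtain ⟨m, hm⟩ := (hlim2.eventually (gt_mem_nhds h4)).exists
    exact mem_iUnion.2 ⟨m, h1, r, h2, h3, hm⟩
  refine (mul_le_mul_right (measure_mono hsub) t).trans ?_
  rw [hmono.measure_iUnion, ENNReal.mul_iSup]
  exact iSup_le fun m => weak_eta μ f hf X δ s hX t _ (by positivity)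

theorem diff_piece (μ : Measure Y) [IsProbabilityMeasure μ] (h : Y → ℝ) (hm : Measurable h)
    (hb : ∀ x, |h x| ≤ 1) (X : Set Y) (δ : ℕ) (s : ℝ) (hs : 0 < s) (hX : NagataDimLE X δ s)
    (ε : NNReal) (hε : 0 < ε) :
    μ {x | x ∈ X ∧ ¬ ∃ ρ > 0, ∀ r, 0 ≤ r → r < ρ →
      ∫⁻ z in closedBall x r, ‖h z - h x‖ₑ ∂μ ≤ 3 * ε * μ (closedBall x r)} = 0 := by
  set Bad := {x | x ∈ X ∧ ¬ ∃ ρ > 0, ∀ r, 0 ≤ r → r < ρ →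
      ∫⁻ z in closedBall x r, ‖h z - h x‖ₑ ∂μ ≤ 3 * ε * μ (closedBall x r)} with hBad
  have hLp : MemLp h 1 μ := MemLp.of_bound hm.aestronglyMeasurable 1
    (Eventually.of_forall fun x => by simpa using hb x)
  have key : ∀ c : ℝ≥0∞, c ≠ 0 → ε * μ Bad ≤ ((δ + 1 : ℕ) + 1) * c := by
    intro c hc
    obtain ⟨g, hg, -⟩ := hLp.exists_boundedContinuous_eLpNorm_sub_le ENNReal.one_ne_top hc
    have hgm : Measurable g := g.continuous.measurable
    rw [eLpNorm_one_eq_lintegral_enorm] at hg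
    have hfm : Measurable fun x => ‖(h - ⇑g) x‖ₑ := (hm.sub hgm).enorm
    have hsub : Bad ⊆ {x | x ∈ X ∧ ∃ r, 0 ≤ r ∧ r < s ∧
      (ε : ℝ≥0∞) * μ (closedBall x r) < ∫⁻ z in closedBall x r, ‖(h - ⇑g) z‖ₑ ∂μ} ∪
        {x | (ε : ℝ≥0∞) ≤ ‖(h - ⇑g) x‖ₑ} := by
      rintro x ⟨hxX, hx⟩
      by_contra hcon
      rw [mem_union, not_or] at hcon
      obtain ⟨h1, h2⟩ := hcon
      simp only [Set.mem_ofPred_eq, not_and, not_exists, not_lt, not_le] at h1 h2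
      have h1 := h1 hxX
      apply hx
      obtain ⟨ρ0, hρ0, hcont⟩ := Metric.continuousAt_iff.1 (g.continuous.continuousAt (x := x)) ε
        (by exact_mod_cast hε)
      refine ⟨min s ρ0, lt_min hs hρ0, fun r hr0 hr => ?_⟩
      calc ∫⁻ z in closedBall x r, ‖h z - h x‖ₑ ∂μ
          ≤ ∫⁻ z in closedBall x r, (‖(h - ⇑g) z‖ₑ + (ε + ε)) ∂μ := by
            refine setLIntegral_mono (hfm.add_const _) fun z hz => ?_
            have e1 : h z - h x = (h - ⇑g) z + ((g z - g x) + -(h - ⇑g) x) := by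
              simp only [Pi.sub_apply]; ring
            rw [e1]
            refine (enorm_add_le _ _).trans ?_
            gcongr
            refine (enorm_add_le _ _).trans ?_
            have e2 : ‖g z - g x‖ₑ ≤ ε := by
              have hz2 : dist z x < ρ0 := lt_of_le_of_lt hz (hr.trans_le (min_le_right _ _))
              have := hcont hz2
              rw [dist_eq_norm] at this
              rw [enorm_eq_nnnorm]
              exact_mod_cast this.le
            have e3 : ‖-(h - ⇑g) x‖ₑ ≤ ε := by rw [enorm_neg]; exact h2.le
            gcongr
        _ = ∫⁻ z in closedBall x r, ‖(h - ⇑g) z‖ₑ ∂μ + (ε + ε) * μ (closedBall x r) := by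
            rw [lintegral_add_left hfm]; simp
        _ ≤ ε * μ (closedBall x r) + (ε + ε) * μ (closedBall x r) := by
            gcongr
            exact h1 r hr0 (hr.trans_le (min_le_left _ _))
        _ = 3 * ε * μ (closedBall x r) := by ring
    calc (ε : ℝ≥0∞) * μ Bad ≤ ε * (μ {x | x ∈ X ∧ ∃ r, 0 ≤ r ∧ r < s ∧
      (ε : ℝ≥0∞) * μ (closedBall x r) < ∫⁻ z in closedBall x r, ‖(h - ⇑g) z‖ₑ ∂μ} +
          μ {x | (ε : ℝ≥0∞) ≤ ‖(h - ⇑g) x‖ₑ}) := by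
          gcongr
          exact (measure_mono hsub).trans (measure_union_le _ _)
      _ ≤ (δ + 1 : ℕ) * c + c := by
          rw [mul_add]
          refine add_le_add ((weak_type μ _ hfm X δ s hX ε ENNReal.coe_ne_top).trans (by gcongr)) ?_
          exact (mul_meas_ge_le_lintegral hfm _).trans hg
      _ = _ := by ring
  have h0 : (ε : ℝ≥0∞) * μ Bad = 0 := by
    by_contra hne
    have hfin : (ε : ℝ≥0∞) * μ Bad ≠ ⊤ := ENNReal.mul_ne_top ENNReal.coe_ne_top (measure_ne_top _ _)
    set a := (ε : ℝ≥0∞) * μ Bad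
    set b : ℝ≥0∞ := ((δ + 1 : ℕ) + 1 : ℝ≥0∞) with hb
    have hb0 : b ≠ 0 := by simp [hb]
    have hbt : b ≠ ⊤ := by simp [hb]
    have := key (a / (2 * b)) (by simp [hne, hbt, ENNReal.mul_eq_top])
    have h2 : b * (a / (2 * b)) = a / 2 := by
      rw [← mul_div_assoc, mul_comm b a, ENNReal.mul_div_mul_right _ _ hb0 hbt]
    rw [h2] at this
    exact absurd this (not_le.2 (ENNReal.half_lt_self hne hfin))
  have : (ε : ℝ≥0∞) ≠ 0 := by exact_mod_cast hε.ne'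
  exact (mul_eq_zero.1 h0).resolve_left this

theorem lebesgue_diff (hY : IsSigmaFiniteDimNagata Y) (μ : Measure Y) [IsProbabilityMeasure μ]
    (h : Y → ℝ) (hm : Measurable h) (hb : ∀ x, |h x| ≤ 1) :
    ∀ᵐ x ∂μ, ∀ ε : NNReal, 0 < ε → ∃ ρ > 0, ∀ r, 0 ≤ r → r < ρ →
      ∫⁻ z in closedBall x r, ‖h z - h x‖ₑ ∂μ ≤ ε * μ (closedBall x r) := by
  obtain ⟨X, δ, s, hs, hN, hU⟩ := hY
  have h1 : ∀ᵐ x ∂μ, ∀ m j : ℕ, x ∉ {x | x ∈ X j ∧ ¬ ∃ ρ > 0, ∀ r, 0 ≤ r → r < ρ →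
      ∫⁻ z in closedBall x r, ‖h z - h x‖ₑ ∂μ ≤ 3 * (1 / ((m : NNReal) + 1) : NNReal) * μ (closedBall x r)} := by
    rw [ae_all_iff]; intro m; rw [ae_all_iff]; intro j
    exact measure_eq_zero_iff_ae_notMem.1 (diff_piece μ h hm hb (X j) (δ j) (s j) (hs j) (hN j) _ (by positivity))
  filter_upwards [h1] with x hx ε hε
  obtain ⟨m, hmε⟩ := exists_nat_one_div_lt (show (0 : NNReal) < ε / 3 by positivity)
  have hxU : x ∈ ⋃ n, X n := by rw [hU]; trivial
  obtain ⟨j, hj⟩ := mem_iUnion.1 hxU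
  have := hx m j
  simp only [Set.mem_ofPred_eq, not_and, not_not] at this
  obtain ⟨ρ, hρ, h2⟩ := this hj
  refine ⟨ρ, hρ, fun r h0 hr => (h2 r h0 hr).trans ?_⟩
  gcongr
  have : 3 * (1 / ((m : NNReal) + 1)) ≤ ε := by
    calc 3 * (1 / ((m : NNReal) + 1)) ≤ 3 * (ε / 3) := by gcongr
      _ = ε := by field_simp
  exact_mod_cast this

theorem ae_support (μ : Measure Y) : ∀ᵐ x ∂μ, ∀ r > 0, μ (ball x r) ≠ 0 := by
  filter_upwards [Measure.support_mem_ae (μ := μ)] with x hx r hr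
  rw [Measure.mem_support_iff_forall] at hx
  exact (hx _ (ball_mem_nhds x hr)).ne'
end

end KNNAux

namespace KNNAux

open Classical in
def nr {n : ℕ} (π : Equiv.Perm (Fin n)) (d : Fin n → ℝ) (j i : Fin n) : ℕ :=
  if d j < d i ∨ (d j = d i ∧ π j < π i) then 1 else 0

def rk {n : ℕ} (π : Equiv.Perm (Fin n)) (d : Fin n → ℝ) (i : Fin n) : ℕ := ∑ j, nr π d j i

theorem measurable_nr {n : ℕ} (π : Equiv.Perm (Fin n)) (j i : Fin n) :
    Measurable fun d : Fin n → ℝ => nr π d j i := by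
  unfold nr
  refine Measurable.ite ?_ measurable_const measurable_const
  refine (measurableSet_lt (measurable_pi_apply j) (measurable_pi_apply i)).union ?_
  exact (measurableSet_eq_fun (measurable_pi_apply j) (measurable_pi_apply i)).inter (MeasurableSet.const _)

theorem measurable_rk {n : ℕ} (π : Equiv.Perm (Fin n)) (i : Fin n) :
    Measurable fun d : Fin n → ℝ => rk π d i :=
  Finset.measurable_sum _ fun j _ => measurable_nr π j i

open Classical in
theorem rk_eq_card {n : ℕ} (π : Equiv.Perm (Fin n)) (d : Fin n → ℝ) (i : Fin n) :
    rk π d i = (Finset.univ.filter fun j => toLex (d j, π j) < toLex (d i, π i)).card := by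
  simp only [rk, nr, Finset.card_filter, Prod.Lex.toLex_lt_toLex]

open Classical in
theorem card_rk_lt {n : ℕ} (π : Equiv.Perm (Fin n)) (d : Fin n → ℝ) {k : ℕ} (hk : k ≤ n) :
    (Finset.univ.filter fun i => rk π d i < k).card = k := by
  have hlt : ∀ i, rk π d i < n := by
    intro i
    rw [rk_eq_card]
    refine (Finset.card_lt_card (t := Finset.univ) ?_).trans_le (by simp)
    rw [Finset.ssubset_univ_iff]
    intro h
    have := Finset.mem_univ i
    rw [← h] at this
    simp at this
  have hmono : ∀ i j, toLex (d i, π i) < toLex (d j, π j) → rk π d i < rk π d j := by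
    intro i j hij
    rw [rk_eq_card, rk_eq_card]
    refine Finset.card_lt_card ?_
    rw [Finset.ssubset_iff_of_subset]
    · exact ⟨i, by simpa using hij, by simp⟩
    · intro l hl
      simp only [Finset.mem_filter, Finset.mem_univ, true_and] at hl ⊢
      exact hl.trans hij
  have hinj : Function.Injective (fun i => (⟨rk π d i, hlt i⟩ : Fin n)) := by
    intro i j hij
    have hij : rk π d i = rk π d j := congrArg Fin.val hij
    rcases lt_trichotomy (toLex (d i, π i)) (toLex (d j, π j)) with h | h | h
    · exact absurd hij (hmono i j h).ne
    · have := congrArg (fun p => (ofLex p).2) h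
      exact π.injective this
    · exact absurd hij (hmono j i h).ne'
  have hbij := Finite.injective_iff_bijective.1 hinj
  have e := Equiv.ofBijective _ hbij
  have : (Finset.univ.filter fun i => rk π d i < k).card =
      (Finset.univ.filter fun i : Fin n => i.val < k).card := by
    refine Finset.card_bijective _ hbij ?_
    intro i
    simp
  rw [this]
  rw [Fin.card_filter_val_lt]
  exact min_eq_right hk

theorem sum_lt_eq_card {n : ℕ} (p : Fin n → Prop) [DecidablePred p] (c : ℝ) :
    ∑ i, (if p i then c else 0) = (Finset.univ.filter p).card * c := by
  rw [← Finset.sum_filter]; simp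

open Classical in
theorem kNNLabel_eq {Ω : Type u} [MetricSpace Ω] (n k : ℕ) (σ : Fin n → Ω × Bool)
    (π : Equiv.Perm (Fin n)) (x : Ω) :
    kNNLabel n k σ π x = true ↔ (k : ℝ) ≤ 2 * ∑ i, (if rk π (fun j => dist x (σ j).1) i < k then 1 else 0)
      * (if (σ i).2 = true then (1 : ℝ) else 0) := by
  have h1 : ∀ i, Set.ncard {j | dist x (σ j).1 < dist x (σ i).1 ∨ (dist x (σ j).1 = dist x (σ i).1 ∧ π j < π i)}
      = rk π (fun j => dist x (σ j).1) i := by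
    intro i
    rw [rk_eq_card, ← Set.ncard_coe_finset]
    congr 1
    ext j
    simp [Prod.Lex.toLex_lt_toLex]
  have h2 : (∑ i, (if rk π (fun j => dist x (σ j).1) i < k then (1 : ℝ) else 0)
      * (if (σ i).2 = true then (1 : ℝ) else 0)) =
      ((Finset.univ.filter fun i => rk π (fun j => dist x (σ j).1) i < k ∧ (σ i).2 = true).card : ℝ) := by
    rw [Finset.card_filter]
    push_cast
    refine Finset.sum_congr rfl fun i _ => ?_
    by_cases h : rk π (fun j => dist x (σ j).1) i < k <;> by_cases h' : (σ i).2 = true <;> simp [h, h']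
  unfold kNNLabel
  simp only [decide_eq_true_eq, h1]
  rw [h2]
  norm_cast
  have : {i | i ∈ ({i | rk π (fun j => dist x (σ j).1) i < k} : Set (Fin n)) ∧ (σ i).2 = true} =
     ((Finset.univ.filter fun i => rk π (fun j => dist x (σ j).1) i < k ∧ (σ i).2 = true : Finset (Fin n)) : Set (Fin n)) := by
    ext i; simp
  rw [this, Set.ncard_coe_finset]

section resample
variable {α : Type*} [MeasurableSpace α] (ν : Measure α) [IsProbabilityMeasure ν] {n : ℕ}

theorem measurable_upd (j : Fin n) :
    Measurable (fun q : (Fin n → α) × α => Function.update q.1 j q.2) := by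
  rw [measurable_pi_iff]
  intro i
  by_cases h : i = j
  · subst h; simpa using measurable_snd
  · simp only [Function.update_of_ne h]
    exact (measurable_pi_apply i).comp measurable_fst

theorem resample (j : Fin n) : MeasurePreserving (fun q : (Fin n → α) × α => Function.update q.1 j q.2)
    ((Measure.pi fun _ : Fin n => ν).prod ν) (Measure.pi fun _ : Fin n => ν) := by
  refine ⟨measurable_upd j, ?_⟩
  symm
  apply Measure.pi_eq
  intro s hs
  rw [Measure.map_apply (measurable_upd j) (MeasurableSet.univ_pi hs)]
  have : (fun q : (Fin n → α) × α => Function.update q.1 j q.2) ⁻¹' (Set.univ.pi s) =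
      (Set.univ.pi (Function.update s j Set.univ)) ×ˢ s j := by
    ext ⟨σ, p⟩
    simp only [mem_preimage, Set.mem_pi, mem_univ, forall_const, mem_prod]
    constructor
    · intro h
      refine ⟨fun i => ?_, by simpa using h j⟩
      by_cases hi : i = j
      · subst hi; simp
      · have := h i
        rwa [Function.update_of_ne hi] at this ⊢
    · rintro ⟨h1, h2⟩ i
      by_cases hi : i = j
      · subst hi; simpa using h2
      · have := h1 i
        rwa [Function.update_of_ne hi] at this ⊢
  rw [this, Measure.prod_prod, Measure.pi_pi, ← Finset.prod_erase_mul _ _ (Finset.mem_univ j),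
    ← Finset.prod_erase_mul Finset.univ (fun i => ν (s i)) (Finset.mem_univ j)]
  simp only [Function.update_self, measure_univ, mul_one]
  congr 1
  refine Finset.prod_congr rfl fun i hi => ?_
  rw [Function.update_of_ne (Finset.ne_of_mem_erase hi)]

theorem resample_lintegral (j : Fin n) (F : (Fin n → α) → ℝ≥0∞) (hF : Measurable F) :
    ∫⁻ σ, F σ ∂(Measure.pi fun _ : Fin n => ν) =
      ∫⁻ σ, ∫⁻ p, F (Function.update σ j p) ∂ν ∂(Measure.pi fun _ : Fin n => ν) := by
  rw [← (resample ν j).lintegral_comp hF]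
  exact lintegral_prod _ (hF.comp (measurable_upd j)).aemeasurable

theorem resample_le (j : Fin n) (F G : (Fin n → α) → ℝ≥0∞) (hF : Measurable F) (hG : Measurable G)
    (h : ∀ σ, ∫⁻ p, F (Function.update σ j p) ∂ν ≤ ∫⁻ p, G (Function.update σ j p) ∂ν) :
    ∫⁻ σ, F σ ∂(Measure.pi fun _ : Fin n => ν) ≤ ∫⁻ σ, G σ ∂(Measure.pi fun _ : Fin n => ν) := by
  rw [resample_lintegral ν j F hF, resample_lintegral ν j G hG]
  exact lintegral_mono h

theorem resample_zero (j : Fin n) (F : (Fin n → α) → ℝ) (hF : Measurable F)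
    (hi : Integrable F (Measure.pi fun _ : Fin n => ν))
    (h : ∀ σ, ∫ p, F (Function.update σ j p) ∂ν = 0) :
    ∫ σ, F σ ∂(Measure.pi fun _ : Fin n => ν) = 0 := by
  have hmp := resample ν j
  rw [← hmp.map_eq, integral_map hmp.measurable.aemeasurable hF.aestronglyMeasurable, integral_prod]
  · simp [h]
  · exact hmp.integrable_comp_of_integrable hi
end resample

theorem tail_bound {α : Type*} [MeasurableSpace α] (ν : Measure α) [IsProbabilityMeasure ν] {n : ℕ}
    (B : Set α) (hB : MeasurableSet B) (k : ℕ) [DecidablePred (· ∈ B)] :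
    (Measure.pi fun _ : Fin n => ν) {σ | (∑ j, if σ j ∈ B then 1 else 0) < k} ≤
      2 ^ k * (1 - ν B / 2) ^ n := by
  set g : α → ℝ≥0∞ := fun a => if a ∈ B then 2⁻¹ else 1 with hg
  have hgm : Measurable g := Measurable.ite hB measurable_const measurable_const
  have h1 : ∫⁻ a, g a ∂ν = 1 - ν B / 2 := by
    have h2 : ∫⁻ a, (g a + B.indicator (fun _ => 2⁻¹) a) ∂ν = 1 := by
      have : ∀ a, g a + B.indicator (fun _ => 2⁻¹) a = 1 := by
        intro a
        by_cases h : a ∈ B <;> simp [hg, h, ENNReal.inv_two_add_inv_two]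
      simp [this]
    rw [lintegral_add_left hgm, lintegral_indicator hB] at h2
    have e : ∫⁻ a in B, 2⁻¹ ∂ν = ν B / 2 := by simp [div_eq_mul_inv, mul_comm]
    rw [e] at h2
    refine ENNReal.eq_sub_of_add_eq (ENNReal.div_ne_top (measure_ne_top _ _) (by norm_num)) h2
  have h3 : ∫⁻ σ, ∏ j, g (σ j) ∂(Measure.pi fun _ : Fin n => ν) = (1 - ν B / 2) ^ n := by
    have hind : ProbabilityTheory.iIndepFun (fun (j : Fin n) (σ : Fin n → α) => g (σ j)) (Measure.pi fun _ : Fin n => ν) :=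
      ProbabilityTheory.iIndepFun_pi (X := fun _ => g) (fun _ => hgm.aemeasurable)
    rw [ProbabilityTheory.lintegral_prod_eq_prod_lintegral_of_indepFun Finset.univ _ hind
      (fun j => hgm.comp (measurable_pi_apply j))]
    have : ∀ j : Fin n, ∫⁻ σ, g (σ j) ∂(Measure.pi fun _ : Fin n => ν) = 1 - ν B / 2 := by
      intro j
      rw [← h1]
      exact (measurePreserving_eval (fun _ : Fin n => ν) j).lintegral_comp hgm
    simp [this]
  have h4 := mul_meas_ge_le_lintegral (μ := Measure.pi fun _ : Fin n => ν)
    (f := fun σ => ∏ j, g (σ j)) (by fun_prop) ((2 ^ k)⁻¹)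
  rw [h3] at h4
  have h5 : {σ : Fin n → α | (∑ j, if σ j ∈ B then 1 else 0) < k} ⊆
      {σ | ((2 : ℝ≥0∞) ^ k)⁻¹ ≤ ∏ j, g (σ j)} := by
    intro σ hσ
    have hσ : (∑ j, if σ j ∈ B then 1 else 0) < k := hσ
    have e : ∏ j, g (σ j) = 2⁻¹ ^ (∑ j, if σ j ∈ B then 1 else 0) := by
      rw [← Finset.prod_pow_eq_pow_sum]
      refine Finset.prod_congr rfl fun j _ => ?_
      by_cases h : σ j ∈ B <;> simp [hg, h]
    rw [Set.mem_ofPred_eq, e, ← ENNReal.inv_pow]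
    exact ENNReal.inv_le_inv.2 (pow_le_pow_right₀ (by norm_num) hσ.le)
  calc _ ≤ (Measure.pi fun _ : Fin n => ν) {σ | ((2 : ℝ≥0∞) ^ k)⁻¹ ≤ ∏ j, g (σ j)} := measure_mono h5
    _ = 2 ^ k * ((2 ^ k)⁻¹ * (Measure.pi fun _ : Fin n => ν) {σ | ((2 : ℝ≥0∞) ^ k)⁻¹ ≤ ∏ j, g (σ j)}) := by
        rw [← mul_assoc, ENNReal.mul_inv_cancel (by simp) (by simp), one_mul]
    _ ≤ _ := by gcongr

theorem tail_tendsto (k : ℕ → ℕ) (hk : Tendsto (fun n : ℕ => (k n : ℝ) / n) atTop (nhds 0))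
    (p : ℝ≥0∞) (hp : p ≠ 0) (hp1 : p ≤ 1) :
    Tendsto (fun n => (2 : ℝ≥0∞) ^ (k n) * (1 - p / 2) ^ n) atTop (nhds 0) := by
  lift p to NNReal using ne_top_of_le_ne_top ENNReal.one_ne_top hp1
  have hp1' : (p : ℝ) ≤ 1 := by exact_mod_cast hp1
  have hp0 : (0 : ℝ) < p := by
    have : p ≠ 0 := by exact_mod_cast hp
    positivity
  set q : ℝ := 1 - p / 2 with hq
  have hq0 : 0 < q := by rw [hq]; linarith
  have hq1 : q < 1 := by rw [hq]; linarith
  have e : (1 - (p : ℝ≥0∞) / 2) = ENNReal.ofReal q := by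
    rw [hq, ENNReal.ofReal_sub _ (by positivity), ENNReal.ofReal_one, ENNReal.ofReal_div_of_pos (by norm_num)]
    simp
  have e2 : ∀ n, (2 : ℝ≥0∞) ^ (k n) * (1 - (p : ℝ≥0∞) / 2) ^ n = ENNReal.ofReal (2 ^ (k n) * q ^ n) := by
    intro n
    rw [e, ENNReal.ofReal_mul (by positivity), ENNReal.ofReal_pow (by positivity), ENNReal.ofReal_pow hq0.le]
    simp
  simp_rw [e2]
  rw [← ENNReal.ofReal_zero]
  refine ENNReal.tendsto_ofReal ?_
  have hlog : Real.log q < 0 := Real.log_neg hq0 hq1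
  have hlog2 : 0 < Real.log 2 := Real.log_pos (by norm_num)
  set c : ℝ := Real.log q / 2 with hc
  have hc0 : c < 0 := by rw [hc]; linarith
  have hev : ∀ᶠ n in atTop, 2 ^ (k n) * q ^ n ≤ (Real.exp c) ^ n := by
    have h1 := hk.eventually (gt_mem_nhds (show 0 < -c / Real.log 2 by apply div_pos <;> linarith))
    filter_upwards [h1, eventually_gt_atTop 0] with n hn hn0
    have hn0' : (0 : ℝ) < n := by exact_mod_cast hn0
    rw [div_lt_iff₀ hn0', div_mul_eq_mul_div, lt_div_iff₀ hlog2] at hn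
    have e3 : (2 : ℝ) ^ (k n) * q ^ n = Real.exp (k n * Real.log 2 + n * Real.log q) := by
      rw [Real.exp_add, Real.exp_nat_mul, Real.exp_nat_mul, Real.exp_log (by norm_num), Real.exp_log hq0]
    rw [e3, ← Real.exp_nat_mul]
    refine Real.exp_le_exp.2 ?_
    have : Real.log q = 2 * c := by rw [hc]; ring
    rw [this]
    nlinarith
  refine squeeze_zero' (Eventually.of_forall fun n => by positivity) hev ?_
  exact tendsto_pow_atTop_nhds_zero_of_lt_one (Real.exp_pos _).le (Real.exp_lt_one_iff.2 hc0)

end KNNAux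

namespace KNNAux

theorem rk_upd_mono {n : ℕ} (π : Equiv.Perm (Fin n)) (d : Fin n → ℝ) (i : Fin n) {t' t : ℝ} (h : t' ≤ t) :
    rk π (Function.update d i t') i ≤ rk π (Function.update d i t) i := by
  unfold rk
  refine Finset.sum_le_sum fun j _ => ?_
  unfold nr
  by_cases hj : j = i
  · subst hj; simp
  · simp only [Function.update_self, Function.update_of_ne hj]
    split_ifs with h1 h2 <;> try omega
    exfalso
    apply h2
    rcases h1 with h1 | ⟨h1, h1'⟩
    · exact Or.inl (h1.trans_le h)
    · rcases h.lt_or_eq with h3 | h3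
      · exact Or.inl (h1 ▸ h3)
      · exact Or.inr ⟨h1.trans h3, h1'⟩

theorem far_lt {n : ℕ} (π : Equiv.Perm (Fin n)) (d : Fin n → ℝ) (i : Fin n) {k : ℕ} {ρ : ℝ}
    (h : rk π d i < k) (hρ : ρ ≤ d i) : (∑ j, if d j < ρ then 1 else 0) < k := by
  refine lt_of_le_of_lt ?_ h
  unfold rk
  refine Finset.sum_le_sum fun j _ => ?_
  unfold nr
  split_ifs with h1 h2 <;> try omega
  exact absurd (Or.inl (h1.trans_le hρ)) h2

section
variable {Y : Type u} [MetricSpace Y] [MeasurableSpace Y] [BorelSpace Y]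

theorem radial (μ : Measure Y) (x : Y) (f : Y → ℝ≥0∞) (ε : ℝ≥0∞) (ρ : ℝ)
    (hball : ∀ r, 0 ≤ r → r < ρ → ∫⁻ z in closedBall x r, f z ∂μ ≤ ε * μ (closedBall x r))
    (D : Set Y) (hD : ∀ z ∈ D, ∀ z', dist x z' ≤ dist x z → z' ∈ D) (hDρ : ∀ z ∈ D, dist x z < ρ) :
    ∫⁻ z in D, f z ∂μ ≤ ε * μ D := by
  rcases D.eq_empty_or_nonempty with rfl | hne
  · simp
  set S := (fun z => dist x z) '' D with hS
  have hSne : S.Nonempty := hne.image _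
  have hbdd : BddAbove S := ⟨ρ, by rintro _ ⟨z, hz, rfl⟩; exact (hDρ z hz).le⟩
  have hlub := isLUB_csSup hSne hbdd
  have hcb : ∀ t ∈ S, closedBall x t ⊆ D := by
    rintro _ ⟨z, hz, rfl⟩ z' hz'
    refine hD z hz z' ?_
    rw [dist_comm x z']; exact hz'
  have hbS : ∀ t ∈ S, ∫⁻ z in closedBall x t, f z ∂μ ≤ ε * μ (closedBall x t) := by
    rintro _ ⟨z, hz, rfl⟩
    exact hball _ dist_nonneg (hDρ z hz)
  by_cases hs : sSup S ∈ S
  · have : D = closedBall x (sSup S) := by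
      refine Subset.antisymm (fun z hz => ?_) (hcb _ hs)
      rw [mem_closedBall, dist_comm]
      exact hlub.1 ⟨z, hz, rfl⟩
    rw [this]; exact hbS _ hs
  · obtain ⟨v, hv, hvle, hvt, hvS⟩ := hlub.exists_seq_monotone_tendsto hSne
    have hU : D = ⋃ n, closedBall x (v n) := by
      refine Subset.antisymm (fun z hz => ?_) (iUnion_subset fun n => hcb _ (hvS n))
      have hlt : dist x z < sSup S := lt_of_le_of_ne (hlub.1 ⟨z, hz, rfl⟩) (by
        intro h; exact hs (h ▸ ⟨z, hz, rfl⟩))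
      obtain ⟨n, hn⟩ := (hvt.eventually (lt_mem_nhds hlt)).exists
      refine mem_iUnion.2 ⟨n, ?_⟩
      rw [mem_closedBall, dist_comm]; exact hn.le
    have hmono : Monotone fun n => closedBall x (v n) := fun a b hab => closedBall_subset_closedBall (hv hab)
    have e : ∀ D : Set Y, MeasurableSet D → ∫⁻ z in D, f z ∂μ = μ.withDensity f D := fun D hD => (withDensity_apply _ hD).symm
    have hDm : MeasurableSet D := by rw [hU]; exact MeasurableSet.iUnion fun n => measurableSet_closedBall
    rw [e D hDm, hU, hmono.measure_iUnion]
    refine iSup_le fun n => ?_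
    rw [← e _ measurableSet_closedBall]
    refine (hbS _ (hvS n)).trans ?_
    gcongr
    exact subset_iUnion (fun n => closedBall x (v n)) n

def dv {n : ℕ} (x : Y) (σ : Fin n → Y × Bool) : Fin n → ℝ := fun j => dist x (σ j).1

theorem dv_update {n : ℕ} (x : Y) (σ : Fin n → Y × Bool) (i : Fin n) (p : Y × Bool) :
    dv x (Function.update σ i p) = Function.update (dv x σ) i (dist x p.1) := by
  funext j
  by_cases h : j = i
  · subst h; simp [dv]
  · simp [dv, Function.update_of_ne h]

def wt {n : ℕ} (π : Equiv.Perm (Fin n)) (k : ℕ) (d : Fin n → ℝ) (i : Fin n) : ℝ := if rk π d i < k then 1 else 0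

theorem measurable_wt {n : ℕ} (π : Equiv.Perm (Fin n)) (k : ℕ) (i : Fin n) :
    Measurable fun d : Fin n → ℝ => wt π k d i := by
  unfold wt
  exact Measurable.ite (measurableSet_lt (measurable_rk π i) measurable_const) measurable_const measurable_const

theorem wt_nonneg {n : ℕ} (π : Equiv.Perm (Fin n)) (k : ℕ) (d : Fin n → ℝ) (i : Fin n) : 0 ≤ wt π k d i := by
  unfold wt; split_ifs <;> norm_num

theorem wt_le {n : ℕ} (π : Equiv.Perm (Fin n)) (k : ℕ) (d : Fin n → ℝ) (i : Fin n) : wt π k d i ≤ 1 := by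
  unfold wt; split_ifs <;> norm_num

theorem wt_sq {n : ℕ} (π : Equiv.Perm (Fin n)) (k : ℕ) (d : Fin n → ℝ) (i : Fin n) : wt π k d i * wt π k d i = wt π k d i := by
  unfold wt; split_ifs <;> norm_num

theorem sum_wt {n : ℕ} (π : Equiv.Perm (Fin n)) {k : ℕ} (hk : k ≤ n) (d : Fin n → ℝ) : ∑ i, wt π k d i = k := by
  unfold wt
  rw [sum_lt_eq_card, mul_one]
  exact_mod_cast card_rk_lt π d hk

variable [SecondCountableTopology Y]

theorem measurable_dv {n : ℕ} (x : Y) : Measurable fun σ : Fin n → Y × Bool => dv x σ := by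
  rw [measurable_pi_iff]
  intro j
  unfold dv
  fun_prop

theorem measurable_dv2 {n : ℕ} : Measurable fun q : (Fin n → Y × Bool) × Y => dv q.2 q.1 := by
  rw [measurable_pi_iff]
  intro j
  unfold dv
  fun_prop

theorem bias_bound (ν : Measure (Y × Bool)) [IsProbabilityMeasure ν] (x : Y) (f : Y → ℝ≥0∞) (hf : Measurable f)
    (hf1 : ∀ z, f z ≤ 1) (ε : ℝ≥0∞) (ρ : ℝ)
    (hball : ∀ r, 0 ≤ r → r < ρ → ∫⁻ z in closedBall x r, f z ∂ν.fst ≤ ε * ν.fst (closedBall x r))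
    {n k : ℕ} (hk : k ≤ n) (π : Equiv.Perm (Fin n)) :
    ∫⁻ σ, ∑ i, ENNReal.ofReal (wt π k (dv x σ) i) * f (σ i).1 ∂(Measure.pi fun _ : Fin n => ν) ≤
      k * ε + k * (2 ^ k * (1 - ν.fst (ball x ρ) / 2) ^ n) := by
  classical
  have hwm : ∀ i, Measurable fun σ : Fin n → Y × Bool => ENNReal.ofReal (wt π k (dv x σ) i) := fun i =>
    ENNReal.measurable_ofReal.comp ((measurable_wt π k i).comp (measurable_dv x))
  have hfm : ∀ i : Fin n, Measurable fun σ : Fin n → Y × Bool => f (σ i).1 := fun i =>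
    hf.comp (measurable_fst.comp (measurable_pi_apply i))
  have him : ∀ i : Fin n, Measurable fun σ : Fin n → Y × Bool => (if ρ ≤ dist x (σ i).1 then (1 : ℝ≥0∞) else 0) := by
    intro i
    refine Measurable.ite (measurableSet_le measurable_const ?_) measurable_const measurable_const
    fun_prop
  set T : Set (Fin n → Y × Bool) := {σ | (∑ j, if σ j ∈ (Prod.fst ⁻¹' ball x ρ : Set (Y × Bool)) then 1 else 0) < k} with hT
  have htail : (Measure.pi fun _ : Fin n => ν) T ≤ 2 ^ k * (1 - ν.fst (ball x ρ) / 2) ^ n := by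
    rw [Measure.fst_apply measurableSet_ball]
    exact tail_bound ν _ (measurable_fst measurableSet_ball) k
  have hTm : MeasurableSet T := by
    rw [hT]
    refine measurableSet_lt (Finset.measurable_sum _ fun j _ => ?_) measurable_const
    refine Measurable.ite ?_ measurable_const measurable_const
    exact (measurable_fst.comp (measurable_pi_apply j)) measurableSet_ball
  rw [lintegral_finsetSum _ fun i _ => (hwm i).fun_mul (hfm i)]
  have step : ∀ i : Fin n, ∫⁻ σ, ENNReal.ofReal (wt π k (dv x σ) i) * f (σ i).1 ∂(Measure.pi fun _ : Fin n => ν) ≤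
      ∫⁻ σ, (ε * ENNReal.ofReal (wt π k (dv x σ) i) + ENNReal.ofReal (wt π k (dv x σ) i) * (if ρ ≤ dist x (σ i).1 then 1 else 0)) ∂(Measure.pi fun _ : Fin n => ν) := by
    intro i
    refine resample_le ν i _ _ ((hwm i).fun_mul (hfm i)) (((hwm i).const_mul ε).fun_add ((hwm i).fun_mul (him i))) ?_
    intro σ
    simp only [dv_update, Function.update_self]
    set W : Y → ℝ≥0∞ := fun z => ENNReal.ofReal (wt π k (Function.update (dv x σ) i (dist x z)) i) with hW
    set D0 : Set Y := {z | rk π (Function.update (dv x σ) i (dist x z)) i < k} with hD0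
    have hWi : ∀ z, W z = D0.indicator 1 z := by
      intro z
      simp only [hW, wt, hD0, indicator, Set.mem_ofPred_eq]
      split_ifs <;> simp
    have hum : Measurable fun z : Y => Function.update (dv x σ) i (dist x z) := by
      rw [measurable_pi_iff]
      intro j
      by_cases h : j = i
      · subst h; simp only [Function.update_self]; fun_prop
      · simp only [Function.update_of_ne h]; exact measurable_const
    have hWm : Measurable W := ENNReal.measurable_ofReal.comp ((measurable_wt π k i).comp hum)
    have hD0m : MeasurableSet D0 := measurableSet_lt ((measurable_rk π i).comp hum) measurable_const
    have him' : Measurable fun z : Y => (if ρ ≤ dist x z then (1 : ℝ≥0∞) else 0) := by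
      refine Measurable.ite (measurableSet_le measurable_const ?_) measurable_const measurable_const
      fun_prop
    have m1 : ∫⁻ p, W p.1 * f p.1 ∂ν = ∫⁻ z, W z * f z ∂ν.fst := by
      rw [Measure.fst, lintegral_map (hWm.fun_mul hf) measurable_fst]
    have m2 : ∫⁻ p, (ε * W p.1 + W p.1 * (if ρ ≤ dist x p.1 then 1 else 0)) ∂ν
        = ∫⁻ z, (ε * W z + W z * (if ρ ≤ dist x z then 1 else 0)) ∂ν.fst := by
      rw [Measure.fst, lintegral_map ((hWm.const_mul ε).fun_add (hWm.fun_mul him')) measurable_fst]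
    change ∫⁻ p, W p.1 * f p.1 ∂ν ≤ ∫⁻ p, (ε * W p.1 + W p.1 * (if ρ ≤ dist x p.1 then 1 else 0)) ∂ν
    rw [m1, m2, lintegral_add_right _ (hWm.fun_mul him')]
    have hDm : MeasurableSet (D0 ∩ ball x ρ) := hD0m.inter measurableSet_ball
    have hrad : ∫⁻ z in D0 ∩ ball x ρ, f z ∂ν.fst ≤ ε * ν.fst (D0 ∩ ball x ρ) := by
      refine radial ν.fst x f ε ρ hball _ ?_ ?_
      · rintro z ⟨hz, hz'⟩ z' hzz
        refine ⟨(rk_upd_mono π _ i hzz).trans_lt hz, ?_⟩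
        rw [mem_ball, dist_comm] at hz' ⊢
        exact hzz.trans_lt hz'
      · rintro z ⟨hz, hz'⟩
        rw [mem_ball, dist_comm] at hz'
        exact hz'
    calc ∫⁻ z, W z * f z ∂ν.fst ≤ ∫⁻ z, ((D0 ∩ ball x ρ).indicator f z + W z * (if ρ ≤ dist x z then 1 else 0)) ∂ν.fst := by
          refine lintegral_mono fun z => ?_
          dsimp only
          rw [hWi]
          by_cases h1 : z ∈ D0
          · by_cases h2 : ρ ≤ dist x z
            · have h3 : z ∉ ball x ρ := by rw [mem_ball, dist_comm]; exact not_lt.2 h2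
              simp [h1, h2, h3, hf1 z]
            · have h3 : z ∈ ball x ρ := by rw [mem_ball, dist_comm]; exact not_le.1 h2
              simp [h1, h2, h3]
          · simp [h1]
      _ = ∫⁻ z in D0 ∩ ball x ρ, f z ∂ν.fst + ∫⁻ z, W z * (if ρ ≤ dist x z then 1 else 0) ∂ν.fst := by
          rw [lintegral_add_right _ (hWm.fun_mul him'), lintegral_indicator hDm]
      _ ≤ _ := by
          refine add_le_add_left (hrad.trans ?_) _
          rw [lintegral_const_mul _ hWm]
          gcongr
          have : ∫⁻ z, W z ∂ν.fst = ν.fst D0 := by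
            simp only [hWi]
            rw [lintegral_indicator_one hD0m]
          rw [this]
          exact measure_mono inter_subset_left
  refine (Finset.sum_le_sum fun i _ => step i).trans ?_
  rw [← lintegral_finsetSum _ fun i _ => ((hwm i).const_mul ε).fun_add ((hwm i).fun_mul (him i))]
  have hsum : ∀ σ : Fin n → Y × Bool, ∑ i, ENNReal.ofReal (wt π k (dv x σ) i) = k := by
    intro σ
    rw [← ENNReal.ofReal_sum_of_nonneg fun i _ => wt_nonneg π k _ i, sum_wt π hk]
    simp
  calc _ ≤ ∫⁻ σ, (k * ε + k * T.indicator 1 σ) ∂(Measure.pi fun _ : Fin n => ν) := by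
        refine lintegral_mono fun σ => ?_
        dsimp only
        rw [Finset.sum_add_distrib, ← Finset.mul_sum, hsum, mul_comm ε]
        gcongr
        rw [← hsum σ, Finset.sum_mul]
        refine Finset.sum_le_sum fun i _ => ?_
        unfold wt
        split_ifs with h1 h2
        · have : σ ∈ T := by
            have := far_lt π (dv x σ) i h1 h2
            simpa only [hT, Set.mem_ofPred_eq, mem_preimage, mem_ball, dv, dist_comm x] using this
          simp [this]
        · simp
        · simp
        · simp
    _ = k * ε + k * (Measure.pi fun _ : Fin n => ν) T := by
        rw [lintegral_add_left measurable_const, lintegral_const_mul _ (measurable_one.indicator hTm), lintegral_indicator_one hTm]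
        simp
    _ ≤ _ := by gcongr

end
end KNNAux

namespace KNNAux
section
variable {Y : Type u} [MetricSpace Y] [MeasurableSpace Y] [BorelSpace Y] [SecondCountableTopology Y]

def lab (b : Bool) : ℝ := if b = true then 1 else 0

theorem measurable_lab : Measurable lab := measurable_of_finite _

theorem lab_nonneg (b : Bool) : 0 ≤ lab b := by cases b <;> simp [lab]
theorem lab_le (b : Bool) : lab b ≤ 1 := by cases b <;> simp [lab]

theorem integrable_bdd {α : Type*} [MeasurableSpace α] (P : Measure α) [IsFiniteMeasure P] {F : α → ℝ}
    (hF : Measurable F) (C : ℝ) (hb : ∀ a, |F a| ≤ C) : Integrable F P :=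
  Integrable.of_bound hF.aestronglyMeasurable C (Eventually.of_forall hb)

theorem var_bound (ν : Measure (Y × Bool)) [IsProbabilityMeasure ν] (x : Y) (η : Y → ℝ) (hη : Measurable η)
    (h0 : ∀ z, 0 ≤ η z) (h1 : ∀ z, η z ≤ 1)
    (hort : ∀ g : Y → ℝ, Measurable g → (∀ z, |g z| ≤ 1) → ∫ p, g p.1 * (lab p.2 - η p.1) ∂ν = 0)
    {n k : ℕ} (hk : k ≤ n) (π : Equiv.Perm (Fin n)) :
    ∫ σ, (∑ i, wt π k (dv x σ) i * (lab (σ i).2 - η (σ i).1)) ^ 2 ∂(Measure.pi fun _ : Fin n => ν) ≤ k := by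
  set P := Measure.pi fun _ : Fin n => ν with hP
  set e : Y × Bool → ℝ := fun p => lab p.2 - η p.1 with he
  have hem : Measurable e := (measurable_lab.comp measurable_snd).sub (hη.comp measurable_fst)
  have heb : ∀ p, |e p| ≤ 1 := by
    intro p
    rw [abs_le]
    have a1 := lab_nonneg p.2
    have a2 := lab_le p.2
    have a3 := h0 p.1
    have a4 := h1 p.1
    constructor <;> simp only [he] <;> linarith
  have hwm : ∀ i, Measurable fun σ : Fin n → Y × Bool => wt π k (dv x σ) i := fun i =>
    (measurable_wt π k i).comp (measurable_dv x)
  have hwb : ∀ (d : Fin n → ℝ) i, |wt π k d i| ≤ 1 := fun d i => by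
    rw [abs_of_nonneg (wt_nonneg _ _ _ _)]; exact wt_le _ _ _ _
  have hei : ∀ i : Fin n, Measurable fun σ : Fin n → Y × Bool => e (σ i) := fun i => hem.comp (measurable_pi_apply i)
  have htm : ∀ i j : Fin n, Measurable fun σ : Fin n → Y × Bool =>
      (wt π k (dv x σ) i * wt π k (dv x σ) j * e (σ i)) * e (σ j) := fun i j =>
    (((hwm i).fun_mul (hwm j)).fun_mul (hei i)).fun_mul (hei j)
  have hg : ∀ (a b c : ℝ), |a| ≤ 1 → |b| ≤ 1 → |c| ≤ 1 → |a * b * c| ≤ 1 := by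
    intro a b c ha hb hc
    rw [abs_mul, abs_mul]
    exact mul_le_one₀ (mul_le_one₀ ha (abs_nonneg _) hb) (abs_nonneg _) hc
  have hti : ∀ i j : Fin n, Integrable (fun σ : Fin n → Y × Bool =>
      (wt π k (dv x σ) i * wt π k (dv x σ) j * e (σ i)) * e (σ j)) P := by
    intro i j
    refine integrable_bdd P (htm i j) 1 fun σ => ?_
    rw [abs_mul]
    exact mul_le_one₀ (hg _ _ _ (hwb _ _) (hwb _ _) (heb _)) (abs_nonneg _) (heb _)
  have hwi : ∀ i : Fin n, Integrable (fun σ : Fin n → Y × Bool => wt π k (dv x σ) i) P := fun i =>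
    integrable_bdd P (hwm i) 1 fun σ => hwb _ _
  have hexp : ∀ σ : Fin n → Y × Bool, (∑ i, wt π k (dv x σ) i * (lab (σ i).2 - η (σ i).1)) ^ 2 =
      ∑ i, ∑ j, (wt π k (dv x σ) i * wt π k (dv x σ) j * e (σ i)) * e (σ j) := by
    intro σ
    rw [sq, Finset.sum_mul_sum]
    refine Finset.sum_congr rfl fun i _ => Finset.sum_congr rfl fun j _ => ?_
    simp only [he]; ring
  simp_rw [hexp]
  rw [integral_finset_sum _ fun i _ => integrable_finset_sum _ fun j _ => hti i j]
  have hterm : ∀ i, ∫ σ, ∑ j, (wt π k (dv x σ) i * wt π k (dv x σ) j * e (σ i)) * e (σ j) ∂P ≤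
      ∫ σ, wt π k (dv x σ) i ∂P := by
    intro i
    rw [integral_finset_sum _ fun j _ => hti i j, ← Finset.sum_erase_add _ _ (Finset.mem_univ i)]
    rw [Finset.sum_eq_zero, zero_add]
    · refine integral_mono (hti i i) (hwi i) fun σ => ?_
      dsimp only
      rw [wt_sq, mul_assoc]
      refine mul_le_of_le_one_right (wt_nonneg _ _ _ _) ?_
      have := heb (σ i)
      rw [abs_le] at this
      nlinarith
    · intro j hj
      have hji : i ≠ j := (Finset.ne_of_mem_erase hj).symm
      refine resample_zero ν j _ (htm i j) (hti i j) fun σ => ?_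
      simp only [dv_update, Function.update_self, Function.update_of_ne hji]
      have hum : Measurable fun z : Y => Function.update (dv x σ) j (dist x z) := by
        rw [measurable_pi_iff]
        intro l
        by_cases h : l = j
        · subst h; simp only [Function.update_self]; fun_prop
        · simp only [Function.update_of_ne h]; exact measurable_const
      refine hort (fun z => wt π k (Function.update (dv x σ) j (dist x z)) i * wt π k (Function.update (dv x σ) j (dist x z)) j * e (σ i)) ?_ ?_
      · exact (((measurable_wt π k i).comp hum).fun_mul ((measurable_wt π k j).comp hum)).fun_mul measurable_const
      · intro z; exact hg _ _ _ (hwb _ _) (hwb _ _) (heb _)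
  refine (Finset.sum_le_sum fun i _ => hterm i).trans ?_
  rw [← integral_finset_sum _ fun i _ => hwi i]
  simp [sum_wt π hk]

theorem abs_bound (ν : Measure (Y × Bool)) [IsProbabilityMeasure ν] (x : Y) (η : Y → ℝ) (hη : Measurable η)
    (h0 : ∀ z, 0 ≤ η z) (h1 : ∀ z, η z ≤ 1)
    (hort : ∀ g : Y → ℝ, Measurable g → (∀ z, |g z| ≤ 1) → ∫ p, g p.1 * (lab p.2 - η p.1) ∂ν = 0)
    {n k : ℕ} (hk0 : 0 < k) (hk : k ≤ n) (π : Equiv.Perm (Fin n)) :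
    ∫⁻ σ, ‖∑ i, wt π k (dv x σ) i * (lab (σ i).2 - η (σ i).1)‖ₑ ∂(Measure.pi fun _ : Fin n => ν) ≤ ENNReal.ofReal (√k) := by
  set P := Measure.pi fun _ : Fin n => ν with hP
  set A : (Fin n → Y × Bool) → ℝ := fun σ => ∑ i, wt π k (dv x σ) i * (lab (σ i).2 - η (σ i).1) with hA
  have hv := var_bound ν x η hη h0 h1 hort hk π
  have hAm : Measurable A := by
    refine Finset.measurable_sum _ fun i _ => ?_
    refine ((measurable_wt π k i).comp (measurable_dv x)).fun_mul ?_
    refine Measurable.fun_sub ?_ ?_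
    · exact measurable_lab.comp (measurable_snd.comp (measurable_pi_apply i))
    · exact hη.comp (measurable_fst.comp (measurable_pi_apply i))
  have hAb : ∀ σ, |A σ| ≤ k := by
    intro σ
    rw [← sum_wt π hk (dv x σ)]
    refine (Finset.abs_sum_le_sum_abs _ _).trans (Finset.sum_le_sum fun i _ => ?_)
    rw [abs_mul, abs_of_nonneg (wt_nonneg _ _ _ _)]
    refine mul_le_of_le_one_right (wt_nonneg _ _ _ _) ?_
    rw [abs_le]
    have a1 := lab_nonneg (σ i).2
    have a2 := lab_le (σ i).2
    have a3 := h0 (σ i).1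
    have a4 := h1 (σ i).1
    constructor <;> linarith
  have hAi : Integrable A P := integrable_bdd P hAm k hAb
  have hA2 : Integrable (fun σ => A σ ^ 2) P := by
    refine integrable_bdd P (hAm.pow_const 2) (k ^ 2) fun σ => ?_
    rw [abs_pow]
    exact pow_le_pow_left₀ (abs_nonneg _) (hAb σ) 2
  have hkk : (0 : ℝ) < √k := Real.sqrt_pos.2 (by exact_mod_cast hk0)
  have hsq : √(k : ℝ) * √k = k := Real.mul_self_sqrt (by positivity)
  have h2 : ∫ σ, 2 * √k * |A σ| ∂P ≤ ∫ σ, (A σ ^ 2 + k) ∂P := by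
    refine integral_mono (hAi.abs.const_mul _) (hA2.add (integrable_const _)) fun σ => ?_
    dsimp only
    have := sq_nonneg (|A σ| - √k)
    rw [← sq_abs (A σ)]
    nlinarith
  rw [integral_const_mul, integral_add hA2 (integrable_const _)] at h2
  simp only [integral_const, probReal_univ, smul_eq_mul, one_mul] at h2
  have h3 : ∫ σ, |A σ| ∂P ≤ √k := by
    by_contra hcon
    push Not at hcon
    have : √(k:ℝ) * √k < √k * ∫ σ, |A σ| ∂P := by gcongr
    have hv' : ∫ σ, A σ ^ 2 ∂P ≤ k := hv
    nlinarith
  have h4 : ∫⁻ σ, ‖A σ‖ₑ ∂P = ENNReal.ofReal (∫ σ, |A σ| ∂P) := by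
    rw [ofReal_integral_eq_lintegral_ofReal hAi.abs (Eventually.of_forall fun σ => abs_nonneg _)]
    refine lintegral_congr fun σ => ?_
    rw [Real.enorm_eq_ofReal_abs]
  rw [h4]
  exact ENNReal.ofReal_le_ofReal h3

/-- expected deviation -/
def vote {n : ℕ} (π : Equiv.Perm (Fin n)) (k : ℕ) (x : Y) (σ : Fin n → Y × Bool) : ℝ :=
  (∑ i, wt π k (dv x σ) i * lab (σ i).2) / k

theorem dev_bound (ν : Measure (Y × Bool)) [IsProbabilityMeasure ν] (x : Y) (η : Y → ℝ) (hη : Measurable η)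
    (h0 : ∀ z, 0 ≤ η z) (h1 : ∀ z, η z ≤ 1)
    (hort : ∀ g : Y → ℝ, Measurable g → (∀ z, |g z| ≤ 1) → ∫ p, g p.1 * (lab p.2 - η p.1) ∂ν = 0)
    (ε : ℝ≥0∞) (ρ : ℝ)
    (hball : ∀ r, 0 ≤ r → r < ρ → ∫⁻ z in closedBall x r, ‖η z - η x‖ₑ ∂ν.fst ≤ ε * ν.fst (closedBall x r))
    {n k : ℕ} (hk0 : 0 < k) (hk : k ≤ n) (π : Equiv.Perm (Fin n)) :
    ∫⁻ σ, ‖vote π k x σ - η x‖ₑ ∂(Measure.pi fun _ : Fin n => ν) ≤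
      ENNReal.ofReal (√k)⁻¹ + (ε + 2 ^ k * (1 - ν.fst (ball x ρ) / 2) ^ n) := by
  have hkp : (0 : ℝ) < k := by exact_mod_cast hk0
  have hf : Measurable fun z => ‖η z - η x‖ₑ := (hη.sub measurable_const).enorm
  have hb := bias_bound ν x (fun z => ‖η z - η x‖ₑ) hf (fun z => by
    rw [Real.enorm_eq_ofReal_abs, ← ENNReal.ofReal_one]
    refine ENNReal.ofReal_le_ofReal ?_
    rw [abs_le]
    have := h0 z; have := h1 z; have := h0 x; have := h1 x
    constructor <;> linarith) ε ρ hball hk π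
  have ha := abs_bound ν x η hη h0 h1 hort hk0 hk π
  set P := Measure.pi fun _ : Fin n => ν with hP
  have hpt : ∀ σ : Fin n → Y × Bool, ‖vote π k x σ - η x‖ₑ ≤
      (k : ℝ≥0∞)⁻¹ * (‖∑ i, wt π k (dv x σ) i * (lab (σ i).2 - η (σ i).1)‖ₑ
        + ∑ i, ENNReal.ofReal (wt π k (dv x σ) i) * ‖η (σ i).1 - η x‖ₑ) := by
    intro σ
    have e : vote π k x σ - η x = (k : ℝ)⁻¹ * (∑ i, wt π k (dv x σ) i * (lab (σ i).2 - η (σ i).1)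
        + ∑ i, wt π k (dv x σ) i * (η (σ i).1 - η x)) := by
      rw [← Finset.sum_add_distrib]
      have : ∀ i, wt π k (dv x σ) i * (lab (σ i).2 - η (σ i).1) + wt π k (dv x σ) i * (η (σ i).1 - η x)
        = wt π k (dv x σ) i * lab (σ i).2 - wt π k (dv x σ) i * η x := fun i => by ring
      simp_rw [this]
      rw [Finset.sum_sub_distrib, ← Finset.sum_mul, sum_wt π hk]
      unfold vote
      field_simp
    rw [e, enorm_mul]
    have e2 : ‖(k : ℝ)⁻¹‖ₑ = (k : ℝ≥0∞)⁻¹ := by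
      rw [enorm_inv hkp.ne']
      simp
    rw [e2]
    gcongr
    refine (enorm_add_le _ _).trans ?_
    gcongr
    refine (enorm_sum_le _ _).trans (Finset.sum_le_sum fun i _ => ?_)
    rw [enorm_mul, Real.enorm_eq_ofReal (wt_nonneg _ _ _ _)]
  have hAm : Measurable fun σ : Fin n → Y × Bool => ‖∑ i, wt π k (dv x σ) i * (lab (σ i).2 - η (σ i).1)‖ₑ := by
    refine Measurable.enorm (Finset.measurable_sum _ fun i _ => ?_)
    refine ((measurable_wt π k i).comp (measurable_dv x)).fun_mul ?_
    refine Measurable.fun_sub ?_ ?_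
    · exact measurable_lab.comp (measurable_snd.comp (measurable_pi_apply i))
    · exact hη.comp (measurable_fst.comp (measurable_pi_apply i))
  have hkne : (k : ℝ≥0∞) ≠ 0 := by exact_mod_cast hk0.ne'
  calc _ ≤ ∫⁻ σ, (k : ℝ≥0∞)⁻¹ * (‖∑ i, wt π k (dv x σ) i * (lab (σ i).2 - η (σ i).1)‖ₑ
        + ∑ i, ENNReal.ofReal (wt π k (dv x σ) i) * ‖η (σ i).1 - η x‖ₑ) ∂P := lintegral_mono hpt
    _ = (k : ℝ≥0∞)⁻¹ * (∫⁻ σ, ‖∑ i, wt π k (dv x σ) i * (lab (σ i).2 - η (σ i).1)‖ₑ ∂P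
        + ∫⁻ σ, ∑ i, ENNReal.ofReal (wt π k (dv x σ) i) * ‖η (σ i).1 - η x‖ₑ ∂P) := by
      rw [lintegral_const_mul' _ _ (by simpa using hk0.ne'), lintegral_add_left hAm]
    _ ≤ (k : ℝ≥0∞)⁻¹ * (ENNReal.ofReal (√k) + (k * ε + k * (2 ^ k * (1 - ν.fst (ball x ρ) / 2) ^ n))) := by
      gcongr
    _ = _ := by
      rw [← mul_add (k : ℝ≥0∞), mul_add, ← mul_assoc, ENNReal.inv_mul_cancel hkne (by simp), one_mul]
      congr 1
      have : (k : ℝ≥0∞)⁻¹ = ENNReal.ofReal (k : ℝ)⁻¹ := by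
        rw [ENNReal.ofReal_inv_of_pos hkp]; simp
      rw [this, ← ENNReal.ofReal_mul (by positivity)]
      congr 1
      have hsq : √(k : ℝ) * √k = k := Real.mul_self_sqrt (by positivity)
      have hkk : (0 : ℝ) < √k := Real.sqrt_pos.2 hkp
      field_simp
      linarith

end
end KNNAux

namespace KNNAux
section
variable {Y : Type u} [MetricSpace Y] [MeasurableSpace Y] [BorelSpace Y] [SecondCountableTopology Y]

theorem meas_ne {α : Type*} [MeasurableSpace α] {f g : α → Bool} (hf : Measurable f) (hg : Measurable g) :
    MeasurableSet {a | f a ≠ g a} :=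
  (hf.prodMk hg) (MeasurableSet.of_discrete (s := {q : Bool × Bool | q.1 ≠ q.2}))

def loss (b : Bool) (c : ℝ) : ℝ := if b = true then 1 - c else c

theorem exists_eta {Y : Type u} [MeasurableSpace Y] (ν : Measure (Y × Bool)) [IsProbabilityMeasure ν] :
    ∃ η : Y → ℝ, Measurable η ∧ (∀ z, 0 ≤ η z) ∧ (∀ z, η z ≤ 1) ∧
    (∀ g : Y → ℝ, Measurable g → (∀ z, |g z| ≤ 1) → ∫ p, g p.1 * (lab p.2 - η p.1) ∂ν = 0) ∧
    ∀ T : Y → Bool, Measurable T → ν {p | T p.1 ≠ p.2} = ∫⁻ x, ENNReal.ofReal (loss (T x) (η x)) ∂ν.fst := by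
  set K := ν.condKernel with hK
  set η : Y → ℝ := fun x => (K x).real {true} with hη
  have hηm : Measurable η := (K.measurable_coe (measurableSet_singleton true)).ennreal_toReal
  have h0 : ∀ z, 0 ≤ η z := fun z => measureReal_nonneg
  have h1 : ∀ z, η z ≤ 1 := fun z => measureReal_le_one
  have hf : ∀ z, (K z).real {false} = 1 - η z := by
    intro z
    have : ({false} : Set Bool) = {true}ᶜ := by ext b; cases b <;> simp
    rw [this, probReal_compl_eq_one_sub (measurableSet_singleton _)]
  have hdis : ν.fst.compProd K = ν := ν.disintegrate _
  refine ⟨η, hηm, h0, h1, ?_, ?_⟩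
  · intro g hg hgb
    have hm : Measurable fun p : Y × Bool => g p.1 * (lab p.2 - η p.1) :=
      (hg.comp measurable_fst).fun_mul ((measurable_lab.comp measurable_snd).fun_sub (hηm.comp measurable_fst))
    have hi : Integrable (fun p : Y × Bool => g p.1 * (lab p.2 - η p.1)) ν := by
      refine integrable_bdd ν hm 1 fun p => ?_
      rw [abs_mul]
      refine mul_le_one₀ (hgb _) (abs_nonneg _) ?_
      rw [abs_le]
      have a1 := lab_nonneg p.2
      have a2 := lab_le p.2
      have a3 := h0 p.1
      have a4 := h1 p.1
      constructor <;> linarith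
    rw [← hdis] at hi ⊢
    rw [Measure.integral_compProd hi]
    refine integral_eq_zero_of_ae (Eventually.of_forall fun z => ?_)
    dsimp only
    rw [integral_fintype (Integrable.of_finite)]
    simp only [Fintype.sum_bool, hf, smul_eq_mul, lab]
    change η z * _ + _ = 0
    simp
    ring
  · intro T hT
    have hS : MeasurableSet {p : Y × Bool | T p.1 ≠ p.2} :=
      meas_ne (hT.comp measurable_fst) measurable_snd
    conv_lhs => rw [← hdis]
    rw [Measure.compProd_apply hS]
    refine lintegral_congr fun x => ?_
    cases h : T x
    · have : Prod.mk x ⁻¹' {p : Y × Bool | T p.1 ≠ p.2} = {true} := by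
        ext b; cases b <;> simp [h]
      rw [this]
      simp [loss, hη]
    · have : Prod.mk x ⁻¹' {p : Y × Bool | T p.1 ≠ p.2} = {false} := by
        ext b; cases b <;> simp [h]
      rw [this]
      simp [loss, ← hf]

theorem measurable_vote {n : ℕ} (π : Equiv.Perm (Fin n)) (k : ℕ) :
    Measurable fun q : (Fin n → Y × Bool) × Y => vote π k q.2 q.1 := by
  unfold vote
  refine Measurable.div_const (Finset.measurable_sum _ fun i _ => ?_) _
  refine ((measurable_wt π k i).comp measurable_dv2).fun_mul ?_
  exact measurable_lab.comp (measurable_snd.comp ((measurable_pi_apply i).comp measurable_fst))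

theorem label_iff {n k : ℕ} (hk : 0 < k) (π : Equiv.Perm (Fin n)) (σ : Fin n → Y × Bool) (x : Y) :
    kNNLabel n k σ π x = true ↔ 1 / 2 ≤ vote π k x σ := by
  have hkp : (0 : ℝ) < k := by exact_mod_cast hk
  rw [kNNLabel_eq]
  change (k : ℝ) ≤ 2 * ∑ i, wt π k (dv x σ) i * lab (σ i).2 ↔ _
  unfold vote
  rw [le_div_iff₀ hkp]
  constructor <;> intro h <;> linarith

theorem measurable_label {n k : ℕ} (hk : 0 < k) (π : Equiv.Perm (Fin n)) :
    Measurable fun q : (Fin n → Y × Bool) × Y => kNNLabel n k q.1 π q.2 := by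
  refine measurable_to_bool ?_
  have : (fun q : (Fin n → Y × Bool) × Y => kNNLabel n k q.1 π q.2) ⁻¹' {true} =
      {q | 1 / 2 ≤ vote π k q.2 q.1} := by
    ext q; simp only [mem_preimage, mem_singleton_iff, label_iff hk, Set.mem_ofPred_eq]
  rw [this]
  exact measurableSet_le measurable_const (measurable_vote π k)

theorem measurable_label_left {n k : ℕ} (hk : 0 < k) (π : Equiv.Perm (Fin n)) (σ : Fin n → Y × Bool) :
    Measurable fun x : Y => kNNLabel n k σ π x :=
  Measurable.comp (g := fun q : (Fin n → Y × Bool) × Y => kNNLabel n k q.1 π q.2) (f := fun x => (σ, x))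
    (measurable_label hk π) measurable_prodMk_left

theorem measurable_label3 {n k : ℕ} (hk : 0 < k) (π : Equiv.Perm (Fin n)) :
    Measurable fun q : (Fin n → Y × Bool) × (Y × Bool) => kNNLabel n k q.1 π q.2.1 :=
  Measurable.comp (g := fun q : (Fin n → Y × Bool) × Y => kNNLabel n k q.1 π q.2)
    (f := fun q : (Fin n → Y × Bool) × (Y × Bool) => (q.1, q.2.1))
    (measurable_label hk π) (measurable_fst.prodMk (measurable_fst.comp measurable_snd))

theorem loss_le {v c : ℝ} {t : Bool} (b : Bool) (ht : t = true ↔ 1 / 2 ≤ v) (h0 : 0 ≤ c) (h1 : c ≤ 1) :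
    ENNReal.ofReal (loss t c) ≤ ENNReal.ofReal (loss b c) + 2 * ‖v - c‖ₑ := by
  rw [Real.enorm_eq_ofReal_abs]
  have : (2 : ℝ≥0∞) = ENNReal.ofReal 2 := by simp
  have hb : 0 ≤ loss b c := by cases b <;> simp [loss] <;> linarith
  rw [this, ← ENNReal.ofReal_mul (by norm_num), ← ENNReal.ofReal_add hb (by positivity)]
  refine ENNReal.ofReal_le_ofReal ?_
  have a1 := le_abs_self (v - c)
  have a2 := neg_abs_le (v - c)
  cases t
  · have : v < 1 / 2 := by
      by_contra h; push Not at h; exact absurd (ht.2 h) (by simp)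
    cases b <;> simp [loss] <;> linarith [abs_nonneg (v - c)]
  · have := ht.1 rfl
    cases b <;> simp [loss] <;> linarith [abs_nonneg (v - c)]

theorem err_bounds (ν : Measure (Y × Bool)) [IsProbabilityMeasure ν] (η : Y → ℝ) (hη : Measurable η)
    (h0 : ∀ z, 0 ≤ η z) (h1 : ∀ z, η z ≤ 1)
    (hL : ∀ T : Y → Bool, Measurable T → ν {p | T p.1 ≠ p.2} = ∫⁻ x, ENNReal.ofReal (loss (T x) (η x)) ∂ν.fst)
    {n k : ℕ} (hk : 0 < k) (π : Equiv.Perm (Fin n)) :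
    bayesError ν ≤ (Measure.pi fun _ : Fin n => ν).prod ν
        {q : (Fin n → Y × Bool) × (Y × Bool) | kNNLabel n k q.1 π q.2.1 ≠ q.2.2} ∧
    (Measure.pi fun _ : Fin n => ν).prod ν
        {q : (Fin n → Y × Bool) × (Y × Bool) | kNNLabel n k q.1 π q.2.1 ≠ q.2.2} ≤
      bayesError ν + 2 * ∫⁻ x, ∫⁻ σ, ‖vote π k x σ - η x‖ₑ ∂(Measure.pi fun _ : Fin n => ν) ∂ν.fst := by
  have hT : ∀ σ : Fin n → Y × Bool, Measurable fun x => kNNLabel n k σ π x := fun σ =>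
    measurable_label_left hk π σ
  have hS : MeasurableSet {q : (Fin n → Y × Bool) × (Y × Bool) | kNNLabel n k q.1 π q.2.1 ≠ q.2.2} := by
    refine meas_ne ?_ ?_
    · exact measurable_label3 hk π
    · exact measurable_snd.comp measurable_snd
  rw [Measure.prod_apply hS]
  have hsec : ∀ σ, ν (Prod.mk σ ⁻¹' {q : (Fin n → Y × Bool) × (Y × Bool) | kNNLabel n k q.1 π q.2.1 ≠ q.2.2})
      = ν {p | kNNLabel n k σ π p.1 ≠ p.2} := fun σ => rfl
  simp only [hsec]
  have hvm : Measurable fun q : (Fin n → Y × Bool) × Y => ‖vote π k q.2 q.1 - η q.2‖ₑ :=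
    ((measurable_vote π k).fun_sub (hη.comp measurable_snd)).enorm
  constructor
  · have : ∀ σ : Fin n → Y × Bool, bayesError ν ≤ ν {p | kNNLabel n k σ π p.1 ≠ p.2} := fun σ =>
      iInf₂_le (fun x => kNNLabel n k σ π x) (hT σ)
    calc bayesError ν = ∫⁻ σ, bayesError ν ∂(Measure.pi fun _ : Fin n => ν) := by simp
      _ ≤ _ := lintegral_mono this
  · rw [← tsub_le_iff_right]
    refine le_iInf₂ fun B hB => ?_
    rw [tsub_le_iff_right]
    calc _ ≤ ∫⁻ σ, (ν {p | B p.1 ≠ p.2} + 2 * ∫⁻ x, ‖vote π k x σ - η x‖ₑ ∂ν.fst) ∂(Measure.pi fun _ : Fin n => ν) := by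
          refine lintegral_mono fun σ => ?_
          dsimp only
          rw [hL _ (hT σ), hL _ hB]
          have hvx : Measurable fun x => ‖vote π k x σ - η x‖ₑ := 
            Measurable.comp (g := fun q : (Fin n → Y × Bool) × Y => ‖vote π k q.2 q.1 - η q.2‖ₑ) (f := fun x => (σ, x)) hvm measurable_prodMk_left
          rw [← lintegral_const_mul _ hvx, ← lintegral_add_right _ (hvx.const_mul 2)]
          exact lintegral_mono fun x => loss_le (B x) (label_iff hk π σ x) (h0 x) (h1 x)
      _ = _ := by
          rw [lintegral_add_left measurable_const, lintegral_const_mul' _ _ (by norm_num)]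
          rw [lintegral_lintegral_swap (f := fun (σ : Fin n → Y × Bool) (x : Y) => ‖vote π k x σ - η x‖ₑ) (hvm.aemeasurable)]
          simp

theorem avg_le {n : ℕ} (a : Equiv.Perm (Fin n) → ℝ≥0∞) (C : ℝ≥0∞) (h : ∀ π, a π ≤ C) :
    (∑ π, a π) / (Nat.factorial n : ℝ≥0∞) ≤ C := by
  refine ENNReal.div_le_of_le_mul' ?_
  refine (Finset.sum_le_sum fun π _ => h π).trans ?_
  simp [Fintype.card_perm]

theorem le_avg {n : ℕ} (a : Equiv.Perm (Fin n) → ℝ≥0∞) (C : ℝ≥0∞) (h : ∀ π, C ≤ a π) :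
    C ≤ (∑ π, a π) / (Nat.factorial n : ℝ≥0∞) := by
  rw [ENNReal.le_div_iff_mul_le (Or.inl (by exact_mod_cast n.factorial_ne_zero)) (Or.inl (by simp))]
  refine le_trans ?_ (Finset.sum_le_sum fun π _ => h π)
  simp [Fintype.card_perm, mul_comm]

theorem sep_consistent (hY : IsSigmaFiniteDimNagata Y) (k : ℕ → ℕ) (hk : Tendsto k atTop atTop)
    (hkn : Tendsto (fun n : ℕ => (k n : ℝ) / n) atTop (nhds 0))
    (ν : Measure (Y × Bool)) [IsProbabilityMeasure ν] :
    Tendsto (fun n => kNNError ν n (k n)) atTop (nhds (bayesError ν)) := by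
  obtain ⟨η, hη, h0, h1, hort, hL⟩ := exists_eta ν
  set Φ : ℕ → Y → ℝ≥0∞ := fun n x =>
    (∑ π : Equiv.Perm (Fin n), ∫⁻ σ, ‖vote π (k n) x σ - η x‖ₑ ∂(Measure.pi fun _ : Fin n => ν)) / (Nat.factorial n : ℝ≥0∞) with hΦ
  have hin : ∀ (n : ℕ) (π : Equiv.Perm (Fin n)), Measurable fun x => ∫⁻ σ, ‖vote π (k n) x σ - η x‖ₑ ∂(Measure.pi fun _ : Fin n => ν) := by
    intro n π
    have hvm : Measurable fun q : (Fin n → Y × Bool) × Y => ‖vote π (k n) q.2 q.1 - η q.2‖ₑ :=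
      ((measurable_vote π (k n)).fun_sub (hη.comp measurable_snd)).enorm
    exact hvm.lintegral_prod_left'
  have hΦm : ∀ n, Measurable (Φ n) := fun n => (Finset.measurable_sum _ fun π _ => hin n π).div_const _
  have hkpos : ∀ᶠ n in atTop, 0 < k n := hk.eventually_gt_atTop 0
  have hkle : ∀ᶠ n in atTop, k n ≤ n := by
    filter_upwards [hkn.eventually (gt_mem_nhds one_pos), eventually_gt_atTop 0] with n hn hn0
    rw [div_lt_one (by exact_mod_cast hn0)] at hn
    exact_mod_cast hn.le
  have hvle : ∀ (n : ℕ), 0 < k n → k n ≤ n → ∀ x, Φ n x ≤ 1 := by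
    intro n hp hl x
    refine avg_le _ _ fun π => ?_
    refine (lintegral_mono (g := fun _ => 1) fun σ => ?_).trans (by simp)
    dsimp only
    rw [Real.enorm_eq_ofReal_abs, ← ENNReal.ofReal_one]
    refine ENNReal.ofReal_le_ofReal ?_
    have hkp : (0 : ℝ) < k n := by exact_mod_cast hp
    have v0 : 0 ≤ vote π (k n) x σ := by
      unfold vote
      exact div_nonneg (Finset.sum_nonneg fun i _ => mul_nonneg (wt_nonneg _ _ _ _) (lab_nonneg _)) hkp.le
    have v1 : vote π (k n) x σ ≤ 1 := by
      unfold vote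
      rw [div_le_one hkp, ← sum_wt π hl (dv x σ)]
      exact Finset.sum_le_sum fun i _ => mul_le_of_le_one_right (wt_nonneg _ _ _ _) (lab_le _)
    have := h0 x; have := h1 x
    rw [abs_le]; constructor <;> linarith
  have hlim : ∀ᵐ x ∂ν.fst, Tendsto (fun n => Φ n x) atTop (nhds 0) := by
    filter_upwards [ae_support ν.fst, lebesgue_diff hY ν.fst η hη (fun z => by
      rw [abs_of_nonneg (h0 z)]; exact h1 z)] with x hs hd
    rw [ENNReal.tendsto_nhds_zero]
    intro ε hε
    obtain ⟨δ, hδ0, hδ⟩ := ENNReal.lt_iff_exists_nnreal_btwn.1 hε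
    obtain ⟨ρ, hρ, hball⟩ := hd δ (by exact_mod_cast hδ0)
    have ht : Tendsto (fun n => ENNReal.ofReal (√(k n))⁻¹ +
        ((δ : ℝ≥0∞) + 2 ^ (k n) * (1 - ν.fst (ball x ρ) / 2) ^ n)) atTop (nhds (0 + (δ + 0))) := by
      refine Tendsto.add ?_ (tendsto_const_nhds.add (tail_tendsto k hkn _ (hs ρ hρ) prob_le_one))
      rw [← ENNReal.ofReal_zero]
      refine ENNReal.tendsto_ofReal (tendsto_inv_atTop_zero.comp ?_)
      exact Real.tendsto_sqrt_atTop.comp (tendsto_natCast_atTop_atTop.comp hk)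
    rw [zero_add, add_zero] at ht
    filter_upwards [ht.eventually (gt_mem_nhds hδ), hkpos, hkle] with n hn hp hl
    refine avg_le _ _ fun π => ?_
    exact (dev_bound ν x η hη h0 h1 hort δ ρ hball hp hl π).trans hn.le
  have hint : Tendsto (fun n => ∫⁻ x, Φ n x ∂ν.fst) atTop (nhds 0) := by
    have := tendsto_lintegral_filter_of_dominated_convergence (μ := ν.fst) (l := atTop) (F := Φ) (f := fun _ => 0) (fun _ => 1)
      (Eventually.of_forall hΦm) (by
        filter_upwards [hkpos, hkle] with n hp hl
        exact Eventually.of_forall (hvle n hp hl)) (by simp) hlim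
    simpa using this
  have hup : Tendsto (fun n => bayesError ν + 2 * ∫⁻ x, Φ n x ∂ν.fst) atTop (nhds (bayesError ν)) := by
    have := (tendsto_const_nhds (x := bayesError ν) (f := atTop (α := ℕ))).add
      (ENNReal.Tendsto.const_mul (a := 2) hint (Or.inr (by norm_num)))
    simpa using this
  refine tendsto_of_tendsto_of_tendsto_of_le_of_le' tendsto_const_nhds hup ?_ ?_
  · filter_upwards [hkpos] with n hp
    exact le_avg _ _ fun π => (err_bounds ν η hη h0 h1 hL hp π).1
  · filter_upwards [hkpos] with n hp
    have e : ∫⁻ x, Φ n x ∂ν.fst = (∑ π : Equiv.Perm (Fin n), ∫⁻ x, ∫⁻ σ, ‖vote π (k n) x σ - η x‖ₑ ∂(Measure.pi fun _ : Fin n => ν) ∂ν.fst) / (Nat.factorial n : ℝ≥0∞) := by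
      simp only [hΦ, div_eq_mul_inv]
      rw [lintegral_mul_const _ (Finset.measurable_sum _ fun π _ => hin n π), lintegral_finsetSum _ fun π _ => hin n π]
    have hfac : (Nat.factorial n : ℝ≥0∞) ≠ 0 := by exact_mod_cast n.factorial_ne_zero
    rw [e]
    unfold kNNError
    refine (ENNReal.div_le_div_right (Finset.sum_le_sum fun π _ => (err_bounds ν η hη h0 h1 hL hp π).2) _).trans ?_
    rw [Finset.sum_add_distrib, ENNReal.add_div, ← Finset.mul_sum, mul_div_assoc]
    gcongr
    exact avg_le (fun _ => bayesError ν) _ fun _ => le_rfl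
end

theorem forward {Ω : Type u} [MetricSpace Ω]
    (h : ∀ Y : Set Ω, TopologicalSpace.IsSeparable Y → IsSigmaFiniteDimNagata Y)
    (hden : ∀ τ : Cardinal.{u}, IsRealValuedMeasurableCardinal τ → densityCard Ω < τ) :
    kNNUniversallyConsistent Ω := by
  unfold kNNUniversallyConsistent
  let _ : MeasurableSpace Ω := borel Ω
  have : BorelSpace Ω := ⟨rfl⟩
  intro k hk hkn μt hμt
  obtain ⟨Z, hZc, hZs, hZ0⟩ := exists_separable_carrier (μt.map Prod.fst) hden
  obtain ⟨ν, hν, hb, he⟩ := transfer Z hZc.measurableSet μt (by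
    rwa [Measure.map_apply measurable_fst hZc.measurableSet.compl] at hZ0)
  have : TopologicalSpace.SeparableSpace Z := hZs.separableSpace
  have : SecondCountableTopology Z := UniformSpace.secondCountable_of_separable Z
  have := sep_consistent (h Z hZs) k hk hkn ν
  rw [hb] at this
  simpa only [he] using this

end KNNAux

/-- **Corollary.** Let `Ω` be a metric space each of whose separable subspaces is
sigma-finite dimensional in the sense of Nagata and Preiss.  Then the `k`-NN classifier
is universally consistent in `Ω` if and only if the density of `Ω` is strictly less
than every real-valued measurable cardinal. -/
theorem kNN_universallyConsistent_iff_density_lt_rvm_of_sigmaFiniteDim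
    (Ω : Type u) [MetricSpace Ω]
    (h : ∀ Y : Set Ω, TopologicalSpace.IsSeparable Y → IsSigmaFiniteDimNagata Y) :
    kNNUniversallyConsistent Ω ↔
      ∀ τ : Cardinal.{u}, IsRealValuedMeasurableCardinal τ → densityCard Ω < τ := by
  exact ⟨fun hc τ hτ => KNNAux.backward hc τ hτ, fun hden => KNNAux.forward h hden⟩

end
end

section
/- Let (Ω,𝒜,μ) be a probability space with Ω infinite, and suppose there exists a learning rule 𝓛 on (Ω,𝒜) which is consistent for every learning problem (μ,η) with η: Ω→[0,1] measurable. Then the Maharam type of the measure algebra (𝒜, μ∘Δ) does not exceed the cardinality of Ω; equivalently, the metric space of classes of measurable sets modulo μ-null sets, with distance d(A,B) = μ(A Δ B), has a dense subset of cardinality at most |Ω|. -/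
open MeasureTheory Filter Set Cardinal
open scoped ENNReal symmDiff

noncomputable section

universe u

/-- A *learning rule* on a measurable space `Ω`: a map assigning to every labelled sample
`σ ∈ Ωⁿ × {0,1}ⁿ` a classifier `Ω → {0,1}`, jointly measurable in the sample and the point. -/
structure LearningRule (Ω : Type u) [MeasurableSpace Ω] where
  classify : (n : ℕ) → (Fin n → Ω × Bool) → Ω → Bool
  measurable : ∀ n : ℕ, Measurable fun q : (Fin n → Ω × Bool) × Ω => classify n q.1 q.2

/-- The expected misclassification error of the rule `L` at sample size `n`, for i.i.d.
labelled data with law `μt` on `Ω × {0,1}`. -/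
def ruleError {Ω : Type u} [MeasurableSpace Ω] (L : LearningRule Ω)
    (μt : Measure (Ω × Bool)) (n : ℕ) : ℝ≥0∞ :=
  (Measure.pi fun _ : Fin n => μt).prod μt
    {q : (Fin n → Ω × Bool) × (Ω × Bool) | L.classify n q.1 q.2.1 ≠ q.2.2}

/-- The probability measure on `Ω × {0,1}` determined by the learning problem `(μ, η)`:
its first marginal is `μ` and the conditional probability of the label `1` at `x` is `η x`. -/
def labelMeasure {Ω : Type u} [MeasurableSpace Ω] (μ : Measure Ω) (η : Ω → ℝ) :
    Measure (Ω × Bool) :=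
  μ.bind fun x =>
    ENNReal.ofReal (η x) • Measure.dirac (x, true) +
      ENNReal.ofReal (1 - η x) • Measure.dirac (x, false)

/-- The rule `L` is consistent for the learning problem `(μ, η)`. -/
def ConsistentFor {Ω : Type u} [MeasurableSpace Ω] (L : LearningRule Ω)
    (μ : Measure Ω) (η : Ω → ℝ) : Prop :=
  Tendsto (ruleError L (labelMeasure μ η)) atTop (nhds (bayesError (labelMeasure μ η)))

/-- **Theorem.** Let `(Ω, 𝒜, μ)` be a probability space with `Ω` infinite, admitting a
learning rule consistent for every measurable regression function `η : Ω → [0,1]`.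
Then the Maharam type of the measure algebra `(𝒜, μ ∘ Δ)` does not exceed the cardinality
of `Ω`: the metric space of measurable sets with the distance `μ (A Δ B)` has a dense
family of cardinality at most `#Ω`. -/
theorem maharamType_le_card_of_consistent_learningRule
    {Ω : Type u} [MeasurableSpace Ω] (μ : Measure Ω) [IsProbabilityMeasure μ]
    [Infinite Ω] (L : LearningRule Ω)
    (hL : ∀ η : Ω → ℝ, Measurable η → (∀ x, η x ∈ Set.Icc (0 : ℝ) 1) →
      ConsistentFor L μ η) :
    ∃ D : Set (Set Ω), (∀ A ∈ D, MeasurableSet A) ∧ #D ≤ #Ω ∧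
      ∀ A : Set Ω, MeasurableSet A → ∀ ε : ℝ≥0∞, 0 < ε →
        ∃ B ∈ D, μ (A ∆ B) < ε := by
  classical
  refine ⟨Set.range fun s : (Σ n : ℕ, (Fin n → Ω × Bool)) =>
    {x | L.classify s.1 s.2 x = true}, ?_, ?_, ?_⟩
  · rintro _ ⟨⟨n, s⟩, rfl⟩
    have h : Measurable fun x => L.classify n s x :=
      (L.measurable n).comp (measurable_const.prodMk measurable_id)
    exact h (measurableSet_singleton true)
  · refine Cardinal.mk_range_le.trans ?_
    have hinf : ℵ₀ ≤ #Ω := Cardinal.aleph0_le_mk Ω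
    rw [Cardinal.mk_sigma]
    refine (Cardinal.sum_le_lift_mk_mul_iSup_lift _).trans ?_
    have hb : ∀ n : ℕ, #(Fin n → Ω × Bool) ≤ #Ω := by
      intro n
      have h2 : #(Ω × Bool) ≤ #Ω := by
        rw [Cardinal.mk_prod]
        simp only [Cardinal.lift_id, Cardinal.lift_uzero, Cardinal.mk_bool, Cardinal.lift_ofNat]
        exact Cardinal.mul_le_of_le hinf le_rfl
          ((Cardinal.ofNat_lt_aleph0 (n := 2)).le.trans hinf)
      have : #(Fin n → Ω × Bool) = #(Ω × Bool) ^ n := by simp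
      rw [this]
      exact (pow_le_pow_left' h2 n).trans (Cardinal.power_nat_le hinf)
    have hs : (⨆ n : ℕ, Cardinal.lift.{0} #(Fin n → Ω × Bool)) ≤ #Ω :=
      ciSup_le' fun n => by simpa using hb n
    refine Cardinal.mul_le_of_le hinf ?_ ?_
    · simp
    · exact hs
  · intro A hA ε hε
    have hf : Measurable fun x : Ω => (x, decide (x ∈ A)) :=
      measurable_id.prodMk (measurable_to_bool (by
        have : (fun x => decide (x ∈ A)) ⁻¹' {true} = A := by ext x; simp
        rw [this]; exact hA))
    have hl : labelMeasure μ (A.indicator fun _ => (1 : ℝ)) =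
        μ.map fun x => (x, decide (x ∈ A)) := by
      rw [← Measure.bind_dirac_eq_map μ hf]
      unfold labelMeasure
      congr 1
      funext x
      by_cases hx : x ∈ A <;> simp [hx]
    have hc := hL (A.indicator fun _ => (1 : ℝ)) (measurable_const.indicator hA) (by
      intro x
      by_cases hx : x ∈ A <;> simp [hx])
    unfold ConsistentFor at hc
    rw [hl] at hc
    set ν := μ.map fun x => (x, decide (x ∈ A)) with hν
    have : IsProbabilityMeasure ν := Measure.isProbabilityMeasure_map hf.aemeasurable
    have h0 : bayesError ν = 0 := by
      refine le_antisymm ?_ bot_le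
      unfold bayesError
      refine (iInf₂_le (fun x => decide (x ∈ A)) (measurable_snd.comp hf)).trans ?_
      rw [hν, Measure.map_apply hf]
      · simp
      · exact (measurableSet_eq_fun ((measurable_snd.comp hf).comp measurable_fst)
          measurable_snd).compl
    rw [h0] at hc
    obtain ⟨n, hn⟩ := (hc.eventually (gt_mem_nhds hε)).exists
    have hm : Measurable fun q : (Fin n → Ω × Bool) × (Ω × Bool) => L.classify n q.1 q.2.1 :=
      (L.measurable n).comp (measurable_fst.prodMk (measurable_fst.comp measurable_snd))
    have hS : MeasurableSet {q : (Fin n → Ω × Bool) × (Ω × Bool) |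
        L.classify n q.1 q.2.1 ≠ q.2.2} :=
      (measurableSet_eq_fun hm (measurable_snd.comp measurable_snd)).compl
    unfold ruleError at hn
    rw [Measure.prod_apply hS] at hn
    have hex : ∃ s : Fin n → Ω × Bool, ν (Prod.mk s ⁻¹'
        {q : (Fin n → Ω × Bool) × (Ω × Bool) | L.classify n q.1 q.2.1 ≠ q.2.2}) < ε := by
      by_contra! hcon
      refine absurd hn (not_lt.2 ?_)
      calc ε = ∫⁻ _, ε ∂(Measure.pi fun _ : Fin n => ν) := by simp
        _ ≤ _ := lintegral_mono hcon
    obtain ⟨s, hs⟩ := hex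
    refine ⟨_, ⟨⟨n, s⟩, rfl⟩, ?_⟩
    rw [hν, Measure.map_apply hf (measurable_prodMk_left hS)] at hs
    convert hs using 2
    ext x
    by_cases hx : x ∈ A <;> simp [Set.mem_symmDiff, hx]

end
end

section
/- Let τ be an atomlessly measurable cardinal and let μ be a witnessing atomless probability measure defined on all subsets of τ. Then the measure space (τ, 2^τ, μ) admits no learning rule that is consistent for every measurable regression function η: τ → [0,1]. -/
open MeasureTheory Filter Set Cardinal
open scoped ENNReal symmDiff

noncomputable section

universe u

lemma kunen_null {X : Type*} {Y : Type*} [MeasurableSpace X] [TopologicalSpace Y]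
    [SecondCountableTopology Y] [MeasurableSpace Y] [BorelSpace Y]
    (hX : ∀ s : Set X, MeasurableSet s) (μ : Measure X) [IsFiniteMeasure μ]
    (ν : Measure Y) [IsFiniteMeasure ν] [ν.OuterRegular] (W : X → Set Y)
    (hW : ∀ a, ν (W a) = 0) : ν {y | μ {a | y ∈ W a} ≠ 0} = 0 := by
  have h1 : ∀ (j : ℕ) (a : X), ∃ U : Set Y, W a ⊆ U ∧ IsOpen U ∧ ν U < ((j : ℝ≥0∞) + 1)⁻¹ := by
    intro j a
    have : ν (W a) < ((j : ℝ≥0∞) + 1)⁻¹ := by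
      rw [hW a]
      exact ENNReal.inv_pos.2 (by finiteness)
    obtain ⟨U, h1, h2, h3⟩ := Set.exists_isOpen_lt_of_lt (W a) _ this
    exact ⟨U, h1, h2, h3⟩
  choose U hWU hUo hUν using h1
  set V : Set (X × Y) := {p | ∀ j, p.2 ∈ U j p.1} with hV
  have hVm : MeasurableSet V := by
    have : V = ⋂ j, ⋃ b ∈ TopologicalSpace.countableBasis Y, {a | b ⊆ U j a} ×ˢ b := by
      ext ⟨a, y⟩
      simp only [hV, mem_ofPred_eq, mem_iInter, mem_iUnion, mem_prod, exists_prop]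
      refine forall_congr' fun j => ⟨fun h => ?_, ?_⟩
      · obtain ⟨b, hb, hyb, hbU⟩ :=
          (TopologicalSpace.isBasis_countableBasis Y).exists_subset_of_mem_open h (hUo j a)
        exact ⟨b, hb, hbU, hyb⟩
      · rintro ⟨b, hb, hbU, hyb⟩
        exact hbU hyb
    rw [this]
    refine MeasurableSet.iInter fun j => MeasurableSet.biUnion
      (TopologicalSpace.countable_countableBasis Y) fun b hb => ?_
    exact (hX _).prod (TopologicalSpace.isOpen_of_mem_countableBasis hb).measurableSet
  have hV0 : (μ.prod ν) V = 0 := by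
    rw [Measure.measure_prod_null hVm]
    refine Eventually.of_forall fun a => ?_
    simp only [Pi.zero_apply]
    refine le_antisymm ?_ (zero_le)
    refine ENNReal.le_of_forall_pos_le_add fun ε hε _ => ?_
    obtain ⟨j, hj⟩ := ENNReal.exists_inv_nat_lt (a := (ε : ℝ≥0∞)) (by simpa using hε.ne')
    rw [zero_add]
    calc ν (Prod.mk a ⁻¹' V) ≤ ν (U j a) := measure_mono fun y hy => hy j
      _ ≤ ((j : ℝ≥0∞) + 1)⁻¹ := (hUν j a).le
      _ ≤ (j : ℝ≥0∞)⁻¹ := ENNReal.inv_le_inv.2 le_self_add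
      _ ≤ ε := hj.le
  rw [Measure.prod_apply_symm hVm, lintegral_eq_zero_iff (measurable_measure_prodMk_right hVm)] at hV0
  refine measure_mono_null ?_ hV0
  intro y hy h
  refine hy (measure_mono_null ?_ h)
  intro a ha j
  exact hWU j a ha

lemma p4 {X : Type u} {Y : Type*} {E : Type u} [MeasurableSpace X] [TopologicalSpace Y]
    [SecondCountableTopology Y] [MeasurableSpace Y] [BorelSpace Y]
    (hX : ∀ s : Set X, MeasurableSet s) (μ : Measure X) [IsProbabilityMeasure μ]
    (hsing : ∀ x, μ {x} = 0)
    (hadd : ∀ 𝒩 : Set (Set X), #𝒩 < #X → (∀ A ∈ 𝒩, μ A = 0) → μ (⋃₀ 𝒩) = 0)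
    (ν : Measure Y) [IsFiniteMeasure ν] [ν.OuterRegular]
    (hE : #E < #X) (π : E → Y) (T : X → Set E) (hT : ∀ x, ν (π '' T x) ≠ 0)
    (hTT : ∀ x y, x ≠ y → ν (π '' (T x ∩ T y)) = 0) : False := by
  classical
  set A : X → Set Y := fun x => {y | μ {z | y ∈ (if z = x then ∅ else π '' (T x ∩ T z))} ≠ 0}
  have hA : ∀ x, ν (A x) = 0 := by
    intro x
    refine kunen_null hX μ ν _ fun z => ?_
    split_ifs with h
    · simp
    · exact hTT x z (Ne.symm h)
  have hB := kunen_null hX μ ν A hA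
  have hS : μ (⋃₀ (range fun e : {e : E // μ {x | e ∈ T x} = 0} => {x | e.1 ∈ T x})) = 0 := by
    refine hadd _ (lt_of_le_of_lt (mk_range_le.trans (mk_subtype_le _)) hE) ?_
    rintro _ ⟨e, rfl⟩
    exact e.2
  have : ∃ x, x ∉ (⋃₀ (range fun e : {e : E // μ {x | e ∈ T x} = 0} => {x | e.1 ∈ T x})) := by
    by_contra! h
    rw [eq_univ_of_forall h] at hS
    simp at hS
  obtain ⟨x, hx⟩ := this
  refine hT x (measure_mono_null ?_ hB)
  rintro _ ⟨e, he, rfl⟩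
  have hpe : μ {x | e ∈ T x} ≠ 0 := by
    intro h
    exact hx ⟨_, ⟨⟨e, h⟩, rfl⟩, he⟩
  intro h0
  refine hpe (measure_mono_null ?_ h0)
  intro z hz h1
  refine hpe (measure_mono_null ?_ (measure_union_null h1 (hsing z)))
  intro w hw
  by_cases hwz : w = z
  · right; exact hwz
  · left
    simp only [mem_ofPred_eq, if_neg hwz]
    exact ⟨e, ⟨hz, hw⟩, rfl⟩

/-- Separable Gitik–Shelah. -/
lemma gitik_shelah_sep {X : Type u} [MeasurableSpace X]
    (hX : ∀ s : Set X, MeasurableSet s) (μ : Measure X) [IsProbabilityMeasure μ]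
    (hsing : ∀ x, μ {x} = 0)
    (hatom : ∀ A : Set X, 0 < μ A → ∃ B ⊆ A, 0 < μ B ∧ μ B < μ A)
    (hadd : ∀ 𝒩 : Set (Set X), #𝒩 < #X → (∀ A ∈ 𝒩, μ A = 0) → μ (⋃₀ 𝒩) = 0)
    (f : X → (ℕ → Bool))
    (hf : ∀ A : Set X, ∃ D : Set (ℕ → Bool), MeasurableSet D ∧ μ (A ∆ (f ⁻¹' D)) = 0) : False := by
  classical
  have hfm : Measurable f := fun s _ => hX _
  have hadd' : ∀ {ι : Type u} (p : ι → Set X), #ι < #X → (∀ i, μ (p i) = 0) → μ (⋃ i, p i) = 0 := by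
    intro ι p h1 h2
    rw [← sUnion_range]
    refine hadd _ (mk_range_le.trans_lt h1) ?_
    rintro _ ⟨i, rfl⟩
    exact h2 i
  -- injection into Cantor space
  have hfib : ∀ y, μ (f ⁻¹' {y}) = 0 := by
    intro y
    by_contra h
    obtain ⟨B, hB, hB0, hB1⟩ := hatom _ (pos_iff_ne_zero.2 h)
    obtain ⟨D, hD, hBD⟩ := hf B
    by_cases hy : y ∈ D
    · refine hB1.not_ge ?_
      calc μ (f ⁻¹' {y}) ≤ μ (B ∪ B ∆ (f ⁻¹' D)) := by
            refine measure_mono fun x hx => ?_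
            by_cases hxB : x ∈ B
            · left; exact hxB
            · right; right
              refine ⟨?_, hxB⟩
              have : f x = y := hx
              simpa [this] using hy
        _ ≤ μ B + μ (B ∆ (f ⁻¹' D)) := measure_union_le _ _
        _ = μ B := by rw [hBD, add_zero]
    · refine hB0.ne' (measure_mono_null ?_ hBD)
      intro x hx
      left
      refine ⟨hx, ?_⟩
      have : f x = y := hB hx
      simpa [this] using hy
  obtain ⟨ι⟩ : Nonempty (X ↪ (ℕ → Bool)) := by
    rw [← Cardinal.lift_mk_le']
    by_contra h
    rw [not_le] at h
    have h2 : μ (⋃ i : ULift.{u} (ℕ → Bool), f ⁻¹' {i.down}) = 0 := by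
      refine hadd' _ ?_ fun i => hfib _
      simpa using h
    have : (⋃ i : ULift.{u} (ℕ → Bool), f ⁻¹' {i.down}) = Set.univ := by
      ext x; simp only [mem_iUnion, mem_univ, iff_true]
      exact ⟨⟨f x⟩, rfl⟩
    rw [this] at h2
    simp at h2
  -- initial segments
  obtain ⟨I, hI, hIμ⟩ : ∃ I : X → Set X, (∀ x, #(I x) < #X) ∧ ∀ b, μ {d | b ∉ I d} = 0 := by
    obtain ⟨r, hwo, hr⟩ := Cardinal.exists_ord_eq X
    have hlt : ∀ x, #{y | r y x} < #X := fun x => by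
      have := Ordinal.typein_lt_type r x
      rw [← hr, Cardinal.lt_ord] at this
      exact this
    refine ⟨fun x => {y | r y x}, hlt, fun b => ?_⟩
    have h1 : μ {y | r y b} = 0 := by
      have : {y | r y b} = ⋃ i : {y | r y b}, {i.1} := by ext y; simp
      rw [this]
      exact hadd' _ (hlt b) fun i => hsing _
    refine measure_mono_null ?_ (measure_union_null h1 (hsing b))
    intro d hd
    rcases trichotomous_of r b d with h | h | h
    · exact absurd h hd
    · right; exact h.symm
    · left; exact h
  have hinf : ℵ₀ ≤ #X := by
    by_contra! h
    have : Finite X := Cardinal.lt_aleph0_iff_finite.1 h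
    have h2 : μ (⋃ x : X, {x}) = 0 := measure_iUnion_null fun x => hsing x
    rw [iUnion_of_singleton] at h2
    simp at h2
  -- Borel representatives
  set ν : Measure (ℕ → Bool) := μ.map f
  have : IsProbabilityMeasure ν := Measure.isProbabilityMeasure_map hfm.aemeasurable
  have hrep : ∀ g : X → X, ∃ G : (ℕ → Bool) → (ℕ → Bool), Measurable G ∧
      μ {x | ι (g x) ≠ G (f x)} = 0 := by
    intro g
    choose D hD hD0 using fun k : ℕ => hf {x | ι (g x) k = true}
    refine ⟨fun y k => decide (y ∈ D k), ?_, ?_⟩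
    · refine measurable_pi_lambda _ fun k => ?_
      exact measurable_to_bool (by simpa [preimage] using hD k)
    · refine measure_mono_null ?_ (measure_iUnion_null hD0)
      intro x hx
      by_contra h
      simp only [mem_iUnion, not_exists] at h
      refine hx (funext fun k => ?_)
      have := h k
      simp only [mem_symmDiff, mem_ofPred_eq, mem_preimage] at this
      by_cases h1 : f x ∈ D k <;> simp_all
  choose G hGm hG using hrep
  have hδ : ∀ g : X → X, ∃ d, ν (f '' {a | ι (g a) = G g (f a) ∧ a ∈ I d ∧ g a ∈ I d}) ≠ 0 := by
    intro g
    by_contra! h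
    have h1 := kunen_null hX μ ν _ h
    have h2 : μ (f ⁻¹' toMeasurable ν {y | μ {d | y ∈ f '' {a | ι (g a) = G g (f a) ∧ a ∈ I d ∧ g a ∈ I d}} ≠ 0}) = 0 := by
      rw [← Measure.map_apply hfm (measurableSet_toMeasurable _ _), measure_toMeasurable]
      exact h1
    have h3 : (Set.univ : Set X) ⊆ {x | ι (g x) ≠ G g (f x)} ∪ (f ⁻¹' toMeasurable ν {y | μ {d | y ∈ f '' {a | ι (g a) = G g (f a) ∧ a ∈ I d ∧ g a ∈ I d}} ≠ 0}) := by
      intro b _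
      by_cases hb : ι (g b) = G g (f b)
      · right
        refine subset_toMeasurable _ _ ?_
        intro h0
        have : μ (Set.univ : Set X) = 0 := by
          refine measure_mono_null ?_ (measure_union_null h0 (measure_union_null (hIμ b) (hIμ (g b))))
          intro d _
          by_cases h4 : b ∈ I d
          · by_cases h5 : g b ∈ I d
            · left; exact ⟨b, ⟨hb, h4, h5⟩, rfl⟩
            · right; right; exact h5
          · right; left; exact h4
        simp at this
      · left; exact hb
    have := measure_mono_null h3 (measure_union_null (hG g) h2)
    simp at this
  choose δ hδ using hδ
  -- maximal a.e. different family
  obtain ⟨F, hF⟩ := zorn_subset {F : Set (X → X) | F.Pairwise fun g h => μ {x | g x = h x} = 0} (by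
    intro c hc hchain
    refine ⟨⋃₀ c, ?_, fun s hs => subset_sUnion_of_mem hs⟩
    exact (pairwise_sUnion hchain.directedOn).2 fun s hs => hc hs)
  have hFp : F.Pairwise fun g h => μ {x | g x = h x} = 0 := hF.prop
  have hcard : ∀ d, #{g : F // δ g.1 = d} < #X := by
    intro d
    by_contra! h
    obtain ⟨e⟩ := h
    have hinj : ∀ x y, x ≠ y → (e x).1.1 ≠ (e y).1.1 := fun x y hxy h =>
      hxy (e.injective (Subtype.ext (Subtype.ext h)))
    refine p4 (E := I d × I d) hX μ hsing hadd ν ?_ (fun p => f p.1)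
      (fun x => {p | ι ((e x).1.1 p.1) = G (e x).1.1 (f p.1) ∧ (e x).1.1 p.1 = p.2.1}) ?_ ?_
    · rw [mk_prod, lift_id]
      exact mul_lt_of_lt hinf (hI d) (hI d)
    · intro x h0
      refine hδ (e x).1.1 (measure_mono_null ?_ h0)
      rintro _ ⟨a, ⟨h1, h2, h3⟩, rfl⟩
      rw [(e x).2] at h2 h3
      exact ⟨⟨⟨a, h2⟩, ⟨_, h3⟩⟩, ⟨h1, rfl⟩, rfl⟩
    · intro x y hxy
      have hm : MeasurableSet {z | G (e x).1.1 z = G (e y).1.1 z} :=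
        measurableSet_eq_fun (hGm _) (hGm _)
      have : ν {z | G (e x).1.1 z = G (e y).1.1 z} = 0 := by
        rw [Measure.map_apply hfm hm]
        refine measure_mono_null ?_ (measure_union_null (hFp (e x).1.2 (e y).1.2 (hinj x y hxy))
          (measure_union_null (hG (e x).1.1) (hG (e y).1.1)))
        intro a ha
        by_cases h1 : ι ((e x).1.1 a) = G (e x).1.1 (f a)
        · by_cases h2 : ι ((e y).1.1 a) = G (e y).1.1 (f a)
          · left
            have ha' : G (e x).1.1 (f a) = G (e y).1.1 (f a) := ha
            exact ι.injective (by rw [h1, h2, ha'])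
          · right; right; exact h2
        · right; left; exact h1
      refine measure_mono_null ?_ this
      rintro _ ⟨p, ⟨⟨h1, h2⟩, h3, h4⟩, rfl⟩
      show G (e x).1.1 (f p.1) = G (e y).1.1 (f p.1)
      rw [← h1, ← h3, h2, h4]
  have hFcard : #F ≤ #X := by
    have h1 : #F = Cardinal.sum fun d => #{g : F // δ g.1 = d} := by
      rw [← mk_sigma]
      exact mk_congr (Equiv.sigmaFiberEquiv _).symm
    rw [h1]
    calc Cardinal.sum (fun d => #{g : F // δ g.1 = d}) ≤ Cardinal.sum fun _ : X => #X :=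
          sum_le_sum _ _ fun d => (hcard d).le
      _ = #X := by simp [mul_eq_self hinf]
  obtain ⟨e⟩ := hFcard
  have hnew : ∀ a : X, ∃ v : X, ∀ g : F, e g ∈ I a → g.1 a ≠ v := by
    intro a
    by_contra! h
    choose s hs1 hs2 using h
    refine (hI a).not_ge ⟨⟨fun v => ⟨e (s v), hs1 v⟩, ?_⟩⟩
    intro v w hvw
    have : s v = s w := e.injective (Subtype.ext_iff.1 hvw)
    rw [← hs2 v, ← hs2 w, this]
  choose g hg using hnew
  have hgF : ∀ h ∈ F, μ {x | g x = h x} = 0 := by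
    intro h hh
    refine measure_mono_null ?_ (hIμ (e ⟨h, hh⟩))
    intro x hx h1
    exact hg x ⟨h, hh⟩ h1 (Eq.symm hx)
  have hgnot : g ∉ F := by
    intro h
    have := hgF g h
    simp at this
  have hins : insert g F ∈ {F : Set (X → X) | F.Pairwise fun g h => μ {x | g x = h x} = 0} := by
    refine (pairwise_insert).2 ⟨hFp, fun h hh _ => ⟨hgF h hh, ?_⟩⟩
    simpa only [eq_comm] using hgF h hh
  exact hgnot (hF.le_of_ge hins (subset_insert g F) (mem_insert g F))

lemma sections_countable {Z X : Type*} [MeasurableSpace Z] [MeasurableSpace X]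
    (E : Set (Z × X)) (hE : MeasurableSet E) :
    ∃ 𝒮 : Set (Set X), 𝒮.Countable ∧
      ∀ z, MeasurableSet[MeasurableSpace.generateFrom 𝒮] {x | (z, x) ∈ E} := by
  rw [← generateFrom_prod] at hE
  induction E, hE using MeasurableSpace.generateFrom_induction with
  | hC E hE _ =>
    obtain ⟨s, hs, t, ht, rfl⟩ := hE
    refine ⟨{t}, countable_singleton _, fun z => ?_⟩
    by_cases hz : z ∈ s
    · have : {x | (z, x) ∈ s ×ˢ t} = t := by ext x; simp [hz]
      rw [this]; exact MeasurableSpace.measurableSet_generateFrom rfl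
    · have : {x | (z, x) ∈ s ×ˢ t} = ∅ := by ext x; simp [hz]
      rw [this]; exact @MeasurableSet.empty _ (MeasurableSpace.generateFrom {t})
  | empty => 
    refine ⟨∅, countable_empty, fun z => ?_⟩
    have : {x : X | (z, x) ∈ (∅ : Set (Z × X))} = ∅ := by ext x; simp
    rw [this]; exact @MeasurableSet.empty _ (MeasurableSpace.generateFrom ∅)
  | compl E _ ih =>
    obtain ⟨S, hS, h⟩ := ih
    exact ⟨S, hS, fun z => @MeasurableSet.compl _ _ (MeasurableSpace.generateFrom S) (h z)⟩
  | iUnion E _ ih =>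
    choose S hS h using ih
    refine ⟨⋃ n, S n, countable_iUnion hS, fun z => ?_⟩
    have : {x | (z, x) ∈ ⋃ n, E n} = ⋃ n, {x | (z, x) ∈ E n} := by ext x; simp
    rw [this]
    refine @MeasurableSet.iUnion _ _ (MeasurableSpace.generateFrom (⋃ n, S n)) _ _ fun n => ?_
    exact MeasurableSpace.generateFrom_mono (subset_iUnion S n) _ (h n z)

lemma rule_coding {X : Type u} [MeasurableSpace X] (L : LearningRule X) :
    ∃ f : X → (ℕ → Bool), ∀ n σ, ∃ D, MeasurableSet D ∧
      {x | L.classify n σ x = true} = f ⁻¹' D := by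
  have h : ∀ n, ∃ 𝒮 : Set (Set X), 𝒮.Countable ∧ ∀ z : Fin n → X × Bool,
      MeasurableSet[MeasurableSpace.generateFrom 𝒮] {x | L.classify n z x = true} := by
    intro n
    have hE : MeasurableSet {q : (Fin n → X × Bool) × X | L.classify n q.1 q.2 = true} :=
      L.measurable n (measurableSet_singleton true)
    obtain ⟨S, hS, h⟩ := sections_countable _ hE
    exact ⟨S, hS, h⟩
  choose S hS h using h
  have hc : (insert Set.univ (⋃ n, S n)).Countable := (countable_iUnion hS).insert _
  obtain ⟨s, hs⟩ := hc.exists_eq_range (insert_nonempty _ _)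
  classical
  let f : X → (ℕ → Bool) := fun x k => decide (x ∈ s k)
  refine ⟨f, fun n σ => ?_⟩
  have hle : MeasurableSpace.generateFrom (S n) ≤ MeasurableSpace.comap f inferInstance := by
    refine MeasurableSpace.generateFrom_le fun t ht => ?_
    have : t ∈ range s := hs ▸ mem_insert_of_mem _ (mem_iUnion_of_mem n ht)
    obtain ⟨k, rfl⟩ := this
    refine ⟨(fun y : ℕ → Bool => y k) ⁻¹' {true}, measurable_pi_apply k (measurableSet_singleton true), ?_⟩
    ext x; simp [f]
  obtain ⟨D, hD, hD'⟩ := hle _ (h n σ)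
  exact ⟨D, hD, hD'.symm⟩

open Classical in
lemma labelMeasure_ind {X : Type u} [MeasurableSpace X] (hX : ∀ s : Set X, MeasurableSet s)
    (μ : Measure X) (A : Set X) :
    labelMeasure μ (fun x => if x ∈ A then 1 else 0) = μ.map (fun x => (x, decide (x ∈ A))) := by
  have hm : Measurable (fun x => (x, decide (x ∈ A)) : X → X × Bool) := fun s _ => hX _
  rw [labelMeasure, ← Measure.bind_dirac_eq_map _ hm]
  congr 1
  funext x
  by_cases h : x ∈ A <;> simp [h]

lemma approx_one {X : Type u} [MeasurableSpace X] (hX : ∀ s : Set X, MeasurableSet s)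
    (μ : Measure X) [IsProbabilityMeasure μ] (L : LearningRule X)
    (hL : ∀ η : X → ℝ, Measurable η → (∀ x, η x ∈ Set.Icc (0 : ℝ) 1) → ConsistentFor L μ η)
    (A : Set X) (ε : ℝ≥0∞) (hε : 0 < ε) :
    ∃ n σ, μ (A ∆ {x | L.classify n σ x = true}) ≤ ε := by
  classical
  have h := hL (fun x => if x ∈ A then 1 else 0) (fun s _ => hX _)
    (fun x => by by_cases h : x ∈ A <;> simp [h])
  have hm : Measurable (fun x => (x, decide (x ∈ A)) : X → X × Bool) := fun s _ => hX _
  have hlab := labelMeasure_ind hX μ A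
  unfold ConsistentFor at h
  have hlab' : labelMeasure μ (fun x => if x ∈ A then 1 else 0) = μ.map (fun x => (x, decide (x ∈ A))) := by
    convert hlab
  rw [hlab'] at h
  set ν := μ.map (fun x => (x, decide (x ∈ A))) with hν
  haveI : IsProbabilityMeasure ν := Measure.isProbabilityMeasure_map hm.aemeasurable
  have hmT : ∀ T : X → Bool, MeasurableSet {p : X × Bool | T p.1 ≠ p.2} := by
    intro T
    have hT : Measurable T := fun s _ => hX _
    exact (measurableSet_eq_fun (hT.comp measurable_fst) measurable_snd).compl
  have hb : bayesError ν = 0 := by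
    refine le_antisymm ?_ bot_le
    refine (iInf₂_le (fun x => decide (x ∈ A)) (fun s _ => hX _)).trans ?_
    rw [hν, Measure.map_apply hm (hmT (fun x => decide (x ∈ A)))]
    simp
  rw [hb] at h
  obtain ⟨n, hn⟩ := (h.eventually (gt_mem_nhds hε)).exists
  have hms : MeasurableSet {q : (Fin n → X × Bool) × (X × Bool) | L.classify n q.1 q.2.1 ≠ q.2.2} := by
    have h1 : Measurable fun q : (Fin n → X × Bool) × (X × Bool) => L.classify n q.1 q.2.1 :=
      (L.measurable n).comp (measurable_fst.prodMk (measurable_fst.comp measurable_snd))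
    exact (measurableSet_eq_fun h1 (measurable_snd.comp measurable_snd)).compl
  rw [ruleError, Measure.prod_apply hms] at hn
  obtain ⟨σ, hσ⟩ := exists_le_lintegral (μ := Measure.pi fun _ : Fin n => ν)
    (measurable_measure_prodMk_left (ν := ν) hms).aemeasurable
  refine ⟨n, σ, le_trans (le_of_eq ?_) (hσ.trans hn.le)⟩
  have : Prod.mk σ ⁻¹' {q : (Fin n → X × Bool) × (X × Bool) | L.classify n q.1 q.2.1 ≠ q.2.2}
      = {p : X × Bool | L.classify n σ p.1 ≠ p.2} := rfl
  rw [this, hν, Measure.map_apply hm (hmT _)]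
  congr 1
  ext x
  by_cases hx : x ∈ A <;> simp [hx, Set.mem_symmDiff]

lemma approx_all {X : Type u} [MeasurableSpace X] (hX : ∀ s : Set X, MeasurableSet s)
    (μ : Measure X) [IsProbabilityMeasure μ] (L : LearningRule X)
    (hL : ∀ η : X → ℝ, Measurable η → (∀ x, η x ∈ Set.Icc (0 : ℝ) 1) → ConsistentFor L μ η) :
    ∃ f : X → (ℕ → Bool), ∀ A : Set X, ∃ D, MeasurableSet D ∧ μ (A ∆ (f ⁻¹' D)) = 0 := by
  obtain ⟨f, hf⟩ := rule_coding L
  refine ⟨f, fun A => ?_⟩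
  have h : ∀ k : ℕ, ∃ D, MeasurableSet D ∧ μ (A ∆ (f ⁻¹' D)) ≤ (2⁻¹ : ℝ≥0∞) ^ k := by
    intro k
    obtain ⟨n, σ, h⟩ := approx_one hX μ L hL A ((2⁻¹ : ℝ≥0∞) ^ k)
      (by apply ENNReal.pow_pos; simp)
    obtain ⟨D, hD, hD'⟩ := hf n σ
    exact ⟨D, hD, hD' ▸ h⟩
  choose D hD h using h
  refine ⟨⋂ N, ⋃ k ≥ N, D k, MeasurableSet.iInter fun N => MeasurableSet.iUnion fun k =>
    MeasurableSet.iUnion fun _ => hD k, ?_⟩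
  have hsum : ∑' k, μ (A ∆ (f ⁻¹' (D k))) ≠ ∞ := by
    refine ne_top_of_le_ne_top ?_ (ENNReal.tsum_le_tsum h)
    rw [ENNReal.tsum_geometric]; simp
  have h0 := ae_eventually_notMem hsum
  refine measure_mono_null (fun x hx => ?_) (ae_iff.mp h0)
  simp only [mem_ofPred_eq]
  intro hev
  obtain ⟨N, hN⟩ := eventually_atTop.mp hev
  have hN' : ∀ k ≥ N, (x ∈ A ↔ f x ∈ D k) := by
    intro k hk
    have := hN k hk
    simp only [Set.mem_symmDiff, mem_preimage] at this
    tauto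
  rw [Set.mem_symmDiff] at hx
  simp only [mem_preimage, mem_iInter, mem_iUnion, exists_prop] at hx
  rcases hx with ⟨hA, hx⟩ | ⟨hx, hA⟩
  · apply hx
    intro M
    exact ⟨max M N, le_max_left _ _, (hN' _ (le_max_right _ _)).mp hA⟩
  · obtain ⟨k, hk, hkx⟩ := hx N
    exact hA ((hN' k hk).mpr hkx)

/-- **Corollary.** Let `τ` be an atomlessly measurable cardinal, with a witnessing
atomless probability measure `μ` defined on all subsets of `τ` (vanishing on singletons,
null ideal closed under unions of fewer than `τ` members, and atomless: every set of
positive measure has a subset of strictly smaller positive measure).  Then the measure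
space `(τ, 2^τ, μ)` admits no learning rule that is consistent for every measurable
regression function `η : τ → [0,1]`. -/
theorem no_consistent_learningRule_of_atomlesslyMeasurable (τ : Cardinal.{u}) :
    letI : MeasurableSpace τ.out := ⊤
    ∀ μ : Measure τ.out,
      μ Set.univ = 1 →
      (∀ x : τ.out, μ {x} = 0) →
      (∀ A : Set τ.out, 0 < μ A → ∃ B ⊆ A, 0 < μ B ∧ μ B < μ A) →
      (∀ 𝒩 : Set (Set τ.out), #𝒩 < τ → (∀ A ∈ 𝒩, μ A = 0) → μ (⋃₀ 𝒩) = 0) →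
      ¬ ∃ L : LearningRule τ.out,
          ∀ η : τ.out → ℝ, Measurable η → (∀ x, η x ∈ Set.Icc (0 : ℝ) 1) →
            ConsistentFor L μ η := by
  letI : MeasurableSpace τ.out := ⊤
  intro μ h1 hsing hatom hadd ⟨L, hL⟩
  haveI : IsProbabilityMeasure μ := ⟨h1⟩
  have hX : ∀ s : Set τ.out, MeasurableSet s := fun s => MeasurableSpace.measurableSet_top
  obtain ⟨f, hf⟩ := approx_all hX μ L hL
  exact gitik_shelah_sep hX μ hsing hatom (by rw [Cardinal.mk_out]; exact hadd) f hf

end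
end
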